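/- arXiv:0709.0988 — 2 statements merged into one kernel-verified Lean document; each statement's English description precedes it below -/
import Mathlib

section
/- Let d ≥ 1. Let S be a finite abstract simplicial complex with ‖S‖ homeomorphic to S^{2d} (a triangulated 2d-sphere), and let L be an induced subcomplex of S (the set of all faces of S contained in some fixed subset of the vertex set of S) with ‖L‖ homeomorphic to S^{d−1}. Let B be a finite abstract simplicial complex with ‖B‖ homeomorphic to the closed unit ball of ℝ^d (a triangulated d-ball), whose vertex set intersects the vertex set of S exactly in the vertex set of L, and whose boundary complex ∂B equals L, where ∂B consists of all nonempty subsets of those (d−1)-faces of B that are contained in exactly one d-face of B. Then the complex K := S_{≤d} ∪ B is not the d-skeleton of a triangulated 2d-sphere: there is no finite abstract simplicial complex S' with ‖S'‖ homeomorphic to S^{2d} such that S'_{≤d} is simplicially isomorphic to K. -/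
/-- An abstract simplicial complex on vertex type `V`: a collection of nonempty finite
sets (the faces) closed under passing to nonempty subsets. -/
def IsComplex {V : Type} [DecidableEq V] (K : Finset (Finset V)) : Prop :=
  (∀ σ ∈ K, σ.Nonempty) ∧ ∀ σ ∈ K, ∀ τ : Finset V, τ ⊆ σ → τ.Nonempty → τ ∈ K

/-- The geometric realization `‖K‖` of an abstract simplicial complex `K`. -/
def GeomRep {V : Type} [Fintype V] (K : Finset (Finset V)) : Type :=
  {x : V → ℝ // (∀ v, 0 ≤ x v) ∧ (∀ v, x v ≤ 1) ∧ (∑ v, x v) = 1 ∧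
    (Finset.univ.filter fun v => x v ≠ 0) ∈ K}

instance {V : Type} [Fintype V] (K : Finset (Finset V)) : TopologicalSpace (GeomRep K) :=
  instTopologicalSpaceSubtype

/-- The vertex set of a complex. -/
def vertexSet {V : Type} [DecidableEq V] (K : Finset (Finset V)) : Finset V :=
  K.sup id

/-- The boundary complex `∂B` of a `d`-dimensional complex `B`: all nonempty subsets of
those `(d-1)`-faces of `B` that are contained in exactly one `d`-face of `B`. -/
def bdryComplex {V : Type} [DecidableEq V] (B : Finset (Finset V)) (d : ℕ) :
    Finset (Finset V) :=
  B.filter fun ρ => ∃ F ∈ B, F.card = d ∧ ρ ⊆ F ∧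
    (B.filter fun G => F ⊆ G ∧ G.card = d + 1).card = 1

/-! ### Chains modulo two -/

section Chains

variable {X V : Type*}

/-- Prepend a point to every list of a chain. -/
noncomputable def coneMap (x : X) : (List X →₀ ZMod 2) →ₗ[ZMod 2] (List X →₀ ZMod 2) :=
  Finsupp.lmapDomain (ZMod 2) (ZMod 2) (List.cons x)

/-- The boundary of an ordered simplex, given as the list of its vertices. -/
noncomputable def listBdry : List X → (List X →₀ ZMod 2)
  | [] => 0
  | x :: l => Finsupp.single l 1 + coneMap x (listBdry l)

/-- The boundary operator on ordered chains. -/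
noncomputable def bdryL : (List X →₀ ZMod 2) →ₗ[ZMod 2] (List X →₀ ZMod 2) :=
  Finsupp.linearCombination (ZMod 2) listBdry

lemma add_self_chain {I : Type*} (c : I →₀ ZMod 2) : c + c = 0 := by
  ext i; exact CharTwo.add_self_eq_zero _

lemma coneMap_single (x : X) (l : List X) (a : ZMod 2) :
    coneMap x (Finsupp.single l a) = Finsupp.single (x :: l) a := by
  simp [coneMap]

lemma bdryL_single (l : List X) : bdryL (Finsupp.single l 1) = listBdry l := by
  simp [bdryL]

lemma bdryL_coneMap (x : X) (c : List X →₀ ZMod 2) :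
    bdryL (coneMap x c) = c + coneMap x (bdryL c) := by
  have : bdryL ∘ₗ coneMap x = LinearMap.id + coneMap x ∘ₗ bdryL := by
    refine Finsupp.lhom_ext' fun l => LinearMap.ext_ring ?_
    simp [coneMap_single, bdryL_single, listBdry]
  exact LinearMap.congr_fun this c

lemma bdryL_listBdry (l : List X) : bdryL (listBdry l) = 0 := by
  induction l with
  | nil => simp [listBdry]
  | cons x l ih =>
    simp [listBdry, bdryL_coneMap, ih, bdryL_single, add_self_chain]

/-- A linear map sends chains supported in `s` to chains supported in `t` as soon as it does so
on basis elements. -/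
lemma linearCombination_mem_supported {I J : Type*} {s : Set I} {t : Set J}
    {T : I → (J →₀ ZMod 2)} (h : ∀ i ∈ s, T i ∈ Finsupp.supported (ZMod 2) (ZMod 2) t)
    {c : I →₀ ZMod 2} (hc : c ∈ Finsupp.supported (ZMod 2) (ZMod 2) s) :
    Finsupp.linearCombination (ZMod 2) T c ∈ Finsupp.supported (ZMod 2) (ZMod 2) t := by
  rw [Finsupp.linearCombination_apply]
  exact Submodule.sum_mem _ fun i hi => Submodule.smul_mem _ _ (h i (hc hi))

lemma map_mem_supported {I J : Type*} {s : Set I} {t : Set J}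
    {T : (I →₀ ZMod 2) →ₗ[ZMod 2] (J →₀ ZMod 2)}
    (h : ∀ i ∈ s, T (Finsupp.single i 1) ∈ Finsupp.supported (ZMod 2) (ZMod 2) t)
    {c : I →₀ ZMod 2} (hc : c ∈ Finsupp.supported (ZMod 2) (ZMod 2) s) :
    T c ∈ Finsupp.supported (ZMod 2) (ZMod 2) t := by
  have : T = Finsupp.linearCombination (ZMod 2) fun i => T (Finsupp.single i 1) := by
    refine Finsupp.lhom_ext' fun l => LinearMap.ext_ring ?_
    simp
  rw [this]
  exact linearCombination_mem_supported h hc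

/-- Two linear maps that agree on the basis elements in `s` agree on chains supported in `s`. -/
lemma eq_of_mem_supported {I M : Type*} [AddCommMonoid M] [Module (ZMod 2) M] {s : Set I}
    {T T' : (I →₀ ZMod 2) →ₗ[ZMod 2] M}
    (h : ∀ i ∈ s, T (Finsupp.single i 1) = T' (Finsupp.single i 1))
    {c : I →₀ ZMod 2} (hc : c ∈ Finsupp.supported (ZMod 2) (ZMod 2) s) : T c = T' c := by
  rw [Finsupp.supported_eq_span_single] at hc
  induction hc using Submodule.span_induction with
  | mem x hx => obtain ⟨i, hi, rfl⟩ := hx; exact h i hi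
  | zero => simp
  | add x y _ _ hx hy => simp [hx, hy]
  | smul a x _ hx => simp [hx]

lemma single_mem_supported {I : Type*} {s : Set I} {i : I} (h : i ∈ s) :
    Finsupp.single i (1 : ZMod 2) ∈ Finsupp.supported (ZMod 2) (ZMod 2) s :=
  Finsupp.single_mem_supported _ _ h

lemma listBdry_mem_supported (l : List X) :
    listBdry l ∈ Finsupp.supported (ZMod 2) (ZMod 2) {m | m.length + 1 = l.length ∧ m ⊆ l} := by
  induction l with
  | nil => simp [listBdry]
  | cons x l ih =>
    refine Submodule.add_mem _ (single_mem_supported ⟨by simp, by simp⟩) ?_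
    refine map_mem_supported (fun m hm => ?_) ih
    rw [coneMap_single]
    refine single_mem_supported ⟨by simp [hm.1], ?_⟩
    exact List.cons_subset_cons x hm.2

lemma listBdry_deg (l : List X) :
    listBdry l ∈ Finsupp.supported (ZMod 2) (ZMod 2) {m | m.length + 1 = l.length} :=
  Finsupp.supported_mono (fun _ h => h.1) (listBdry_mem_supported l)

section Cone

variable {I : Type*} (bd : I → (I →₀ ZMod 2)) (deg : I → ℕ) (apex : I → X)

/-- Auxiliary recursion for `coneChain`. -/
noncomputable def coneAux : ℕ → I → (List X →₀ ZMod 2)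
  | 0, _ => Finsupp.single [] 1
  | n + 1, i => coneMap (apex i) (Finsupp.linearCombination (ZMod 2) (coneAux n) (bd i))

/-- The map on chains that sends a cell to the cone, with the prescribed apex, over the image of
its boundary. Barycentric subdivision is an instance. -/
noncomputable def coneChain : (I →₀ ZMod 2) →ₗ[ZMod 2] (List X →₀ ZMod 2) :=
  Finsupp.linearCombination (ZMod 2) fun i => coneAux bd apex (deg i) i

variable {bd deg apex}

lemma coneChain_single_zero {i : I} (hi : deg i = 0) :
    coneChain bd deg apex (Finsupp.single i 1) = Finsupp.single [] 1 := by
  simp [coneChain, hi, coneAux]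

lemma coneChain_single_succ
    (hbd : ∀ i, bd i ∈ Finsupp.supported (ZMod 2) (ZMod 2) {j | deg j + 1 = deg i})
    {i : I} (hi : deg i ≠ 0) :
    coneChain bd deg apex (Finsupp.single i 1) =
      coneMap (apex i) (coneChain bd deg apex (bd i)) := by
  obtain ⟨n, hn⟩ := Nat.exists_eq_succ_of_ne_zero hi
  simp only [coneChain, Finsupp.linearCombination_single, hn, coneAux, one_smul]
  congr 1
  refine eq_of_mem_supported (fun j hj => ?_) (hbd i)
  have : deg j = n := by have := hj; simp only [Set.mem_ofPred_eq] at this; omega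
  simp [this]

lemma bdryL_coneChain
    (hbd : ∀ i, bd i ∈ Finsupp.supported (ZMod 2) (ZMod 2) {j | deg j + 1 = deg i})
    (hbb : ∀ i, Finsupp.linearCombination (ZMod 2) bd (bd i) = 0) (c : I →₀ ZMod 2) :
    bdryL (coneChain bd deg apex c) =
      coneChain bd deg apex (Finsupp.linearCombination (ZMod 2) bd c) := by
  have key : ∀ n i, deg i = n → bdryL (coneChain bd deg apex (Finsupp.single i 1)) =
      coneChain bd deg apex (bd i) := by
    intro n
    induction n with
    | zero =>
      intro i hi
      have h0 : bd i = 0 := by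
        have := hbd i
        simpa [hi] using this
      simp [coneChain_single_zero hi, h0, bdryL_single, listBdry]
    | succ n ih =>
      intro i hi
      rw [coneChain_single_succ hbd (by omega), bdryL_coneMap]
      have : bdryL (coneChain bd deg apex (bd i)) =
          coneChain bd deg apex (Finsupp.linearCombination (ZMod 2) bd (bd i)) := by
        refine eq_of_mem_supported (T := bdryL ∘ₗ coneChain bd deg apex)
          (T' := coneChain bd deg apex ∘ₗ Finsupp.linearCombination (ZMod 2) bd)
          (fun j hj => ?_) (hbd i)
        have := ih j (by have := hj; simp only [Set.mem_ofPred_eq] at this; omega)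
        simpa using this
      rw [this, hbb]
      simp
  have : bdryL ∘ₗ coneChain bd deg apex =
      coneChain bd deg apex ∘ₗ Finsupp.linearCombination (ZMod 2) bd := by
    refine Finsupp.lhom_ext' fun i => LinearMap.ext_ring ?_
    simpa using key _ i rfl
  exact LinearMap.congr_fun this c

end Cone

section Unordered

variable [DecidableEq V]

/-- The boundary of an unordered simplex. -/
noncomputable def faceBdry (σ : Finset V) : Finset V →₀ ZMod 2 :=
  ∑ v ∈ σ, Finsupp.single (σ.erase v) 1

/-- The boundary operator on unordered chains. -/
noncomputable def bdryF : (Finset V →₀ ZMod 2) →ₗ[ZMod 2] (Finset V →₀ ZMod 2) :=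
  Finsupp.linearCombination (ZMod 2) faceBdry

/-- The join of a chain with a vertex; degenerate joins are zero. -/
noncomputable def joinF (v : V) : (Finset V →₀ ZMod 2) →ₗ[ZMod 2] (Finset V →₀ ZMod 2) :=
  Finsupp.linearCombination (ZMod 2)
    fun σ => if v ∈ σ then 0 else Finsupp.single (insert v σ) 1

lemma bdryF_single (σ : Finset V) : bdryF (Finsupp.single σ 1) = faceBdry σ := by
  simp [bdryF]

lemma joinF_single (v : V) (σ : Finset V) :
    joinF v (Finsupp.single σ 1) = if v ∈ σ then 0 else Finsupp.single (insert v σ) 1 := by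
  simp [joinF]

lemma bdryF_joinF (v : V) (c : Finset V →₀ ZMod 2) :
    bdryF (joinF v c) = c + joinF v (bdryF c) := by
  have : bdryF ∘ₗ joinF v = LinearMap.id + joinF v ∘ₗ bdryF := by
    refine Finsupp.lhom_ext' fun σ => LinearMap.ext_ring ?_
    simp only [LinearMap.comp_apply, Finsupp.lsingle_apply, LinearMap.add_apply,
      LinearMap.id_apply, bdryF_single, joinF_single, faceBdry, map_sum]
    by_cases hv : v ∈ σ
    · have h : ∀ w ∈ σ, w ≠ v → (if v ∈ σ.erase w then (0 : Finset V →₀ ZMod 2) else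
          Finsupp.single (insert v (σ.erase w)) 1) = 0 := fun w _ hw => by
        simp [hv, hw.symm]
      rw [Finset.sum_eq_single v h (fun h => absurd hv h)]
      simp [hv, Finset.insert_erase hv, add_self_chain]
    · simp only [hv, if_false, bdryF_single, faceBdry]
      rw [Finset.sum_insert hv, Finset.erase_insert hv]
      congr 1
      refine Finset.sum_congr rfl fun w hw => ?_
      have hwv : w ≠ v := fun h => hv (h ▸ hw)
      rw [if_neg (by simp [hv]), Finset.erase_insert_of_ne hwv.symm]
  exact LinearMap.congr_fun this c

lemma bdryF_faceBdry (σ : Finset V) : bdryF (faceBdry σ) = 0 := by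
  induction σ using Finset.induction_on with
  | empty => simp [faceBdry]
  | insert v σ hv ih =>
    have h : faceBdry (insert v σ) = bdryF (joinF v (Finsupp.single σ 1)) := by
      rw [joinF_single, if_neg hv, bdryF_single]
    rw [h, bdryF_joinF, map_add, bdryF_joinF, bdryF_single, ih]
    simp [add_self_chain]

lemma bdryF_bdryF (c : Finset V →₀ ZMod 2) : bdryF (bdryF c) = 0 := by
  have : bdryF ∘ₗ bdryF = (0 : (Finset V →₀ ZMod 2) →ₗ[ZMod 2] (Finset V →₀ ZMod 2)) := by
    refine Finsupp.lhom_ext' fun σ => LinearMap.ext_ring ?_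
    rw [LinearMap.comp_apply, LinearMap.comp_apply, Finsupp.lsingle_apply, bdryF_single,
      bdryF_faceBdry]
    rfl
  exact LinearMap.congr_fun this c

lemma faceBdry_mem_supported (σ : Finset V) :
    faceBdry σ ∈ Finsupp.supported (ZMod 2) (ZMod 2) {τ | τ.card + 1 = σ.card ∧ τ ⊆ σ} :=
  Submodule.sum_mem _ fun v hv => single_mem_supported
    ⟨Finset.card_erase_add_one hv, Finset.erase_subset v σ⟩

lemma faceBdry_deg (σ : Finset V) :
    faceBdry σ ∈ Finsupp.supported (ZMod 2) (ZMod 2) {τ | τ.card + 1 = σ.card} :=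
  Finsupp.supported_mono (fun _ h => h.1) (faceBdry_mem_supported σ)

lemma faceBdry_ne_zero {σ : Finset V} (hσ : σ.Nonempty) : faceBdry σ ≠ 0 := by
  obtain ⟨v, hv⟩ := hσ
  intro h
  have := DFunLike.congr_fun h (σ.erase v)
  simp only [faceBdry, Finsupp.coe_finsetSum, Finset.sum_apply, Finsupp.coe_zero,
    Pi.zero_apply] at this
  rw [Finset.sum_eq_single v] at this
  · simp at this
  · intro w hw hwv
    rw [Finsupp.single_apply, if_neg]
    intro h
    have : v ∈ σ.erase w := by simp [hv, hwv.symm]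
    rw [h] at this
    simp at this
  · exact fun h => absurd hv h

/-- The unordered simplex spanned by the labels of a list of points. -/
noncomputable def labelAux (f : X → V) : List X → (Finset V →₀ ZMod 2)
  | [] => Finsupp.single ∅ 1
  | x :: l => joinF (f x) (labelAux f l)

/-- The chain map from ordered chains of points to unordered chains of labels. -/
noncomputable def labelMap (f : X → V) : (List X →₀ ZMod 2) →ₗ[ZMod 2] (Finset V →₀ ZMod 2) :=
  Finsupp.linearCombination (ZMod 2) (labelAux f)

lemma labelMap_single (f : X → V) (l : List X) :
    labelMap f (Finsupp.single l 1) = labelAux f l := by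
  simp [labelMap]

lemma labelMap_coneMap (f : X → V) (x : X) (c : List X →₀ ZMod 2) :
    labelMap f (coneMap x c) = joinF (f x) (labelMap f c) := by
  have : labelMap f ∘ₗ coneMap x = joinF (f x) ∘ₗ labelMap f := by
    refine Finsupp.lhom_ext' fun l => LinearMap.ext_ring ?_
    simp [coneMap_single, labelMap_single, labelAux]
  exact LinearMap.congr_fun this c

lemma bdryF_labelMap (f : X → V) (c : List X →₀ ZMod 2) :
    bdryF (labelMap f c) = labelMap f (bdryL c) := by
  have : bdryF ∘ₗ labelMap f = labelMap f ∘ₗ bdryL := by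
    refine Finsupp.lhom_ext' fun l => LinearMap.ext_ring ?_
    simp only [LinearMap.comp_apply, Finsupp.lsingle_apply, labelMap_single, bdryL_single]
    induction l with
    | nil => simp [labelAux, listBdry, bdryF_single, faceBdry]
    | cons x l ih =>
      simp [labelAux, listBdry, bdryF_joinF, ih, labelMap_coneMap, labelMap_single]
  exact LinearMap.congr_fun this c

lemma joinF_mem_supported {v : V} {s t : Set (Finset V)}
    (h : ∀ σ ∈ s, v ∉ σ → insert v σ ∈ t) {c : Finset V →₀ ZMod 2}
    (hc : c ∈ Finsupp.supported (ZMod 2) (ZMod 2) s) :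
    joinF v c ∈ Finsupp.supported (ZMod 2) (ZMod 2) t := by
  refine map_mem_supported (fun σ hσ => ?_) hc
  rw [joinF_single]
  split_ifs with hv
  · exact Submodule.zero_mem _
  · exact single_mem_supported (h σ hσ hv)

lemma labelAux_mem_supported (f : X → V) (l : List X) :
    labelAux f l ∈ Finsupp.supported (ZMod 2) (ZMod 2)
      {σ | σ.card = l.length ∧ ∀ v, v ∈ σ ↔ ∃ x ∈ l, f x = v} := by
  induction l with
  | nil => exact single_mem_supported (by simp)
  | cons x l ih =>
    refine joinF_mem_supported (fun σ hσ hv => ?_) ih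
    refine ⟨by rw [Finset.card_insert_of_notMem hv, hσ.1]; simp, fun v => ?_⟩
    simp [hσ.2, eq_comm]

/-- The prism operator between two labellings. -/
noncomputable def prismAux (f g : X → V) : List X → (Finset V →₀ ZMod 2)
  | [] => 0
  | x :: l => joinF (f x) (joinF (g x) (labelAux g l)) + joinF (f x) (prismAux f g l)

/-- The prism operator between two labellings, extended linearly. -/
noncomputable def prism (f g : X → V) : (List X →₀ ZMod 2) →ₗ[ZMod 2] (Finset V →₀ ZMod 2) :=
  Finsupp.linearCombination (ZMod 2) (prismAux f g)

lemma prism_single (f g : X → V) (l : List X) :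
    prism f g (Finsupp.single l 1) = prismAux f g l := by
  simp [prism]

lemma prism_coneMap (f g : X → V) (x : X) (c : List X →₀ ZMod 2) :
    prism f g (coneMap x c) =
      joinF (f x) (joinF (g x) (labelMap g c)) + joinF (f x) (prism f g c) := by
  have : prism f g ∘ₗ coneMap x =
      joinF (f x) ∘ₗ joinF (g x) ∘ₗ labelMap g + joinF (f x) ∘ₗ prism f g := by
    refine Finsupp.lhom_ext' fun l => LinearMap.ext_ring ?_
    simp [coneMap_single, labelMap_single, prism_single, prismAux]
  exact LinearMap.congr_fun this c

lemma bdryF_prism (f g : X → V) (c : List X →₀ ZMod 2) :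
    bdryF (prism f g c) + prism f g (bdryL c) = labelMap f c + labelMap g c := by
  have : bdryF ∘ₗ prism f g + prism f g ∘ₗ bdryL = labelMap f + labelMap g := by
    refine Finsupp.lhom_ext' fun l => LinearMap.ext_ring ?_
    simp only [LinearMap.comp_apply, Finsupp.lsingle_apply, labelMap_single, bdryL_single,
      LinearMap.add_apply, prism_single]
    induction l with
    | nil =>
      simp [labelAux, listBdry, prismAux, add_self_chain]
    | cons x l ih =>
      have h1 : bdryF (prismAux f g l) =
          labelAux f l + labelAux g l + prism f g (listBdry l) := by
        rw [← ih, add_assoc, add_self_chain, add_zero]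
      have h2 : bdryF (labelAux g l) = labelMap g (listBdry l) := by
        rw [← labelMap_single, bdryF_labelMap, bdryL_single]
      simp only [labelAux, listBdry, prismAux, map_add, bdryF_joinF, prism_coneMap, h1, h2,
        prism_single]
      have e : ∀ a b c d e p : Finset V →₀ ZMod 2,
          a + (b + c) + (p + (d + b + e)) + (p + (c + e)) = d + a + (b + b) + (c + c) + (e + e)
            + (p + p) := by
        intros; abel
      rw [e]
      simp [add_self_chain]
  exact LinearMap.congr_fun this c

lemma prismAux_mem_supported (f g : X → V) (l : List X) :
    prismAux f g l ∈ Finsupp.supported (ZMod 2) (ZMod 2)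
      {σ | σ.card = l.length + 1 ∧ ∀ v ∈ σ, ∃ x ∈ l, f x = v ∨ g x = v} := by
  induction l with
  | nil => simp [prismAux]
  | cons x l ih =>
    refine Submodule.add_mem _ ?_ ?_
    · refine joinF_mem_supported (s := {σ | σ.card = l.length + 1 ∧
        ∀ v ∈ σ, ∃ y ∈ x :: l, f y = v ∨ g y = v}) (fun σ hσ hv => ?_)
        (joinF_mem_supported (fun σ hσ hv => ?_) (labelAux_mem_supported g l))
      · refine ⟨by rw [Finset.card_insert_of_notMem hv, hσ.1]; simp, fun v hv => ?_⟩
        rcases Finset.mem_insert.1 hv with rfl | h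
        · exact ⟨x, by simp⟩
        · exact hσ.2 v h
      · refine ⟨by rw [Finset.card_insert_of_notMem hv, hσ.1], fun v hv => ?_⟩
        rcases Finset.mem_insert.1 hv with rfl | h
        · exact ⟨x, by simp⟩
        · obtain ⟨y, hy, rfl⟩ := (hσ.2 v).1 h
          exact ⟨y, by simp [hy]⟩
    · refine joinF_mem_supported (fun σ hσ hv => ?_) ih
      refine ⟨by rw [Finset.card_insert_of_notMem hv, hσ.1]; simp, fun v hv => ?_⟩
      rcases Finset.mem_insert.1 hv with rfl | h
      · exact ⟨x, by simp⟩
      · obtain ⟨y, hy, h⟩ := hσ.2 v h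
        exact ⟨y, by simp [hy], h⟩

end Unordered

end Chains

/-! ### Barycentric subdivision and Sperner's lemma -/

section Subdivision

variable {V : Type*}

/-- The centre of mass of a list of points. -/
noncomputable def listCenter (l : List (V → ℝ)) : V → ℝ :=
  ∑ i : Fin l.length, ((l.length : ℝ)⁻¹) • l[i]

/-- Barycentric subdivision of ordered affine chains. -/
noncomputable def subdivL : (List (V → ℝ) →₀ ZMod 2) →ₗ[ZMod 2] (List (V → ℝ) →₀ ZMod 2) :=
  coneChain listBdry List.length listCenter

lemma bdryL_subdivL (c : List (V → ℝ) →₀ ZMod 2) : bdryL (subdivL c) = subdivL (bdryL c) :=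
  bdryL_coneChain listBdry_deg bdryL_listBdry c

lemma listCenter_mem {C : Set (V → ℝ)} (hC : Convex ℝ C) {l : List (V → ℝ)} (hl : l ≠ [])
    (h : ∀ x ∈ l, x ∈ C) : listCenter l ∈ C := by
  have hpos : 0 < l.length := List.length_pos_of_ne_nil hl
  refine hC.sum_mem (fun i _ => by positivity) ?_ (fun i _ => h _ (by simp))
  simp; field_simp

/-- The barycentre of a simplex. -/
noncomputable def baryF [DecidableEq V] (σ : Finset V) : V → ℝ := fun v =>
  if v ∈ σ then (σ.card : ℝ)⁻¹ else 0

/-- The `k + 1`-st barycentric subdivision, as an operator from unordered to ordered chains. -/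
noncomputable def subdivF [DecidableEq V] (k : ℕ) :
    (Finset V →₀ ZMod 2) →ₗ[ZMod 2] (List (V → ℝ) →₀ ZMod 2) :=
  (subdivL ^ k : Module.End (ZMod 2) _) ∘ₗ coneChain faceBdry Finset.card baryF

lemma subdivF_succ [DecidableEq V] (k : ℕ) (c : Finset V →₀ ZMod 2) :
    subdivF (k + 1) c = subdivL (subdivF k c) := by
  simp [subdivF, pow_succ']

lemma bdryL_subdivF [DecidableEq V] (k : ℕ) (c : Finset V →₀ ZMod 2) :
    bdryL (subdivF k c) = subdivF k (bdryF c) := by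
  induction k with
  | zero => exact bdryL_coneChain faceBdry_deg bdryF_faceBdry c
  | succ k ih => rw [subdivF_succ, bdryL_subdivL, ih, subdivF_succ]

variable [Fintype V]

/-- Lists of `n` points of `C` with diameter at most `D`. -/
def smallLists (C : Set (V → ℝ)) (n : ℕ) (D : ℝ) : Set (List (V → ℝ)) :=
  {l | l.length = n ∧ (∀ x ∈ l, x ∈ C) ∧ ∀ x ∈ l, ∀ y ∈ l, dist x y ≤ D}

lemma dist_listCenter_le {l : List (V → ℝ)} {D : ℝ} {x : V → ℝ} (hx : x ∈ l)
    (h : ∀ y ∈ l, dist y x ≤ D) : dist x (listCenter l) ≤ (1 - (l.length : ℝ)⁻¹) * D := by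
  have hl : 0 < l.length := List.length_pos_of_mem hx
  obtain ⟨i₀, hi₀, rfl⟩ := List.getElem_of_mem hx
  have h1 : listCenter l - l[i₀] = ∑ i : Fin l.length, ((l.length : ℝ)⁻¹) • (l[i] - l[i₀]) := by
    simp only [smul_sub, Finset.sum_sub_distrib, listCenter, Finset.sum_const, Finset.card_univ,
      Fintype.card_fin, ← Nat.cast_smul_eq_nsmul ℝ, smul_smul]
    rw [mul_inv_cancel₀ (by positivity), one_smul]
  rw [dist_comm, dist_eq_norm, h1]
  have h2 : ∀ i ∈ Finset.univ.erase (⟨i₀, hi₀⟩ : Fin l.length),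
      ‖((l.length : ℝ)⁻¹) • (l[i] - l[i₀])‖ ≤ (l.length : ℝ)⁻¹ * D := by
    intro i _
    rw [norm_smul, ← dist_eq_norm, Real.norm_of_nonneg (by positivity)]
    exact mul_le_mul_of_nonneg_left (h _ (by simp)) (by positivity)
  rw [← Finset.sum_erase Finset.univ (a := (⟨i₀, hi₀⟩ : Fin l.length)) (by simp)]
  refine (norm_sum_le_of_le _ h2).trans (le_of_eq ?_)
  rw [Finset.sum_const, Finset.card_erase_of_mem (Finset.mem_univ _), Finset.card_univ,
    Fintype.card_fin, nsmul_eq_mul, Nat.cast_sub hl]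
  field_simp
  simp [mul_comm]

lemma subdivL_mem_supported {N : ℕ} {D : ℝ} (hD : 0 ≤ D) (n : ℕ) (hn : n ≤ N)
    {C : Set (V → ℝ)} (hC : Convex ℝ C) {l : List (V → ℝ)} (hl : l ∈ smallLists C n D) :
    subdivL (Finsupp.single l 1) ∈ Finsupp.supported (ZMod 2) (ZMod 2)
      (smallLists C n ((1 - (N : ℝ)⁻¹) * D)) := by
  induction n generalizing C l with
  | zero =>
    obtain rfl : l = [] := List.length_eq_zero_iff.1 hl.1
    rw [subdivL, coneChain_single_zero List.length_nil]
    exact single_mem_supported (by simp [smallLists])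
  | succ n ih =>
    have hl0 : l ≠ [] := by rintro rfl; simp [smallLists] at hl
    rw [subdivL, coneChain_single_succ listBdry_deg (by rw [hl.1]; simp)]
    set b := listCenter l
    have hq : ∀ x ∈ l, dist x b ≤ (1 - (N : ℝ)⁻¹) * D := fun x hx => by
      refine (dist_listCenter_le hx fun y hy => hl.2.2 y hy x hx).trans ?_
      refine mul_le_mul_of_nonneg_right ?_ hD
      rw [hl.1]
      gcongr
    have hq0 : 0 ≤ (1 - (N : ℝ)⁻¹) * D := by
      obtain ⟨x, hx⟩ := List.exists_mem_of_ne_nil l hl0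
      exact dist_nonneg.trans (hq x hx)
    set C' := C ∩ Metric.closedBall b ((1 - (N : ℝ)⁻¹) * D)
    have hC' : Convex ℝ C' := hC.inter (convex_closedBall _ _)
    have key : subdivL (listBdry l) ∈ Finsupp.supported (ZMod 2) (ZMod 2)
        (smallLists C' n ((1 - (N : ℝ)⁻¹) * D)) := by
      refine map_mem_supported (fun m hm => ih (by omega) hC' ?_) (listBdry_mem_supported l)
      refine ⟨by have := hm.1; have := hl.1; omega, fun x hx => ?_, fun x hx y hy => ?_⟩
      · exact ⟨hl.2.1 x (hm.2 hx), hq x (hm.2 hx)⟩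
      · exact hl.2.2 x (hm.2 hx) y (hm.2 hy)
    refine map_mem_supported (fun m hm => ?_) key
    rw [coneMap_single]
    refine single_mem_supported ⟨by simp [hm.1], ?_, ?_⟩
    · intro x hx
      rcases List.mem_cons.1 hx with rfl | hx
      · exact listCenter_mem hC hl0 hl.2.1
      · exact (hm.2.1 x hx).1
    · intro x hx y hy
      rcases List.mem_cons.1 hx with rfl | hx <;> rcases List.mem_cons.1 hy with rfl | hy
      · simpa using hq0
      · rw [dist_comm]; exact (hm.2.1 y hy).2
      · exact (hm.2.1 x hx).2
      · exact hm.2.2 x hx y hy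

/-- The closed geometric simplex spanned by `σ`. -/
def faceSet (σ : Finset V) : Set (V → ℝ) :=
  {x | (∀ v, 0 ≤ x v) ∧ ∑ v, x v = 1 ∧ ∀ v, v ∉ σ → x v = 0}

lemma convex_faceSet (σ : Finset V) : Convex ℝ (faceSet σ) := by
  intro x hx y hy a b ha hb hab
  refine ⟨fun v => ?_, ?_, fun v hv => ?_⟩
  · have := hx.1 v; have := hy.1 v; simp; positivity
  · simp [Finset.sum_add_distrib, ← Finset.mul_sum, hx.2.1, hy.2.1, hab]
  · simp [hx.2.2 v hv, hy.2.2 v hv]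

lemma faceSet_mono {σ τ : Finset V} (h : σ ⊆ τ) : faceSet σ ⊆ faceSet τ :=
  fun _ hx => ⟨hx.1, hx.2.1, fun v hv => hx.2.2 v fun hσ => hv (h hσ)⟩

lemma faceSet_le_one {σ : Finset V} {x : V → ℝ} (hx : x ∈ faceSet σ) (v : V) : x v ≤ 1 := by
  rw [← hx.2.1]
  exact Finset.single_le_sum (fun w _ => hx.1 w) (Finset.mem_univ v)

lemma dist_le_one_of_mem_faceSet {σ : Finset V} {x y : V → ℝ} (hx : x ∈ faceSet σ)
    (hy : y ∈ faceSet σ) : dist x y ≤ 1 := by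
  refine (dist_pi_le_iff zero_le_one).2 fun v => ?_
  rw [Real.dist_eq, abs_le]
  constructor <;> linarith [hx.1 v, hy.1 v, faceSet_le_one hx v, faceSet_le_one hy v]

variable [DecidableEq V]

lemma baryF_mem_faceSet {σ : Finset V} (hσ : σ.Nonempty) : baryF σ ∈ faceSet σ := by
  have : 0 < σ.card := hσ.card_pos
  refine ⟨fun v => ?_, ?_, fun v hv => by simp [baryF, hv]⟩
  · unfold baryF; split_ifs <;> positivity
  · simp [baryF, Finset.sum_ite_mem]; field_simp

/-- The contraction factor of barycentric subdivision. -/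
noncomputable def meshFactor (V : Type*) [Fintype V] : ℝ := 1 - ((Fintype.card V + 1 : ℕ) : ℝ)⁻¹

lemma meshFactor_nonneg (V : Type*) [Fintype V] : 0 ≤ meshFactor V :=
  sub_nonneg.2 (Nat.cast_inv_le_one _)

lemma meshFactor_lt_one (V : Type*) [Fintype V] : meshFactor V < 1 :=
  sub_lt_self _ (by positivity)

lemma subdivF_mem_supported (k : ℕ) (σ : Finset V) :
    subdivF k (Finsupp.single σ 1) ∈ Finsupp.supported (ZMod 2) (ZMod 2)
      (smallLists (faceSet σ) σ.card (meshFactor V ^ k)) := by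
  induction k with
  | zero =>
    obtain ⟨n, hn⟩ : ∃ n, σ.card = n := ⟨_, rfl⟩
    change coneChain faceBdry Finset.card baryF (Finsupp.single σ 1) ∈ _
    induction n generalizing σ with
    | zero =>
      rw [coneChain_single_zero hn]
      exact single_mem_supported (by simp [smallLists, hn])
    | succ n ih =>
      rw [coneChain_single_succ faceBdry_deg (by omega)]
      have hσ : σ.Nonempty := Finset.card_pos.1 (by omega)
      have key : coneChain faceBdry Finset.card baryF (faceBdry σ) ∈
          Finsupp.supported (ZMod 2) (ZMod 2) (smallLists (faceSet σ) n (meshFactor V ^ 0)) := by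
        refine map_mem_supported (fun τ hτ => ?_) (faceBdry_mem_supported σ)
        have hτn : τ.card = n := by have := hτ.1; omega
        refine Finsupp.supported_mono (fun l hl => ?_) (ih τ hτn)
        exact ⟨hl.1.trans hτn, fun x hx => faceSet_mono hτ.2 (hl.2.1 x hx), hl.2.2⟩
      refine map_mem_supported (fun m hm => ?_) key
      rw [coneMap_single]
      have hm' : ∀ x ∈ baryF σ :: m, x ∈ faceSet σ := by
        intro x hx
        rcases List.mem_cons.1 hx with rfl | hx
        · exact baryF_mem_faceSet hσ
        · exact hm.2.1 x hx
      refine single_mem_supported ⟨by simp [hm.1, hn], hm', fun x hx y hy => ?_⟩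
      simpa using dist_le_one_of_mem_faceSet (hm' x hx) (hm' y hy)
  | succ k ih =>
    rw [subdivF_succ]
    refine map_mem_supported (fun l hl => ?_) ih
    rw [pow_succ']
    exact subdivL_mem_supported (pow_nonneg (meshFactor_nonneg V) k) _
      ((Finset.card_le_univ σ).trans (Nat.le_succ _)) (convex_faceSet σ) hl

/-- Sperner's lemma, at the chain level: a labelling whose labels lie in the supports of the
points recovers every simplex from its subdivision. -/
lemma labelMap_subdivF (k : ℕ) {f : (V → ℝ) → V} (σ : Finset V)
    (hf : ∀ x ∈ faceSet σ, x (f x) ≠ 0) :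
    labelMap f (subdivF k (Finsupp.single σ 1)) = Finsupp.single σ 1 := by
  obtain ⟨n, hn⟩ : ∃ n, σ.card = n := ⟨_, rfl⟩
  induction n generalizing σ with
  | zero =>
    obtain rfl := Finset.card_eq_zero.1 hn
    have : subdivF k (Finsupp.single (∅ : Finset V) 1) = Finsupp.single [] 1 := by
      induction k with
      | zero => exact coneChain_single_zero rfl
      | succ k ih => rw [subdivF_succ, ih, subdivL, coneChain_single_zero List.length_nil]
    rw [this, labelMap_single]
    rfl
  | succ n ih =>
    have hσ : σ.Nonempty := Finset.card_pos.1 (by omega)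
    set c := labelMap f (subdivF k (Finsupp.single σ 1)) with hc
    have hsup : c ∈ Finsupp.supported (ZMod 2) (ZMod 2) {σ} := by
      refine map_mem_supported (fun l hl => ?_) (subdivF_mem_supported k σ)
      rw [labelMap_single]
      refine Finsupp.supported_mono (fun τ hτ => ?_) (labelAux_mem_supported f l)
      refine Finset.eq_of_subset_of_card_le (fun v hv => ?_) (by rw [hτ.1, hl.1])
      obtain ⟨x, hx, rfl⟩ := (hτ.2 v).1 hv
      by_contra hv
      exact hf x (hl.2.1 x hx) ((hl.2.1 x hx).2.2 _ hv)
    have hbd : bdryF c = faceBdry σ := by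
      rw [hc, bdryF_labelMap, bdryL_subdivF, bdryF_single]
      refine eq_of_mem_supported (T := labelMap f ∘ₗ subdivF k) (T' := LinearMap.id)
        (fun τ hτ => ?_) (faceBdry_mem_supported σ)
      exact ih τ (fun x hx => hf x (faceSet_mono hτ.2 hx)) (by have := hτ.1; omega)
    obtain ⟨a, ha⟩ : ∃ a, c = Finsupp.single σ a := by
      refine ⟨c σ, ?_⟩
      rw [Finsupp.eq_single_iff]
      exact ⟨fun τ hτ => by simpa using hsup hτ, rfl⟩
    have ha1 : a = 1 := by
      have : a ≠ 0 := by
        rintro rfl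
        rw [ha] at hbd
        simp only [Finsupp.single_zero, map_zero] at hbd
        exact faceBdry_ne_zero hσ hbd.symm
      exact Fin.eq_one_of_ne_zero a this
    rw [ha, ha1]

end Subdivision

/-! ### The Euler characteristic of a contractible complex -/

section Euler

variable {V : Type*} [Fintype V] [DecidableEq V]

lemma card_even_le_card_odd {I : Type*} [Finite I] {s t : Set I}
    (A : (I →₀ ZMod 2) →ₗ[ZMod 2] (I →₀ ZMod 2))
    (hA : ∀ i ∈ s, A (Finsupp.single i 1) ∈ Finsupp.supported (ZMod 2) (ZMod 2) t)
    (hinj : ∀ c ∈ Finsupp.supported (ZMod 2) (ZMod 2) s, A c = 0 → c = 0) :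
    s.ncard ≤ t.ncard := by
  have hfr : ∀ u : Set I, Module.finrank (ZMod 2) (Finsupp.supported (ZMod 2) (ZMod 2) u) =
      u.ncard := fun u => by
    have := Fintype.ofFinite u
    rw [(Finsupp.supportedEquivFinsupp u).finrank_eq, Module.finrank_finsupp_self,
      Set.ncard_eq_toFinset_card', Set.toFinset_card]
  rw [← hfr, ← hfr]
  refine LinearMap.finrank_le_finrank_of_injective
    (f := A.restrict fun c hc => map_mem_supported hA hc) ?_
  refine LinearMap.ker_eq_bot.1 (LinearMap.ker_eq_bot'.2 fun c hc => ?_)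
  exact Subtype.ext (hinj c c.2 (congrArg Subtype.val hc))

/-- A family of simplices whose augmented chain complex is contractible has vanishing reduced
Euler characteristic. -/
lemma sum_neg_one_pow_card_eq_zero {K : Finset (Finset V)}
    (D : (Finset V →₀ ZMod 2) →ₗ[ZMod 2] (Finset V →₀ ZMod 2))
    (hK : ∀ σ ∈ K, ∀ τ ⊆ σ, τ ∈ K)
    (hD : ∀ σ ∈ K, D (Finsupp.single σ 1) ∈
      Finsupp.supported (ZMod 2) (ZMod 2) {τ | τ ∈ K ∧ τ.card = σ.card + 1})
    (hid : ∀ σ ∈ K, bdryF (D (Finsupp.single σ 1)) + D (bdryF (Finsupp.single σ 1)) =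
      Finsupp.single σ 1) :
    ∑ σ ∈ K, (-1 : ℤ) ^ σ.card = 0 := by
  obtain ⟨A, hA⟩ : ∃ A, A = bdryF + D := ⟨_, rfl⟩
  have hDK : ∀ c ∈ Finsupp.supported (ZMod 2) (ZMod 2) {τ | τ ∈ K},
      A (A c) = c + D (D c) := by
    intro c hc
    have h1 : bdryF (D c) + D (bdryF c) = c :=
      eq_of_mem_supported (T := bdryF ∘ₗ D + D ∘ₗ bdryF) (T' := LinearMap.id) hid hc
    rw [hA, LinearMap.add_apply, LinearMap.add_apply, map_add, map_add, bdryF_bdryF, zero_add,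
      ← add_assoc, h1]
  have hinj : ∀ c ∈ Finsupp.supported (ZMod 2) (ZMod 2) {τ | τ ∈ K}, A c = 0 → c = 0 := by
    intro c hc h0
    have hc2 : c = D (D c) := by
      have h1 := hDK c hc
      rw [h0, map_zero] at h1
      calc c = c + (c + D (D c)) := by rw [← h1, add_zero]
        _ = D (D c) := by rw [← add_assoc, add_self_chain, zero_add]
    have hstep : ∀ n, c ∈ Finsupp.supported (ZMod 2) (ZMod 2) {τ | τ ∈ K ∧ n ≤ τ.card} := by
      intro n
      induction n with
      | zero => simpa using hc
      | succ n ih =>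
        rw [hc2]
        have step : ∀ m, ∀ c ∈ Finsupp.supported (ZMod 2) (ZMod 2) {τ | τ ∈ K ∧ m ≤ τ.card},
            D c ∈ Finsupp.supported (ZMod 2) (ZMod 2) {τ | τ ∈ K ∧ m + 1 ≤ τ.card} :=
          fun m c hc => map_mem_supported (fun σ hσ => by
            refine Finsupp.supported_mono (fun τ hτ => ?_) (hD σ hσ.1)
            exact ⟨hτ.1, by rw [hτ.2]; exact Nat.succ_le_succ hσ.2⟩) hc
        refine Finsupp.supported_mono (fun τ hτ => ?_) (step _ _ (step _ _ ih))
        exact ⟨hτ.1, (Nat.le_succ _).trans hτ.2⟩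
    have hempty : {τ : Finset V | τ ∈ K ∧ Fintype.card V + 1 ≤ τ.card} = ∅ :=
      Set.eq_empty_of_forall_notMem fun τ hτ => by
        have h1 := τ.card_le_univ; have h2 := hτ.2; omega
    have := hstep (Fintype.card V + 1)
    rw [hempty] at this
    simpa using this
  have hA' : ∀ p : Prop, ∀ σ ∈ {τ | τ ∈ K ∧ (Even τ.card ↔ p)}, A (Finsupp.single σ 1) ∈
      Finsupp.supported (ZMod 2) (ZMod 2) {τ | τ ∈ K ∧ (Even τ.card ↔ ¬ p)} := by
    intro p σ hσ
    rw [hA, LinearMap.add_apply]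
    refine Submodule.add_mem _ ?_ ?_
    · rw [bdryF_single]
      refine Finsupp.supported_mono (fun τ hτ => ?_) (faceBdry_mem_supported σ)
      refine ⟨hK σ hσ.1 τ hτ.2, ?_⟩
      rw [← hσ.2, ← hτ.1, Nat.even_add_one, not_not]
    · refine Finsupp.supported_mono (fun τ hτ => ?_) (hD σ hσ.1)
      refine ⟨hτ.1, ?_⟩
      rw [← hσ.2, hτ.2, Nat.even_add_one]
  have hle : ∀ p : Prop, {τ | τ ∈ K ∧ (Even τ.card ↔ p)}.ncard ≤
      {τ | τ ∈ K ∧ (Even τ.card ↔ ¬ p)}.ncard := fun p =>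
    card_even_le_card_odd A (hA' p) fun c hc =>
      hinj c (Finsupp.supported_mono (fun _ h => h.1) hc)
  have heq : (K.filter fun τ => Even τ.card).card = (K.filter fun τ => ¬ Even τ.card).card := by
    have h1 := hle True
    have h2 := hle False
    have e1 : {τ | τ ∈ K ∧ (Even τ.card ↔ True)} = ↑(K.filter fun τ => Even τ.card) := by
      ext; simp
    have e2 : {τ | τ ∈ K ∧ (Even τ.card ↔ False)} = ↑(K.filter fun τ => ¬ Even τ.card) := by
      ext; simp
    simp only [not_true_eq_false, not_false_eq_true] at h1 h2
    rw [e1, e2, Set.ncard_coe_finset, Set.ncard_coe_finset] at h1 h2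
    omega
  rw [← Finset.sum_filter_add_sum_filter_not K fun τ => Even τ.card,
    Finset.sum_congr rfl fun τ hτ => (Finset.mem_filter.1 hτ).2.neg_one_pow,
    Finset.sum_congr (g := fun _ => (-1 : ℤ)) rfl
      fun τ hτ => (Nat.not_even_iff_odd.1 (Finset.mem_filter.1 hτ).2).neg_one_pow]
  simp [heq]

end Euler

section Realization

variable {V : Type} [Fintype V]

/-- The geometric realization as a subset of the coordinate space. -/
def geomSet (K : Finset (Finset V)) : Set (V → ℝ) :=
  {x | (∀ v, 0 ≤ x v) ∧ (∀ v, x v ≤ 1) ∧ (∑ v, x v) = 1 ∧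
    (Finset.univ.filter fun v => x v ≠ 0) ∈ K}

/-- The geometric realization is homeomorphic to the corresponding subset. -/
def geomRepHomeo (K : Finset (Finset V)) : GeomRep K ≃ₜ geomSet K :=
  Homeomorph.refl (geomSet K)

lemma geomSet_subset_faceSet {K : Finset (Finset V)} {x : V → ℝ} (hx : x ∈ geomSet K) :
    x ∈ faceSet (Finset.univ.filter fun v => x v ≠ 0) :=
  ⟨hx.1, hx.2.2.1, fun v hv => by simpa using hv⟩

variable [DecidableEq V]

lemma faceSet_subset_geomSet {K : Finset (Finset V)} (hK : IsComplex K) {σ : Finset V}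
    (hσ : σ ∈ K) : faceSet σ ⊆ geomSet K := by
  intro x hx
  refine ⟨hx.1, faceSet_le_one hx, hx.2.1, hK.2 σ hσ _ (fun v hv => ?_) ?_⟩
  · by_contra h
    exact (Finset.mem_filter.1 hv).2 (hx.2.2 v h)
  · by_contra h
    rw [Finset.not_nonempty_iff_eq_empty, Finset.filter_eq_empty_iff] at h
    have h0 : ∀ v, x v = 0 := fun v => by simpa using h (Finset.mem_univ v)
    have := hx.2.1
    simp [h0] at this

lemma geomSet_eq_iUnion {K : Finset (Finset V)} (hK : IsComplex K) :
    geomSet K = ⋃ σ ∈ K, faceSet σ := by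
  refine Set.Subset.antisymm (fun x hx => ?_)
    (Set.iUnion₂_subset fun σ hσ => faceSet_subset_geomSet hK hσ)
  exact Set.mem_iUnion₂.2 ⟨_, hx.2.2.2, geomSet_subset_faceSet hx⟩

lemma isCompact_faceSet {V : Type*} [Fintype V] (σ : Finset V) : IsCompact (faceSet σ) := by
  refine (isCompact_univ_pi fun _ : V => isCompact_Icc (a := (0 : ℝ)) (b := 1)).of_isClosed_subset
    ?_ fun x hx v _ => ⟨hx.1 v, faceSet_le_one hx v⟩
  refine IsClosed.inter (isClosed_le (f := fun _ => (0 : V → ℝ)) (by fun_prop) continuous_id) ?_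
  refine IsClosed.inter (isClosed_eq (by fun_prop) continuous_const) ?_
  have : {x : V → ℝ | ∀ v, v ∉ σ → x v = 0} = ⋂ (v) (_ : v ∉ σ), {x | x v = 0} := by
    ext; simp
  have h2 : IsClosed {x : V → ℝ | ∀ v, v ∉ σ → x v = 0} := by
    rw [this]
    exact isClosed_iInter fun v => isClosed_iInter fun _ =>
      isClosed_eq (continuous_apply v) continuous_const
  exact h2

lemma isCompact_geomSet {K : Finset (Finset V)} (hK : IsComplex K) : IsCompact (geomSet K) := by
  rw [geomSet_eq_iUnion hK]
  exact K.isCompact_biUnion fun σ _ => isCompact_faceSet σ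

lemma exists_inv_card_le {V : Type*} [Fintype V] {x : V → ℝ} (hx : ∑ v, x v = 1) :
    ∃ v, (Fintype.card V : ℝ)⁻¹ ≤ x v := by
  by_contra! h
  have hne : Nonempty V := by
    by_contra hV
    rw [not_nonempty_iff] at hV
    simp at hx
  have := Finset.sum_lt_sum_of_nonempty Finset.univ_nonempty fun v _ => h v
  rw [hx] at this
  simp at this

lemma exists_pow_meshFactor_lt (V : Type*) [Fintype V] {δ : ℝ} (hδ : 0 < δ) :
    ∃ k, meshFactor V ^ k < δ :=
  exists_pow_lt_of_lt_one hδ (meshFactor_lt_one V)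

/-- The reduced Euler characteristic of a contractible complex vanishes. -/
theorem sum_neg_one_pow_card_of_contractible {K : Finset (Finset V)} (hK : IsComplex K)
    [ContractibleSpace (geomSet K)] : ∑ σ ∈ K, (-1 : ℤ) ^ σ.card = -1 := by
  have hcomp : CompactSpace (geomSet K) := isCompact_iff_compactSpace.1 (isCompact_geomSet hK)
  obtain ⟨y₀, ⟨H⟩⟩ := id_nullhomotopic (geomSet K)
  have hN : ∀ x ∈ geomSet K, ∃ v, (Fintype.card V : ℝ)⁻¹ ≤ x v := fun x hx =>
    exists_inv_card_le hx.2.2.1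
  obtain ⟨v₀, -⟩ := hN y₀ y₀.2
  have hVpos : 0 < (Fintype.card V : ℝ) := by
    have : Nonempty V := ⟨v₀⟩
    exact_mod_cast Fintype.card_pos
  have : Nonempty V := ⟨v₀⟩
  choose! φ hφ using hN
  have hφ0 : ∀ x ∈ geomSet K, x (φ x) ≠ 0 := fun x hx =>
    ((inv_pos.2 hVpos).trans_le (hφ x hx)).ne'
  obtain ⟨δ, hδ, hunif⟩ := Metric.uniformContinuous_iff.1
    (CompactSpace.uniformContinuous_of_continuous H.continuous) _ (inv_pos.2 hVpos)
  obtain ⟨k, hk⟩ := exists_pow_meshFactor_lt V hδ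
  obtain ⟨M, hM⟩ := exists_nat_one_div_lt hδ
  set t : ℕ → unitInterval := fun i => Set.projIcc 0 1 zero_le_one ((i : ℝ) * (1 / (M + 1))) with ht
  have ht0 : t 0 = 0 := by simp [ht, unitInterval]
  have ht1 : t (M + 1) = 1 := by
    have : ((M + 1 : ℕ) : ℝ) * (1 / (M + 1)) = 1 := by push_cast; field_simp
    simp only [ht, this]
    exact Set.projIcc_right zero_le_one
  have htd : ∀ i, dist (t i) (t (i + 1)) < δ := fun i => by
    rw [Subtype.dist_eq, Real.dist_eq]
    refine (Set.abs_projIcc_sub_projIcc zero_le_one).trans_lt ?_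
    rw [abs_sub_comm, ← sub_mul]
    push_cast
    rw [add_sub_cancel_left, one_mul, abs_of_nonneg (by positivity)]
    exact hM
  classical
  set f : ℕ → (V → ℝ) → V := fun i x =>
    if h : x ∈ geomSet K then φ (H (t i, ⟨x, h⟩)) else v₀ with hf
  have hclose : ∀ i, ∀ x y : geomSet K, ∀ s, dist x y < δ → dist (t i) s < δ →
      (H (t i, x) : V → ℝ) (φ (H (s, y))) ≠ 0 := by
    intro i x y s hxy hs h0
    have h1 : dist (H (t i, x)) (H (s, y)) < (Fintype.card V : ℝ)⁻¹ :=
      hunif (by rw [Prod.dist_eq]; exact max_lt hs hxy)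
    have h2 := (dist_le_pi_dist (H (t i, x) : V → ℝ) (H (s, y)) (φ (H (s, y)))).trans_lt h1
    rw [h0, Real.dist_eq, zero_sub, abs_neg] at h2
    exact absurd (hφ _ (H (s, y)).2) (not_le.2 ((le_abs_self _).trans_lt h2))
  set w : V := φ y₀
  have hw : {w} ∈ K := hK.2 _ y₀.2.2.2.2 _ (by simpa using hφ0 _ y₀.2) (by simp)
  set Ψ := labelMap (f (M + 1)) ∘ₗ subdivF k
  set D : (Finset V →₀ ZMod 2) →ₗ[ZMod 2] (Finset V →₀ ZMod 2) :=
    (∑ i ∈ Finset.range (M + 1), prism (f i) (f (i + 1)) ∘ₗ subdivF k) + joinF w ∘ₗ Ψ with hDdef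
  have hface : ∀ σ ∈ insert ∅ K, faceSet σ ⊆ geomSet K := by
    intro σ hσ
    rcases Finset.mem_insert.1 hσ with rfl | hσ
    · intro x hx
      have h0 : ∀ v, x v = 0 := fun v => hx.2.2 v (by simp)
      have := hx.2.1
      simp [h0] at this
    · exact faceSet_subset_geomSet hK hσ
  have key := sum_neg_one_pow_card_eq_zero (K := insert ∅ K) D ?_ ?_ ?_
  · rw [Finset.sum_insert (fun h => by simpa using hK.1 _ h)] at key
    simp only [Finset.card_empty, pow_zero] at key
    linarith
  · intro σ hσ τ hτ
    rcases τ.eq_empty_or_nonempty with rfl | hτ0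
    · simp
    · rcases Finset.mem_insert.1 hσ with rfl | hσ
      · simp [Finset.subset_empty.1 hτ]
      · exact Finset.mem_insert_of_mem (hK.2 σ hσ τ hτ hτ0)
  · intro σ hσ
    rw [hDdef, LinearMap.add_apply, LinearMap.sum_apply]
    refine Submodule.add_mem _ (Submodule.sum_mem _ fun i _ => ?_) ?_
    · rw [LinearMap.comp_apply]
      refine map_mem_supported (fun l hl => ?_) (subdivF_mem_supported k σ)
      rw [prism_single]
      refine Finsupp.supported_mono (fun τ hτ => ?_) (prismAux_mem_supported _ _ l)
      refine ⟨Finset.mem_insert_of_mem ?_, by rw [hτ.1, hl.1]⟩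
      have hτ0 : τ.Nonempty := Finset.card_pos.1 (by have := hτ.1; omega)
      obtain ⟨v, hv⟩ := hτ0
      obtain ⟨x, hx, -⟩ := hτ.2 v hv
      have hxK := hface σ hσ (hl.2.1 x hx)
      refine hK.2 _ (H (t i, ⟨x, hxK⟩)).2.2.2.2 τ (fun u hu => ?_) ⟨v, hv⟩
      simp only [Finset.mem_filter, Finset.mem_univ, true_and]
      obtain ⟨y, hy, hyu⟩ := hτ.2 u hu
      have hyK := hface σ hσ (hl.2.1 y hy)
      have hd : dist (⟨x, hxK⟩ : geomSet K) ⟨y, hyK⟩ < δ := (hl.2.2 x hx y hy).trans_lt hk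
      rcases hyu with rfl | rfl
      · simp only [hf, hyK, dif_pos]
        exact hclose i _ _ _ hd (by simpa using hδ)
      · simp only [hf, hyK, dif_pos]
        exact hclose i _ _ _ hd (htd i)
    · refine joinF_mem_supported (fun τ hτ hwτ => ?_)
        (map_mem_supported (T := labelMap (f (M + 1))) (t := {τ | τ.card = σ.card ∧
          ∀ v ∈ τ, v = w}) (fun l hl => ?_) (subdivF_mem_supported k σ))
      · have : τ = ∅ := Finset.eq_empty_of_forall_notMem fun v hv => hwτ (hτ.2 v hv ▸ hv)
        refine ⟨?_, by rw [Finset.card_insert_of_notMem hwτ, hτ.1]⟩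
        rw [this]
        exact Finset.mem_insert_of_mem hw
      · rw [labelMap_single]
        refine Finsupp.supported_mono (fun τ hτ => ?_) (labelAux_mem_supported _ l)
        refine ⟨hτ.1.trans hl.1, fun v hv => ?_⟩
        obtain ⟨x, hx, rfl⟩ := (hτ.2 v).1 hv
        simp [hf, hface σ hσ (hl.2.1 x hx), ht1, w]
  · intro σ hσ
    set e : Finset V →₀ ZMod 2 := Finsupp.single σ 1
    have hΨ : bdryF (Ψ e) = Ψ (bdryF e) := by
      simp [Ψ, bdryF_labelMap, bdryL_subdivF]
    have h1 : ∀ n, (∑ i ∈ Finset.range n, bdryF (prism (f i) (f (i + 1)) (subdivF k e))) +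
        ∑ i ∈ Finset.range n, prism (f i) (f (i + 1)) (subdivF k (bdryF e)) =
        labelMap (f 0) (subdivF k e) + labelMap (f n) (subdivF k e) := by
      intro n
      induction n with
      | zero => simp [add_self_chain]
      | succ n ih =>
        rw [Finset.sum_range_succ, Finset.sum_range_succ, add_add_add_comm, ih,
          ← bdryL_subdivF, bdryF_prism, add_assoc, ← add_assoc (labelMap (f n) _),
          add_self_chain, zero_add]
    have h0 : labelMap (f 0) (subdivF k e) = e := by
      refine labelMap_subdivF k σ fun x hx => ?_
      have hxK := hface σ hσ hx
      simpa [hf, hxK, ht0] using hφ0 x hxK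
    have h2 := h1 (M + 1)
    rw [h0] at h2
    have h3 : labelMap (f (M + 1)) (subdivF k e) = Ψ e := rfl
    rw [h3] at h2
    simp only [hDdef, LinearMap.add_apply, LinearMap.sum_apply, LinearMap.comp_apply, map_add,
      map_sum]
    rw [add_add_add_comm, h2]
    change e + Ψ e + (bdryF (joinF w (Ψ e)) + joinF w (Ψ (bdryF e))) = e
    rw [bdryF_joinF, hΨ, add_assoc (Ψ e), add_self_chain, add_zero, add_assoc, add_self_chain,
      add_zero]

end Realization

/-! ### Brouwer's fixed point theorem -/

section Brouwer

/-- Brouwer's fixed point theorem for a simplex. -/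
theorem exists_fixedPoint_faceSet {V : Type*} [Fintype V] [Nonempty V] {f : (V → ℝ) → V → ℝ}
    (hf : ContinuousOn f (faceSet Finset.univ))
    (hm : Set.MapsTo f (faceSet Finset.univ) (faceSet Finset.univ)) :
    ∃ x ∈ faceSet (Finset.univ : Finset V), f x = x := by
  classical
  have hlab : ∀ x ∈ faceSet (Finset.univ : Finset V), ∃ v, x v ≠ 0 ∧ f x v ≤ x v := by
    intro x hx
    by_contra! h
    have hle : ∀ v, x v ≤ f x v := fun v => by
      by_cases hv : x v = 0
      · rw [hv]; exact (hm hx).1 v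
      · exact (h v hv).le
    obtain ⟨v, hv⟩ : ∃ v, x v ≠ 0 := by
      by_contra! h0
      have := hx.2.1
      simp [h0] at this
    have := Finset.sum_lt_sum (fun v _ => hle v) ⟨v, Finset.mem_univ v, h v hv⟩
    rw [hx.2.1, (hm hx).2.1] at this
    exact lt_irrefl _ this
  choose! lab hlab0 hlab1 using hlab
  have hrain : ∀ k, ∃ l ∈ smallLists (faceSet (Finset.univ : Finset V)) (Fintype.card V)
      (meshFactor V ^ k), ∀ v, ∃ x ∈ l, lab x = v := by
    intro k
    by_contra! h
    have hmem : labelMap lab (subdivF k (Finsupp.single (Finset.univ : Finset V) 1)) ∈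
        Finsupp.supported (ZMod 2) (ZMod 2) {τ : Finset V | τ ≠ Finset.univ} := by
      refine map_mem_supported (fun l hl => ?_) (subdivF_mem_supported k Finset.univ)
      rw [labelMap_single]
      refine Finsupp.supported_mono (fun τ hτ => ?_) (labelAux_mem_supported _ l)
      rintro rfl
      obtain ⟨v, hv⟩ := h l hl
      obtain ⟨x, hx, hxv⟩ := (hτ.2 v).1 (Finset.mem_univ v)
      exact hv x hx hxv
    rw [labelMap_subdivF k _ hlab0] at hmem
    have h1 := hmem (Finset.mem_coe.2 (Finsupp.mem_support_iff.2
      (by simp : (Finsupp.single (Finset.univ : Finset V) (1 : ZMod 2)) Finset.univ ≠ 0)))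
    exact h1 rfl
  choose l hl hrain using hrain
  choose y hy hylab using hrain
  obtain ⟨v₀⟩ := ‹Nonempty V›
  have hyF : ∀ k v, y k v ∈ faceSet (Finset.univ : Finset V) := fun k v =>
    (hl k).2.1 _ (hy k v)
  obtain ⟨x, hx, φ, hφ, hlim⟩ := (isCompact_faceSet (Finset.univ : Finset V)).tendsto_subseq
    fun k => hyF k v₀
  have hmesh : Filter.Tendsto (fun k => meshFactor V ^ φ k) Filter.atTop (nhds 0) :=
    (tendsto_pow_atTop_nhds_zero_of_lt_one (meshFactor_nonneg V) (meshFactor_lt_one V)).comp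
      hφ.tendsto_atTop
  have hylim : ∀ v, Filter.Tendsto (fun k => y (φ k) v) Filter.atTop (nhds x) := fun v =>
    (hlim.congr_dist (squeeze_zero (fun _ => dist_nonneg)
      (fun k => (hl (φ k)).2.2 _ (hy _ v₀) _ (hy _ v)) hmesh))
  have hle : ∀ v, f x v ≤ x v := by
    intro v
    have h1 : Filter.Tendsto (fun k => f (y (φ k) v)) Filter.atTop (nhds (f x)) :=
      (hf x hx).tendsto.comp (tendsto_nhdsWithin_iff.2
        ⟨hylim v, Filter.Eventually.of_forall fun k => hyF _ v⟩)
    refine le_of_tendsto_of_tendsto' (tendsto_pi_nhds.1 h1 v) (tendsto_pi_nhds.1 (hylim v) v)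
      fun k => ?_
    have := hlab1 _ (hyF (φ k) v)
    rwa [hylab] at this
  refine ⟨x, hx, funext fun v => ?_⟩
  refine (Finset.sum_eq_sum_iff_of_le fun v _ => hle v).1 ?_ v (Finset.mem_univ v)
  rw [hx.2.1, (hm hx).2.1]

/-- A simplex around the origin. -/
def cornerSimplex (ι : Type*) [Fintype ι] : Set (ι → ℝ) :=
  {u | (∀ i, -1 ≤ u i) ∧ ∑ i, u i ≤ 1}

variable {ι : Type*} [Fintype ι]

lemma isClosed_cornerSimplex : IsClosed (cornerSimplex ι) :=
  (isClosed_le (f := fun _ => (-1 : ι → ℝ)) continuous_const continuous_id).inter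
    (isClosed_le (f := fun u : ι → ℝ => ∑ i, u i) (by fun_prop) continuous_const)

lemma isCompact_cornerSimplex : IsCompact (cornerSimplex ι) := by
  refine (isCompact_univ_pi fun _ : ι => isCompact_Icc (a := (-1 : ℝ))
    (b := Fintype.card ι + 1)).of_isClosed_subset isClosed_cornerSimplex fun u hu i _ =>
    ⟨hu.1 i, ?_⟩
  have h1 : u i + 1 ≤ ∑ j, (u j + 1) :=
    Finset.single_le_sum (f := fun j => u j + 1) (fun j _ => by linarith [hu.1 j])
      (Finset.mem_univ i)
  simp only [Finset.sum_add_distrib, Finset.sum_const, Finset.card_univ, nsmul_eq_mul,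
    mul_one] at h1
  linarith [hu.2]

lemma cornerSimplex_mem_nhds : cornerSimplex ι ∈ nhds 0 := by
  have h1 : ∀ᶠ u : ι → ℝ in nhds 0, ∀ i, -1 < u i :=
    Filter.eventually_all.2 fun i =>
      (continuous_apply i).continuousAt.eventually (lt_mem_nhds (by simp))
  have h2 : ∀ᶠ u : ι → ℝ in nhds 0, ∑ i, u i < 1 :=
    (by fun_prop : Continuous fun u : ι → ℝ => ∑ i, u i).continuousAt.eventually
      (gt_mem_nhds (by simp))
  filter_upwards [h1, h2] with u h1 h2 using ⟨fun i => (h1 i).le, h2.le⟩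

/-- Brouwer's fixed point theorem for `cornerSimplex`. -/
theorem exists_fixedPoint_cornerSimplex {f : (ι → ℝ) → ι → ℝ}
    (hf : ContinuousOn f (cornerSimplex ι))
    (hm : Set.MapsTo f (cornerSimplex ι) (cornerSimplex ι)) :
    ∃ x ∈ cornerSimplex ι, f x = x := by
  set N : ℝ := Fintype.card ι + 1 with hN
  have hN0 : 0 < N := by positivity
  let p : (Option ι → ℝ) → ι → ℝ := fun x i => N * x (some i) - 1
  let q : (ι → ℝ) → Option ι → ℝ := fun u o => o.elim ((1 - ∑ i, u i) / N) fun i => (u i + 1) / N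
  have hpc : Continuous p := by fun_prop
  have hqc : Continuous q := continuous_pi fun o => by
    cases o
    · change Continuous fun u : ι → ℝ => (1 - ∑ i, u i) / N
      fun_prop
    · change Continuous fun u : ι → ℝ => (u _ + 1) / N
      fun_prop
  have hp : Set.MapsTo p (faceSet Finset.univ) (cornerSimplex ι) := by
    intro x hx
    have h1 := hx.2.1
    rw [Fintype.sum_option] at h1
    refine ⟨fun i => ?_, ?_⟩
    · have := mul_nonneg hN0.le (hx.1 (some i))
      simp only [p]; linarith
    · have := mul_nonneg hN0.le (hx.1 none)
      have h2 : ∑ i, x (some i) = 1 - x none := by linarith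
      simp only [p, Finset.sum_sub_distrib, ← Finset.mul_sum, h2]
      simp only [Finset.sum_const, Finset.card_univ, nsmul_eq_mul, mul_one]
      linarith
  have hq : Set.MapsTo q (cornerSimplex ι) (faceSet Finset.univ) := by
    intro u hu
    refine ⟨fun o => ?_, ?_, fun v hv => absurd (Finset.mem_univ v) hv⟩
    · cases o
      · exact div_nonneg (by linarith [hu.2]) hN0.le
      · exact div_nonneg (by linarith [hu.1 ‹_›]) hN0.le
    · rw [Fintype.sum_option]
      simp only [q, Option.elim, ← Finset.sum_div, Finset.sum_add_distrib, Finset.sum_const,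
        Finset.card_univ, nsmul_eq_mul, mul_one]
      rw [← add_div, div_eq_one_iff_eq hN0.ne']
      linarith
  obtain ⟨x, hx, hfx⟩ := exists_fixedPoint_faceSet (f := q ∘ f ∘ p)
    (hqc.comp_continuousOn (hf.comp hpc.continuousOn hp)) (hq.comp (hm.comp hp))
  refine ⟨p x, hp hx, ?_⟩
  have hpq : ∀ u, p (q u) = u := fun u => funext fun i => by
    simp only [p, q, Option.elim]
    field_simp
    ring
  conv_rhs => rw [← hfx]
  exact (hpq _).symm

end Brouwer

/-! ### Invariance of domain -/

section InvarianceOfDomain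

variable {ι : Type*} [Fintype ι]

/-- A perturbation of a left inverse of a map on `cornerSimplex` has a zero. -/
lemma exists_zero_of_dist_leftInverse_le {c : ℝ}
    (hcC : Metric.closedBall (0 : ι → ℝ) c ⊆ cornerSimplex ι) {f G P : (ι → ℝ) → ι → ℝ}
    (hf : ContinuousOn f (cornerSimplex ι)) (hG : ∀ x ∈ cornerSimplex ι, G (f x) = x)
    (hP : ContinuousOn P (f '' cornerSimplex ι))
    (hPG : ∀ y ∈ f '' cornerSimplex ι, dist (P y) (G y) ≤ c) :
    ∃ y ∈ f '' cornerSimplex ι, P y = 0 := by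
  obtain ⟨x, hx, hfx⟩ := exists_fixedPoint_cornerSimplex (f := fun x => x - P (f x))
    (continuousOn_id.sub (hP.comp hf (Set.mapsTo_image f _))) fun x hx => by
      refine hcC ?_
      rw [mem_closedBall_zero_iff, ← dist_eq_norm]
      have := hPG _ (Set.mem_image_of_mem f hx)
      rwa [hG x hx, dist_comm] at this
  exact ⟨f x, Set.mem_image_of_mem f hx, by simpa using hfx⟩

/-- Approximation of a continuous map on a compact set by a differentiable map avoiding `0` on a
null set. -/
lemma exists_differentiable_approx (G : C(ι → ℝ, ι → ℝ)) {K N : Set (ι → ℝ)}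
    (hK : IsCompact K) (hN : MeasureTheory.volume N = 0) {η : ℝ} (hη : 0 < η) :
    ∃ P : (ι → ℝ) → ι → ℝ, Differentiable ℝ P ∧ (∀ y ∈ N, P y ≠ 0) ∧
      ∀ y ∈ K, dist (P y) (G y) < η := by
  obtain ⟨g, hg, hgG⟩ := (mem_closure_iff_nhds_basis
    (nhds_basis_uniformity
      Metric.uniformity_basis_dist.compactConvergenceUniformity)).1
    (ContinuousMap.dense_setOfPred_contDiff (E := ι → ℝ) (F := ι → ℝ) G) (K, η / 2)
    ⟨hK, half_pos hη⟩
  rw [Set.mem_ofPred_eq] at hg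
  have hgd : Differentiable ℝ g := hg.differentiable (by simp)
  have hnull : MeasureTheory.volume (g '' N) = 0 :=
    MeasureTheory.addHaar_image_eq_zero_of_differentiableOn_of_addHaar_eq_zero _
      hgd.differentiableOn hN
  obtain ⟨w, hw, hwN⟩ : ∃ w ∈ Metric.ball (0 : ι → ℝ) (η / 2), w ∉ g '' N := by
    by_contra! h
    exact (Metric.measure_ball_pos MeasureTheory.volume (0 : ι → ℝ) (half_pos hη)).ne'
      (MeasureTheory.measure_mono_null h hnull)
  refine ⟨fun y => g y - w, hgd.sub_const w, fun y hy h => hwN ⟨y, hy, sub_eq_zero.1 h⟩,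
    fun y hy => ?_⟩
  have h1 : dist (g y) (G y) < η / 2 := by simpa using hgG y hy
  have h2 : dist (g y - w) (g y) < η / 2 := by simpa [dist_eq_norm] using hw
  linarith [dist_triangle (g y - w) (g y) (G y)]

/-- Invariance of domain. -/
theorem image_cornerSimplex_mem_nhds {f : (ι → ℝ) → ι → ℝ}
    (hf : ContinuousOn f (cornerSimplex ι)) (hinj : Set.InjOn f (cornerSimplex ι)) :
    f '' cornerSimplex ι ∈ nhds (f 0) := by
  by_contra hnot
  obtain ⟨c, hc, hcC⟩ := Metric.nhds_basis_closedBall.mem_iff.1 (cornerSimplex_mem_nhds (ι := ι))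
  have h0C : (0 : ι → ℝ) ∈ cornerSimplex ι := mem_of_mem_nhds cornerSimplex_mem_nhds
  have : CompactSpace (cornerSimplex ι) := isCompact_iff_compactSpace.1 isCompact_cornerSimplex
  have hD : IsCompact (f '' cornerSimplex ι) := isCompact_cornerSimplex.image_of_continuousOn hf
  have hemb : Topology.IsClosedEmbedding ((cornerSimplex ι).domRestrict f) :=
    hf.domRestrict.isClosedEmbedding hinj.injective
  obtain ⟨G, hG⟩ := ContinuousMap.exists_extension' hemb ⟨Subtype.val, continuous_subtype_val⟩
  replace hG : ∀ x ∈ cornerSimplex ι, G (f x) = x := fun x hx => congrFun hG ⟨x, hx⟩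
  obtain ⟨r, hr, hGr⟩ := Metric.continuousAt_iff.1 G.continuous.continuousAt (c / 4) (by positivity)
  rw [hG 0 h0C] at hGr
  set ε := r / 2 with hε
  have hε0 : 0 < ε := by positivity
  obtain ⟨p, hpε, hpD⟩ : ∃ p ∈ Metric.ball (f 0) ε, p ∉ f '' cornerSimplex ι := by
    by_contra! h
    exact hnot (Filter.mem_of_superset (Metric.ball_mem_nhds _ hε0) h)
  set K := f '' cornerSimplex ι ∩ {y | ε ≤ dist y p} with hKdef
  have hK : IsCompact K := hD.inter_right (isClosed_le continuous_const (by fun_prop))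
  obtain ⟨δ, hδ, hδK⟩ := hK.exists_forall_le' (f := fun y => ‖G y‖) (a := 0) (by fun_prop) (by
    rintro _ ⟨⟨x, hx, rfl⟩, hxp⟩
    rw [norm_pos_iff, hG x hx]
    rintro rfl
    exact absurd hxp (not_le.2 ((dist_comm _ _).trans_lt hpε)))
  obtain ⟨P, hPd, hPN, hPG⟩ := exists_differentiable_approx G
    (hK.union (isCompact_sphere p ε))
    (MeasureTheory.Measure.addHaar_sphere_of_ne_zero MeasureTheory.volume p hε0.ne')
    (η := min δ (c / 2)) (by positivity)
  set Φ : (ι → ℝ) → ι → ℝ := fun y => p + max (ε / dist y p) 1 • (y - p) with hΦ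
  have hpos : ∀ y ∈ f '' cornerSimplex ι, 0 < dist y p := fun y hy =>
    dist_pos.2 fun h => hpD (h ▸ hy)
  have hΦc : ContinuousOn Φ (f '' cornerSimplex ι) := by
    have h1 : ContinuousOn (fun y => ε / dist y p) (f '' cornerSimplex ι) :=
      continuousOn_const.div (by fun_prop) fun y hy => (hpos y hy).ne'
    exact continuousOn_const.add ((h1.sup continuousOn_const).smul (by fun_prop))
  have hfar : ∀ y ∈ f '' cornerSimplex ι, ε ≤ dist y p → Φ y = y := fun y hy h => by
    rw [hΦ]
    simp only
    rw [max_eq_right ((div_le_one (hpos y hy)).2 h), one_smul, add_sub_cancel]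
  have hnear : ∀ y ∈ f '' cornerSimplex ι, dist y p < ε → Φ y ∈ Metric.sphere p ε :=
    fun y hy h => by
      rw [hΦ, mem_sphere_iff_norm]
      simp only
      rw [max_eq_left ((one_le_div (hpos y hy)).2 h.le), add_sub_cancel_left, norm_smul,
        Real.norm_of_nonneg (by positivity), ← dist_eq_norm, div_mul_cancel₀ _ (hpos y hy).ne']
  obtain ⟨y, hy, hy0⟩ := exists_zero_of_dist_leftInverse_le (P := P ∘ Φ) hcC hf hG
    (hPd.continuous.comp_continuousOn hΦc) fun y hy => by
      rcases le_or_gt ε (dist y p) with h | h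
      · rw [Function.comp_apply, hfar y hy h]
        have h1 := hPG y (Or.inl ⟨hy, h⟩)
        have h2 := min_le_right δ (c / 2)
        linarith
      · have h1 := hPG _ (Or.inr (hnear y hy h))
        have h2 := min_le_right δ (c / 2)
        have h3 : dist p (f 0) < ε := hpε
        have h4 : dist (Φ y) p = ε := hnear y hy h
        have h5 := hGr (x := y) (by linarith [dist_triangle y p (f 0)])
        have h6 := hGr (x := Φ y) (by linarith [dist_triangle (Φ y) p (f 0)])
        rw [Function.comp_apply]
        rw [dist_comm] at h5
        linarith [dist_triangle (P (Φ y)) (G (Φ y)) (G y), dist_triangle (G (Φ y)) 0 (G y)]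
  rcases le_or_gt ε (dist y p) with h | h
  · rw [Function.comp_apply, hfar y hy h] at hy0
    have h1 := hPG y (Or.inl ⟨hy, h⟩)
    rw [hy0, dist_zero_left] at h1
    linarith [hδK y ⟨hy, h⟩, min_le_left δ (c / 2)]
  · exact hPN _ (hnear y hy h) hy0

end InvarianceOfDomain

section Embedding

variable {ι κ : Type*} [Fintype ι] [Fintype κ]

/-- Invariance of domain near the origin. -/
theorem image_mem_nhds_of_injOn (hcard : Fintype.card ι = Fintype.card κ)
    {f : (ι → ℝ) → κ → ℝ} {N : Set (ι → ℝ)} (hN : N ∈ nhds 0) (hf : ContinuousOn f N)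
    (hinj : Set.InjOn f N) : f '' N ∈ nhds (f 0) := by
  obtain ⟨e⟩ := Fintype.card_eq.1 hcard
  obtain ⟨R, hR, hCR⟩ := (isCompact_cornerSimplex (ι := ι)).isBounded.exists_pos_norm_le
  obtain ⟨r, hr, hrN⟩ := Metric.nhds_basis_closedBall.mem_iff.1 hN
  set s : ℝ := r / R with hs
  have hs0 : 0 < s := by positivity
  have hmaps : Set.MapsTo (fun u : ι → ℝ => s • u) (cornerSimplex ι) N := fun u hu => by
    refine hrN ?_
    rw [mem_closedBall_zero_iff, norm_smul, Real.norm_of_nonneg hs0.le]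
    calc s * ‖u‖ ≤ s * R := by gcongr; exact hCR u hu
      _ = r := by rw [hs, div_mul_cancel₀ _ hR.ne']
  let E : (ι → ℝ) ≃ₜ (κ → ℝ) := Homeomorph.piCongrLeft (Y := fun _ => ℝ) e
  have key := image_cornerSimplex_mem_nhds (f := fun u => E.symm (f (s • u)))
    (E.symm.continuous.comp_continuousOn (hf.comp (by fun_prop) hmaps)) (fun u hu v hv h => by
      have := hinj (hmaps hu) (hmaps hv) (E.symm.injective h)
      exact smul_right_injective _ hs0.ne' this)
  have h2 := E.symm.continuous.continuousAt.preimage_mem_nhds (x := f 0) (by simpa using key)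
  have h3 := E.isOpenMap.image_mem_nhds key
  simp only [smul_zero, Homeomorph.apply_symm_apply] at h3
  refine Filter.mem_of_superset h3 ?_
  rintro _ ⟨_, ⟨u, hu, rfl⟩, rfl⟩
  simpa using Set.mem_image_of_mem f (hmaps hu)

/-- There is no continuous injection into a space of smaller dimension. -/
theorem card_le_card_of_injective {f : (ι → ℝ) → κ → ℝ} {N : Set (ι → ℝ)} (hN : N ∈ nhds 0)
    (hf : ContinuousOn f N) (hinj : Set.InjOn f N) : Fintype.card ι ≤ Fintype.card κ := by
  by_contra! hlt
  obtain ⟨e⟩ := Function.Embedding.nonempty_of_card_le hlt.le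
  obtain ⟨i, hi⟩ : ∃ i, i ∉ Set.range e := by
    by_contra! h
    exact hlt.not_ge (Fintype.card_le_of_surjective e h)
  let p : (κ → ℝ) → ι → ℝ := fun x => Function.extend e x 0
  have hp : Continuous p := continuous_pi fun j => by
    by_cases hj : ∃ k, e k = j
    · obtain ⟨k, rfl⟩ := hj
      simp only [p, e.injective.extend_apply]
      fun_prop
    · simp only [p, Function.extend_apply' _ _ _ hj]
      fun_prop
  have hpi : Function.Injective p := fun x y h => funext fun k => by
    simpa [p, e.injective.extend_apply] using congrFun h (e k)
  have key := image_mem_nhds_of_injOn (f := p ∘ f) rfl hN (hp.comp_continuousOn hf)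
    (hpi.comp_injOn hinj)
  have hzero : ∀ x, p x i = 0 := fun x => by
    simp only [p]
    rw [Function.extend_apply' _ _ _ (by simpa using hi)]
    rfl
  obtain ⟨r, hr, hball⟩ := Metric.mem_nhds_iff.1 key
  classical
  obtain ⟨u, -, hu⟩ := hball (a := (p ∘ f) 0 + Pi.single i (r / 2)) (by
    rw [mem_ball_iff_norm, add_sub_cancel_left, Pi.norm_single]
    rw [Real.norm_of_nonneg (by positivity)]
    linarith)
  have := congrFun hu i
  simp only [Function.comp_apply, hzero, Pi.add_apply, Pi.single_eq_same] at this
  linarith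

end Embedding

/-! ### Complexes that embed locally in Euclidean space -/

section LocalStructure

variable {V : Type} [Fintype V]

/-- Every point of the realization has a neighbourhood embedding in `ℝⁿ`. -/
def EmbedsLocally (n : ℕ) (K : Finset (Finset V)) : Prop :=
  ∀ x ∈ geomSet K, ∃ U ∈ nhds x, ∃ j : (V → ℝ) → Fin n → ℝ,
    ContinuousOn j (geomSet K ∩ U) ∧ Set.InjOn j (geomSet K ∩ U)

/-- Through every point of the realization there is an injective image of `ℝⁿ`. -/
def HasCharts (n : ℕ) (K : Finset (Finset V)) : Prop :=
  ∀ x ∈ geomSet K, ∃ i : (Fin n → ℝ) → V → ℝ,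
    Continuous i ∧ Function.Injective i ∧ (∀ u, i u ∈ geomSet K) ∧ i 0 = x

end LocalStructure

section Book

variable {V : Type} [DecidableEq V]

/-- The coordinates, other than that of `e`, of the two-page book with spine `E` and pages
`insert a E`, `insert b E`, relative to the barycentre of `E`. -/
noncomputable def bookAux (E : Finset V) (e : E) (a b : V) (u : E → ℝ) (v : V) : ℝ :=
  if v = e then 0 else if h : v ∈ E then u ⟨v, h⟩ else
    if v = a then max (u e) 0 else if v = b then max (-u e) 0 else 0

variable {E : Finset V} {e : E} {a b : V}

lemma continuous_bookAux : Continuous (bookAux E e a b) := by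
  refine continuous_pi fun v => ?_
  unfold bookAux
  split_ifs <;> fun_prop

variable [Fintype V]

/-- A parametrization of a two-page book. -/
noncomputable def bookMap (E : Finset V) (e : E) (a b : V) (u : E → ℝ) : V → ℝ :=
  baryF E + bookAux E e a b u - (∑ v, bookAux E e a b u v) • Pi.single (e : V) (1 : ℝ)

lemma continuous_bookMap : Continuous (bookMap E e a b) := by
  have := continuous_bookAux (E := E) (e := e) (a := a) (b := b)
  unfold bookMap
  have h2 : Continuous fun u => ∑ v, bookAux E e a b u v :=
    continuous_finsetSum _ fun v _ => (continuous_apply v).comp this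
  exact (continuous_const.add this).sub (h2.smul continuous_const)

lemma bookMap_zero : bookMap E e a b 0 = baryF E := by
  have : bookAux E e a b 0 = 0 := funext fun v => by simp [bookAux]
  simp [bookMap, this]

lemma bookMap_apply_of_ne {u : E → ℝ} {v : V} (hv : v ≠ e) :
    bookMap E e a b u v = baryF E v + bookAux E e a b u v := by
  simp [bookMap, hv]

lemma bookMap_injective (ha : a ∉ E) (hb : b ∉ E) (hab : a ≠ b) :
    Function.Injective (bookMap E e a b) := by
  intro u u' h
  have haux : ∀ v ≠ (e : V), bookAux E e a b u v = bookAux E e a b u' v := fun v hv => by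
    have := congrFun h v
    rwa [bookMap_apply_of_ne hv, bookMap_apply_of_ne hv, add_right_inj] at this
  have hae : a ≠ e := fun h => ha (h ▸ e.2)
  have hbe : b ≠ e := fun h => hb (h ▸ e.2)
  funext v
  by_cases hv : v = e
  · subst hv
    have h1 := haux a hae
    have h2 := haux b hbe
    simp only [bookAux, hae, hbe, ha, hb, hab.symm, if_true, if_false, dif_neg,
      not_false_eq_true] at h1 h2
    rcases le_total (u v) 0 with h3 | h3 <;> rcases le_total (u' v) 0 with h4 | h4 <;>
      simp only [max_eq_left, max_eq_right, h3, h4, neg_nonneg, neg_nonpos] at h1 h2 <;> linarith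
  · have hv' : (v : V) ≠ e := fun h => hv (Subtype.ext h)
    simpa [bookAux, hv'] using haux v hv'

lemma bookMap_apply_of_notMem {u : E → ℝ} {v : V} (hv : v ∉ E) :
    bookMap E e a b u v = if v = a then max (u e) 0 else if v = b then max (-u e) 0 else 0 := by
  have hve : v ≠ e := fun h => hv (h ▸ e.2)
  rw [bookMap_apply_of_ne hve]
  simp [baryF, bookAux, hv, hve]

lemma sum_bookMap (u : E → ℝ) : ∑ v, bookMap E e a b u v = 1 := by
  have := (baryF_mem_faceSet ⟨e, e.2⟩ : baryF E ∈ faceSet E).2.1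
  simp [bookMap, Finset.sum_add_distrib, this, ← Finset.mul_sum]

lemma bookMap_mem_faceSet {u : E → ℝ} (hu : ∀ v ∈ E, 0 ≤ bookMap E e a b u v) :
    bookMap E e a b u ∈ faceSet (insert a E) ∨ bookMap E e a b u ∈ faceSet (insert b E) := by
  have h0 : ∀ v, 0 ≤ bookMap E e a b u v := fun v => by
    by_cases hv : v ∈ E
    · exact hu v hv
    · rw [bookMap_apply_of_notMem hv]
      split_ifs <;> simp
  rcases le_total (u e) 0 with h | h
  · refine Or.inr ⟨h0, sum_bookMap u, fun v hv => ?_⟩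
    rw [Finset.mem_insert, not_or] at hv
    rw [bookMap_apply_of_notMem hv.2, if_neg hv.1]
    simp [h]
  · refine Or.inl ⟨h0, sum_bookMap u, fun v hv => ?_⟩
    rw [Finset.mem_insert, not_or] at hv
    rw [bookMap_apply_of_notMem hv.2, if_neg hv.1]
    simp [h]

/-- In a complex embedding locally in `ℝⁿ`, two `n`-dimensional pages along a common
`(n - 1)`-face contain all other faces around it. -/
theorem EmbedsLocally.subset_of_subset {n : ℕ} {K : Finset (Finset V)} (hn : EmbedsLocally n K)
    (hK : IsComplex K) (hE : E.card = n) (hE0 : E.Nonempty) (ha : a ∉ E) (hb : b ∉ E)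
    (hab : a ≠ b) (haK : insert a E ∈ K) (hbK : insert b E ∈ K) {G : Finset V} (hG : G ∈ K)
    (hEG : E ⊆ G) : G ⊆ insert a E ∨ G ⊆ insert b E := by
  obtain ⟨e₀, he₀⟩ := hE0
  set e : E := ⟨e₀, he₀⟩
  have hEK : E ∈ K := hK.2 G hG E hEG ⟨e₀, he₀⟩
  have hbary : ∀ v ∈ E, 0 < baryF E v := fun v hv => by
    have : 0 < E.card := Finset.card_pos.2 ⟨e₀, he₀⟩
    simp only [baryF, hv, if_true]
    positivity
  have hx : baryF E ∈ geomSet K := faceSet_subset_geomSet hK hEK (baryF_mem_faceSet ⟨e₀, he₀⟩)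
  obtain ⟨U, hU, j, hjc, hji⟩ := hn _ hx
  set π := bookMap E e a b with hπ
  have hπ0 : π 0 = baryF E := bookMap_zero
  have hπK : ∀ u, (∀ v ∈ E, 0 < π u v) → π u ∈ geomSet K := fun u hu => by
    rcases bookMap_mem_faceSet fun v hv => (hu v hv).le with h | h
    · exact faceSet_subset_geomSet hK haK h
    · exact faceSet_subset_geomSet hK hbK h
  set N : Set (E → ℝ) := {u | (∀ v ∈ E, 0 < π u v) ∧ π u ∈ U} with hN
  have hN0 : N ∈ nhds 0 := by
    have h1 : ∀ᶠ u in nhds (0 : E → ℝ), ∀ v ∈ E, 0 < π u v := by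
      refine (Finset.eventually_all E).2 fun v hv => ?_
      refine ((continuous_apply v).comp continuous_bookMap).continuousAt.eventually
        (lt_mem_nhds ?_)
      change 0 < π 0 v
      rw [hπ0]
      exact hbary v hv
    have h2 : ∀ᶠ u in nhds (0 : E → ℝ), π u ∈ U :=
      continuous_bookMap.continuousAt.eventually (by
        change ∀ᶠ y in nhds (π 0), y ∈ U
        rwa [hπ0])
    exact h1.and h2
  have hmaps : Set.MapsTo π N (geomSet K ∩ U) := fun u hu => ⟨hπK u hu.1, hu.2⟩
  have key := image_mem_nhds_of_injOn (f := j ∘ π) (by simp [hE]) hN0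
    (hjc.comp continuous_bookMap.continuousOn hmaps)
    (hji.comp (bookMap_injective ha hb hab).injOn hmaps)
  rw [Function.comp_apply, hπ0] at key
  have hG0 : G.Nonempty := ⟨e₀, hEG he₀⟩
  let y : ℝ → V → ℝ := fun t => (1 - t) • baryF E + t • baryF G
  have hy0 : y 0 = baryF E := by simp [y]
  have hyc : Continuous y := by fun_prop
  have hyK : ∀ t ∈ Set.Icc (0 : ℝ) 1, y t ∈ geomSet K := fun t ht =>
    faceSet_subset_geomSet hK hG (convex_faceSet G (faceSet_mono hEG
      (baryF_mem_faceSet ⟨e₀, he₀⟩)) (baryF_mem_faceSet hG0) (sub_nonneg.2 ht.2) ht.1 (by simp))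
  have hyU : ∀ᶠ t in nhdsWithin (0 : ℝ) (Set.Ioi 0), y t ∈ geomSet K ∩ U := by
    have h1 : ∀ᶠ t in nhdsWithin (0 : ℝ) (Set.Ioi 0), t ∈ Set.Ioc (0 : ℝ) 1 :=
      Ioc_mem_nhdsGT zero_lt_one
    have h2 : ∀ᶠ t in nhdsWithin (0 : ℝ) (Set.Ioi 0), y t ∈ U :=
      (hyc.continuousAt.eventually (by rwa [hy0] : ∀ᶠ z in nhds (y 0), z ∈ U)).filter_mono
        nhdsWithin_le_nhds
    filter_upwards [h1, h2] with t h1 h2 using ⟨hyK t ⟨h1.1.le, h1.2⟩, h2⟩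
  have hjlim : Filter.Tendsto (fun t => j (y t)) (nhdsWithin (0 : ℝ) (Set.Ioi 0))
      (nhds (j (baryF E))) := by
    refine (hjc _ ⟨hx, mem_of_mem_nhds hU⟩).tendsto.comp (tendsto_nhdsWithin_iff.2 ⟨?_, hyU⟩)
    rw [← hy0]
    exact hyc.continuousAt.tendsto.mono_left nhdsWithin_le_nhds
  obtain ⟨t, ⟨⟨u, huN, hut⟩, hyt⟩, ht⟩ :=
    ((hjlim.eventually key).and hyU |>.and self_mem_nhdsWithin).exists
  have hyu : π u = y t := hji (hmaps huN) hyt hut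
  have hsupp : ∀ v ∈ G, π u v ≠ 0 := by
    intro v hv
    by_cases hvE : v ∈ E
    · exact (huN.1 v hvE).ne'
    · rw [hyu]
      have h1 : (G.card : ℝ) ≠ 0 := by exact_mod_cast hG0.card_pos.ne'
      have h2 : t ≠ 0 := (Set.mem_Ioi.1 ht).ne'
      simp [y, baryF, hvE, hv, h1, h2]
  rcases bookMap_mem_faceSet fun v hv => (huN.1 v hv).le with h | h
  · exact Or.inl fun v hv => by_contra fun hv' => hsupp v hv (h.2.2 v hv')
  · exact Or.inr fun v hv => by_contra fun hv' => hsupp v hv (h.2.2 v hv')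

lemma EmbedsLocally.card_le {n : ℕ} (hn0 : n ≠ 0) {K : Finset (Finset V)}
    (hn : EmbedsLocally n K) (hK : IsComplex K) {M : Finset V} (hM : M ∈ K) :
    M.card ≤ n + 1 := by
  by_contra! h
  obtain ⟨E, hEM, hE⟩ := Finset.exists_subset_card_eq (s := M) (n := n) (by omega)
  have h2 : 1 < (M \ E).card := by
    rw [Finset.card_sdiff_of_subset hEM]; omega
  obtain ⟨a, ha, b, hb, hab⟩ := Finset.one_lt_card.1 h2
  rw [Finset.mem_sdiff] at ha hb
  have hmem : ∀ c ∈ M, insert c E ∈ K := fun c hc =>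
    hK.2 M hM _ (Finset.insert_subset hc hEM) (Finset.insert_nonempty _ _)
  rcases hn.subset_of_subset hK hE (Finset.card_pos.1 (by omega)) ha.2 hb.2 hab (hmem a ha.1)
    (hmem b hb.1) hM hEM with h | h
  · rcases Finset.mem_insert.1 (h hb.1) with h | h
    exacts [hab h.symm, hb.2 h]
  · rcases Finset.mem_insert.1 (h ha.1) with h | h
    exacts [hab h, ha.2 h]

/-- Faces of a complex containing a chart of `ℝⁿ` around each point lie in `n`-faces. -/
lemma HasCharts.exists_card_eq {n : ℕ} {K : Finset (Finset V)} (hn : HasCharts n K)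
    (hK : IsComplex K) (hle : ∀ M ∈ K, M.card ≤ n + 1) {σ : Finset V} (hσ : σ ∈ K) :
    ∃ M ∈ K, σ ⊆ M ∧ M.card = n + 1 := by
  obtain ⟨M, hσM, hM⟩ := K.exists_le_maximal hσ
  refine ⟨M, hM.1, hσM, le_antisymm (hle M hM.1) ?_⟩
  have hM0 := hK.1 M hM.1
  obtain ⟨i, hic, hii, hiK, hi0⟩ :=
    hn _ (faceSet_subset_geomSet hK hM.1 (baryF_mem_faceSet hM0))
  obtain ⟨e, he⟩ := hM0
  set N : Set (Fin n → ℝ) := {u | ∀ v ∈ M, i u v ≠ 0} with hN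
  have hN0 : N ∈ nhds 0 := by
    refine (Finset.eventually_all M).2 fun v hv => ?_
    refine ((continuous_apply v).comp hic).continuousAt.eventually_ne ?_
    rw [Function.comp_apply, hi0]
    have : M.card ≠ 0 := (Finset.card_pos.2 ⟨e, he⟩).ne'
    simp [baryF, hv, this]
  have hsupp : ∀ u ∈ N, ∀ v, v ∉ M → i u v = 0 := by
    intro u hu v hv
    by_contra h
    have h1 := (hiK u).2.2.2
    have h2 : M ⊆ Finset.univ.filter fun v => i u v ≠ 0 := fun w hw => by
      simpa using hu w hw
    exact hv (hM.2 h1 h2 (by simpa using h))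
  have key := card_le_card_of_injective (κ := {v // v ∈ M.erase e})
    (f := fun u v => i u v) hN0 (by fun_prop) (fun u hu u' hu' h => by
      refine hii ?_
      have h1 : ∀ v ≠ e, i u v = i u' v := fun v hv => by
        by_cases hvM : v ∈ M
        · exact congrFun h ⟨v, Finset.mem_erase.2 ⟨hv, hvM⟩⟩
        · rw [hsupp u hu v hvM, hsupp u' hu' v hvM]
      funext v
      by_cases hv : v = e
      · subst hv
        have s1 := (hiK u).2.2.1
        have s2 := (hiK u').2.2.1
        rw [← Finset.add_sum_erase _ _ (Finset.mem_univ v)] at s1 s2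
        rw [Finset.sum_congr rfl fun w hw => h1 w (Finset.ne_of_mem_erase hw)] at s1
        linarith
      · exact h1 v hv)
  rw [Fintype.card_fin, Fintype.card_coe, Finset.card_erase_of_mem he] at key
  have := Finset.card_pos.2 ⟨e, he⟩
  omega

end Book

/-! ### Triangulated spheres -/

section Sphere

lemma nonempty_sphere_compl_homeomorph {n : ℕ}
    (p : Metric.sphere (0 : EuclideanSpace ℝ (Fin (n + 1))) 1) :
    Nonempty (({p}ᶜ : Set (Metric.sphere (0 : EuclideanSpace ℝ (Fin (n + 1))) 1)) ≃ₜ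
      (Fin n → ℝ)) := by
  have : Fact (Module.finrank ℝ (EuclideanSpace ℝ (Fin (n + 1))) = n + 1) :=
    ⟨finrank_euclideanSpace_fin⟩
  have e := (stereographic' n p).toHomeomorphSourceTarget
  rw [stereographic'_source, stereographic'_target] at e
  exact ⟨e.trans ((Homeomorph.Set.univ _).trans (EuclideanSpace.equiv (Fin n) ℝ).toHomeomorph)⟩

variable {V : Type} [Fintype V]

/-- The complement of every point of the realization is homeomorphic to `ℝⁿ`. -/
def IsPuncturedEuclidean (n : ℕ) (K : Finset (Finset V)) : Prop :=
  ∀ p ∈ geomSet K, Nonempty ((geomSet K \ {p} : Set (V → ℝ)) ≃ₜ (Fin n → ℝ))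

lemma isPuncturedEuclidean_of_homeomorph {n : ℕ} {K : Finset (Finset V)}
    (h : GeomRep K ≃ₜ Metric.sphere (0 : EuclideanSpace ℝ (Fin (n + 1))) 1) :
    IsPuncturedEuclidean n K := by
  intro p hp
  set g : geomSet K ≃ₜ _ := (geomRepHomeo K).symm.trans h
  obtain ⟨e⟩ := nonempty_sphere_compl_homeomorph (g ⟨p, hp⟩)
  let e₁ : {x : geomSet K // x ≠ ⟨p, hp⟩} ≃ₜ
      {y : Metric.sphere (0 : EuclideanSpace ℝ (Fin (n + 1))) 1 // y ≠ g ⟨p, hp⟩} :=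
    g.subtype fun x => g.injective.ne_iff.symm
  let e₀ : (geomSet K \ {p} : Set (V → ℝ)) ≃ₜ {x : geomSet K // x ≠ ⟨p, hp⟩} :=
    { toFun := fun x => ⟨⟨x, x.2.1⟩, fun h => x.2.2 (congrArg Subtype.val h)⟩
      invFun := fun x => ⟨x, x.1.2, fun h => x.2 (Subtype.ext h)⟩
      left_inv := fun _ => rfl
      right_inv := fun _ => rfl
      continuous_toFun := by fun_prop
      continuous_invFun := by fun_prop }
  exact ⟨(e₀.trans e₁).trans e⟩

lemma embedsLocally_aux {n : ℕ} {K : Finset (Finset V)} {A : Set (V → ℝ)} {x : V → ℝ}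
    {U : Set (V → ℝ)} (hU : U ∈ nhds x) (hUA : geomSet K ∩ U ⊆ A) {f : A → Fin n → ℝ}
    (hf : Continuous f) (hinj : Function.Injective f) :
    ∃ U ∈ nhds x, ∃ j : (V → ℝ) → Fin n → ℝ,
      ContinuousOn j (geomSet K ∩ U) ∧ Set.InjOn j (geomSet K ∩ U) := by
  classical
  refine ⟨U, hU, fun y => if h : y ∈ A then f ⟨y, h⟩ else 0, ?_, fun y hy z hz h => ?_⟩
  · refine ContinuousOn.mono ?_ hUA
    rw [continuousOn_iff_continuous_domRestrict]
    convert hf using 1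
    funext y
    simp
  · simpa [hUA hy, hUA hz, hinj.eq_iff] using h

lemma IsPuncturedEuclidean.embedsLocally {n : ℕ} {K : Finset (Finset V)}
    (h : IsPuncturedEuclidean n K) : EmbedsLocally n K := by
  intro x hx
  obtain ⟨e⟩ := h x hx
  obtain ⟨q, hqK, hqx⟩ := e.symm 0
  obtain ⟨e'⟩ := h q hqK
  exact embedsLocally_aux (A := geomSet K \ {q}) (U := {q}ᶜ)
    (isOpen_compl_singleton.mem_nhds fun h => hqx h.symm)
    (fun _ hy => ⟨hy.1, hy.2⟩) e'.continuous e'.injective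

lemma IsPuncturedEuclidean.hasCharts {n : ℕ} {K : Finset (Finset V)}
    (h : IsPuncturedEuclidean n K) : HasCharts n K := by
  intro x hx
  obtain ⟨e⟩ := h x hx
  obtain ⟨q, hqK, hqx⟩ := e.symm 0
  obtain ⟨e'⟩ := h q hqK
  set u₀ := e' ⟨x, hx, fun h => hqx h.symm⟩ with hu₀
  refine ⟨fun u => e'.symm (u + u₀), by fun_prop, fun u v huv => ?_, fun u => (e'.symm _).2.1, ?_⟩
  · simpa using e'.symm.injective (Subtype.ext huv)
  · simp [hu₀]

lemma embedsLocally_of_homeomorph_closedBall {d : ℕ} {B : Finset (Finset V)}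
    (h : GeomRep B ≃ₜ Metric.closedBall (0 : EuclideanSpace ℝ (Fin d)) 1) :
    EmbedsLocally d B := by
  intro x _
  refine embedsLocally_aux (U := Set.univ) Filter.univ_mem Set.inter_subset_left
    (f := fun y : geomSet B => EuclideanSpace.equiv (Fin d) ℝ (h ((geomRepHomeo B).symm y)))
    ?_ ?_
  · exact (EuclideanSpace.equiv (Fin d) ℝ).continuous.comp
      (continuous_subtype_val.comp (h.continuous.comp (geomRepHomeo B).symm.continuous))
  · intro y z hyz
    exact (geomRepHomeo B).symm.injective
      (h.injective (Subtype.ext ((EuclideanSpace.equiv (Fin d) ℝ).injective hyz)))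

end Sphere

section Retraction

lemma contractibleSpace_of_retraction {X Y : Type*} [TopologicalSpace X] [TopologicalSpace Y]
    [ContractibleSpace X] (i : C(Y, X)) (r : C(X, Y)) (h : r.comp i = ContinuousMap.id Y) :
    ContractibleSpace Y := by
  rw [contractible_iff_id_nullhomotopic, ← h]
  exact ((id_nullhomotopic X).comp_left i).comp_right r

variable {V : Type} [Fintype V]

/-- Radial projection away from the barycentre of a simplex `F`. -/
noncomputable def pushOff (F : Finset V) (hF : F.Nonempty) (y : V → ℝ) : V → ℝ := fun v =>
  (y v - F.inf' hF y * Set.indicator (F : Set V) 1 v) / (1 - F.card * F.inf' hF y)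

variable [DecidableEq V]

lemma card_mul_inf_lt_one {F : Finset V} (hF : F.Nonempty) {y : V → ℝ} {σ : Finset V}
    (hy : y ∈ faceSet σ) (hne : y ≠ baryF F) : F.card * F.inf' hF y < 1 := by
  set μ := F.inf' hF y with hμ
  have hμle : ∀ v ∈ F, μ ≤ y v := fun v hv => Finset.inf'_le _ hv
  have h1 : F.card * μ ≤ ∑ v ∈ F, y v := by
    rw [← nsmul_eq_mul]
    exact Finset.card_nsmul_le_sum _ _ _ hμle
  have h2 : ∑ v ∈ F, y v ≤ 1 := by
    rw [← hy.2.1]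
    exact Finset.sum_le_univ_sum_of_nonneg hy.1
  refine lt_of_le_of_ne (h1.trans h2) fun heq => hne ?_
  have h3 : ∑ v ∈ F, y v = 1 := le_antisymm h2 (heq ▸ h1)
  have hc : (F.card : ℝ) ≠ 0 := by exact_mod_cast hF.card_pos.ne'
  have h4 : ∀ v ∈ F, μ = y v := (Finset.sum_eq_sum_iff_of_le hμle).1 (by
    rw [Finset.sum_const, nsmul_eq_mul, heq, h3])
  have h5 : ∀ v ∉ F, y v = 0 := by
    have h6 := hy.2.1
    rw [← Finset.sum_add_sum_compl F, h3] at h6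
    have h7 : ∑ v ∈ Fᶜ, y v = 0 := by linarith
    rw [Finset.sum_eq_zero_iff_of_nonneg fun v _ => hy.1 v] at h7
    exact fun v hv => h7 v (by simpa using hv)
  funext v
  by_cases hv : v ∈ F
  · rw [← h4 v hv]
    simp only [baryF, hv, if_true]
    exact eq_inv_of_mul_eq_one_right heq
  · simp [baryF, hv, h5 v hv]

lemma pushOff_mem {S : Finset (Finset V)} (hS : IsComplex S) {F : Finset V} (hF : F.Nonempty)
    {y : V → ℝ} (hy : y ∈ geomSet S) (hne : y ≠ baryF F) :
    pushOff F hF y ∈ geomSet (S.filter fun G => ¬ F ⊆ G) := by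
  have hyF := geomSet_subset_faceSet hy
  have hlt := card_mul_inf_lt_one hF hyF hne
  set μ := F.inf' hF y with hμ
  have hpos : 0 < 1 - F.card * μ := by linarith
  obtain ⟨w, hwF, hw⟩ := F.exists_mem_eq_inf' hF y
  have hμ0 : 0 ≤ μ := by rw [hμ, hw]; exact hy.1 w
  have happ : ∀ v, pushOff F hF y v = (y v - μ * Set.indicator (F : Set V) 1 v) /
      (1 - F.card * μ) := fun v => rfl
  have hnn : ∀ v, 0 ≤ pushOff F hF y v := fun v => by
    rw [happ]
    refine div_nonneg ?_ hpos.le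
    by_cases hv : v ∈ F
    · simpa [hv] using Finset.inf'_le y hv
    · simpa [hv] using hy.1 v
  have hsum : ∑ v, pushOff F hF y v = 1 := by
    simp only [happ]
    rw [← Finset.sum_div, Finset.sum_sub_distrib, hy.2.2.1, ← Finset.mul_sum,
      div_eq_one_iff_eq hpos.ne']
    have : ∑ v, Set.indicator (F : Set V) (1 : V → ℝ) v = F.card := by
      simp [Set.indicator_apply]
    rw [this, mul_comm]
  have hsupp : ∀ v, y v = 0 → pushOff F hF y v = 0 := fun v hv => by
    refine le_antisymm ?_ (hnn v)
    rw [happ, hv]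
    refine div_nonpos_of_nonpos_of_nonneg ?_ hpos.le
    have := mul_nonneg hμ0 (Set.indicator_nonneg (s := (F : Set V)) (f := (1 : V → ℝ))
      (fun _ _ => zero_le_one) v)
    linarith
  have hle := faceSet_le_one (σ := Finset.univ) (x := pushOff F hF y)
    ⟨hnn, hsum, fun v hv => absurd (Finset.mem_univ v) hv⟩
  refine ⟨hnn, hle, hsum, Finset.mem_filter.2 ⟨hS.2 _ hy.2.2.2 _ (fun v hv => ?_) ?_, ?_⟩⟩
  · simp only [Finset.mem_filter, Finset.mem_univ, true_and] at hv ⊢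
    exact fun h => hv (hsupp v h)
  · by_contra h
    rw [Finset.not_nonempty_iff_eq_empty, Finset.filter_eq_empty_iff] at h
    rw [Finset.sum_eq_zero fun v hv => by simpa using h hv] at hsum
    exact zero_ne_one hsum
  · intro h
    have := h hwF
    simp [happ, hwF, ← hw, ← hμ] at this

lemma pushOff_eq_self {S : Finset (Finset V)} {F : Finset V} (hF : F.Nonempty)
    {y : V → ℝ} (hy : y ∈ geomSet (S.filter fun G => ¬ F ⊆ G)) : pushOff F hF y = y := by
  obtain ⟨w, hwF, hw⟩ := Finset.not_subset.1 (Finset.mem_filter.1 hy.2.2.2).2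
  have hw0 : y w = 0 := by simpa using hw
  have hμ : F.inf' hF y = 0 :=
    le_antisymm (hw0 ▸ Finset.inf'_le y hwF) ((Finset.le_inf'_iff hF y).2 fun v _ => hy.1 v)
  funext v
  simp [pushOff, hμ]

/-- In a triangulated sphere, the faces not containing a given face form an acyclic complex. -/
lemma IsPuncturedEuclidean.sum_not_subset {n : ℕ} {S : Finset (Finset V)}
    (h : IsPuncturedEuclidean n S) (hS : IsComplex S) {F : Finset V} (hF : F ∈ S) :
    ∑ G ∈ S with ¬ F ⊆ G, (-1 : ℤ) ^ G.card = -1 := by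
  have hF0 := hS.1 F hF
  obtain ⟨e⟩ := h _ (faceSet_subset_geomSet hS hF (baryF_mem_faceSet hF0))
  have hT : IsComplex (S.filter fun G => ¬ F ⊆ G) :=
    ⟨fun σ hσ => hS.1 σ (Finset.mem_filter.1 hσ).1, fun σ hσ τ hτ hτ0 =>
      Finset.mem_filter.2 ⟨hS.2 σ (Finset.mem_filter.1 hσ).1 τ hτ hτ0,
        fun h => (Finset.mem_filter.1 hσ).2 (h.trans hτ)⟩⟩
  have hcontr : ContractibleSpace (geomSet S \ {baryF F} : Set (V → ℝ)) := e.contractibleSpace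
  have hsub : geomSet (S.filter fun G => ¬ F ⊆ G) ⊆ geomSet S \ {baryF F} := by
    intro y hy
    refine ⟨⟨hy.1, hy.2.1, hy.2.2.1, (Finset.mem_filter.1 hy.2.2.2).1⟩, ?_⟩
    rintro rfl
    refine (Finset.mem_filter.1 hy.2.2.2).2 fun v hv => ?_
    have : F.card ≠ 0 := hF0.card_pos.ne'
    simp [baryF, hv, this]
  have hcont : Continuous fun y : (geomSet S \ {baryF F} : Set (V → ℝ)) => pushOff F hF0 y := by
    have h1 : Continuous fun y : V → ℝ => F.inf' hF0 y :=
      Continuous.finset_inf'_apply hF0 fun v _ => continuous_apply v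
    have h2 := h1.comp (continuous_subtype_val (p := (· ∈ geomSet S \ {baryF F})))
    refine continuous_pi fun v => ?_
    refine Continuous.div ?_ ?_ fun y => ?_
    · exact ((continuous_apply v).comp continuous_subtype_val).sub (h2.mul continuous_const)
    · exact continuous_const.sub (continuous_const.mul h2)
    · exact (sub_pos.2 (card_mul_inf_lt_one hF0 (geomSet_subset_faceSet y.2.1) y.2.2)).ne'
  have : ContractibleSpace (geomSet (S.filter fun G => ¬ F ⊆ G)) :=
    contractibleSpace_of_retraction (X := (geomSet S \ {baryF F} : Set (V → ℝ)))
      ⟨Set.inclusion hsub, continuous_inclusion hsub⟩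
      ⟨fun y => ⟨pushOff F hF0 y, pushOff_mem hS hF0 y.2.1 y.2.2⟩, hcont.subtype_mk _⟩
      (ContinuousMap.ext fun y => Subtype.ext (pushOff_eq_self hF0 y.2))
  exact sum_neg_one_pow_card_of_contractible hT

end Retraction

/-! ### Euler spheres and the Dehn–Sommerville equations -/

section EulerSphere

open Polynomial

variable {V : Type}

/-- The `f`-polynomial of a complex. -/
noncomputable def fPoly (S : Finset (Finset V)) : ℤ[X] := 1 + ∑ σ ∈ S, X ^ σ.card

lemma coeff_fPoly (S : Finset (Finset V)) (k : ℕ) :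
    (fPoly S).coeff k = (if k = 0 then 1 else 0) + (S.filter fun σ => σ.card = k).card := by
  simp [fPoly, coeff_one, coeff_X_pow, eq_comm]

variable [DecidableEq V]

/-- The combinatorial properties of a triangulated `N`-sphere used below. -/
structure IsEulerSphere (N : ℕ) (S : Finset (Finset V)) : Prop where
  complex : IsComplex S
  nonempty : S.Nonempty
  card_le : ∀ σ ∈ S, σ.card ≤ N + 1
  exists_facet : ∀ σ ∈ S, ∃ τ ∈ S, σ ⊆ τ ∧ τ.card = N + 1
  sum_not_subset : ∀ F ∈ S, ∑ G ∈ S with ¬ F ⊆ G, (-1 : ℤ) ^ G.card = -1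

lemma isEulerSphere_of_homeomorph [Fintype V] {N : ℕ} (hN : N ≠ 0) {S : Finset (Finset V)}
    (hS : IsComplex S)
    (h : GeomRep S ≃ₜ Metric.sphere (0 : EuclideanSpace ℝ (Fin (N + 1))) 1) :
    IsEulerSphere N S := by
  have hp := isPuncturedEuclidean_of_homeomorph h
  have hle := fun σ hσ => hp.embedsLocally.card_le hN hS (M := σ) hσ
  obtain ⟨x, hx⟩ := NormedSpace.sphere_nonempty
    (x := (0 : EuclideanSpace ℝ (Fin (N + 1)))) (r := 1) |>.2 zero_le_one
  exact ⟨hS, ⟨_, (h.symm ⟨x, hx⟩).2.2.2.2⟩, hle,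
    fun σ hσ => hp.hasCharts.exists_card_eq hS hle hσ,
    fun F hF => hp.sum_not_subset hS hF⟩

lemma subset_vertexSet {S : Finset (Finset V)} {σ : Finset V} (hσ : σ ∈ S) : σ ⊆ vertexSet S :=
  Finset.le_sup (f := id) hσ

lemma mem_vertexSet {S : Finset (Finset V)} {v : V} : v ∈ vertexSet S ↔ ∃ σ ∈ S, v ∈ σ := by
  simp [vertexSet, Finset.mem_sup]

lemma image_subset_image_of_injOn {V' : Type} {f : V' → V} {W σ τ : Finset V'}
    (hf : Set.InjOn f W) (hσ : σ ⊆ W) (hτ : τ ⊆ W) : σ.image f ⊆ τ.image f ↔ σ ⊆ τ := by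
  rw [← Finset.coe_subset, Finset.coe_image, Finset.coe_image,
    hf.image_subset_image_iff (by exact_mod_cast hσ) (by exact_mod_cast hτ), Finset.coe_subset]

lemma IsEulerSphere.image {V' : Type} [DecidableEq V'] {N : ℕ} {S : Finset (Finset V')}
    (h : IsEulerSphere N S) {f : V' → V} (hf : Set.InjOn f (vertexSet S)) :
    IsEulerSphere N (S.image (Finset.image f)) := by
  have hcard : ∀ σ ∈ S, (σ.image f).card = σ.card := fun σ hσ =>
    Finset.card_image_of_injOn (hf.mono (by exact_mod_cast subset_vertexSet hσ))
  have hsub : ∀ σ ∈ S, ∀ τ ∈ S, (σ.image f ⊆ τ.image f ↔ σ ⊆ τ) := fun σ hσ τ hτ =>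
    image_subset_image_of_injOn hf (subset_vertexSet hσ) (subset_vertexSet hτ)
  have hinj : Set.InjOn (Finset.image f) (S : Set (Finset V')) := fun σ hσ τ hτ hστ =>
    ((hsub σ hσ τ hτ).1 hστ.subset).antisymm ((hsub τ hτ σ hσ).1 hστ.superset)
  refine ⟨⟨?_, ?_⟩, h.nonempty.image _, ?_, ?_, ?_⟩
  · simpa using h.complex.1
  · simp only [Finset.forall_mem_image]
    intro σ hσ τ hτ hτ0
    obtain ⟨ρ, hρσ, rfl⟩ := Finset.subset_image_iff.1 hτ
    exact Finset.mem_image_of_mem _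
      (h.complex.2 σ hσ ρ (by exact_mod_cast hρσ) (by simpa using hτ0))
  · simp only [Finset.forall_mem_image]
    exact fun σ hσ => (hcard σ hσ).trans_le (h.card_le σ hσ)
  · simp only [Finset.forall_mem_image]
    intro σ hσ
    obtain ⟨τ, hτ, hστ, hτc⟩ := h.exists_facet σ hσ
    exact ⟨_, Finset.mem_image_of_mem _ hτ, Finset.image_subset_image hστ,
      (hcard τ hτ).trans hτc⟩
  · simp only [Finset.forall_mem_image]
    intro F hF
    refine Eq.trans ?_ (h.sum_not_subset F hF)
    rw [Finset.sum_filter, Finset.sum_filter, Finset.sum_image hinj]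
    exact Finset.sum_congr rfl fun G hG => by simp only [hcard G hG, hsub F hF G hG]

namespace IsEulerSphere

variable {N : ℕ} {S : Finset (Finset V)}

lemma sum_superset_eq (h : IsEulerSphere N S) {F : Finset V} (hF : F ∈ S) :
    ∑ G ∈ S with F ⊆ G, (-1 : ℤ) ^ G.card = 1 + ∑ G ∈ S, (-1 : ℤ) ^ G.card := by
  rw [← Finset.sum_filter_add_sum_filter_not S (F ⊆ ·), h.sum_not_subset F hF]
  ring

lemma one_add_sum (h : IsEulerSphere N S) :
    1 + ∑ G ∈ S, (-1 : ℤ) ^ G.card = (-1) ^ (N + 1) := by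
  obtain ⟨σ, hσ⟩ := h.nonempty
  obtain ⟨M, hM, -, hMc⟩ := h.exists_facet σ hσ
  have : S.filter (M ⊆ ·) = {M} := by
    ext G
    simp only [Finset.mem_filter, Finset.mem_singleton]
    exact ⟨fun hG => (Finset.eq_of_subset_of_card_le hG.2 (hMc ▸ h.card_le G hG.1)).symm,
      by rintro rfl; exact ⟨hM, subset_rfl⟩⟩
  rw [← h.sum_superset_eq hM, this, Finset.sum_singleton, hMc]

lemma sum_superset (h : IsEulerSphere N S) {F : Finset V} (hF : F ∈ S) :
    ∑ G ∈ S with F ⊆ G, (-1 : ℤ) ^ G.card = (-1) ^ (N + 1) :=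
  (h.sum_superset_eq hF).trans h.one_add_sum

/-- A ridge lies in more than one facet. -/
lemma exists_insert_ne (h : IsEulerSphere N S) {R : Finset V} (hR : R ∈ S) (hRc : R.card = N)
    (b : V) : ∃ c ∉ R, c ≠ b ∧ insert c R ∈ S := by
  by_contra! hc
  have hb : ∀ G ∈ S, R ⊆ G → G ≠ R → b ∉ R ∧ G = insert b R := by
    intro G hG hRG hne
    have hlt := Finset.card_lt_card (hRG.ssubset_of_ne hne.symm)
    have hle := h.card_le G hG
    have hcov : R ⋖ G := Finset.covBy_iff_card_sdiff_eq_one.2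
      ⟨hRG, by rw [Finset.card_sdiff_of_subset hRG]; omega⟩
    obtain ⟨c, hcR, hcG⟩ := Finset.covBy_iff_exists_insert.1 hcov
    obtain rfl : c = b := by
      by_contra hcb
      exact hc c hcR hcb (hcG ▸ hG)
    exact ⟨hcR, hcG.symm⟩
  obtain ⟨M, hM, hRM, hMc⟩ := h.exists_facet R hR
  have hMR : M ≠ R := by rintro rfl; omega
  have : S.filter (R ⊆ ·) = {R, M} := by
    ext G
    simp only [Finset.mem_filter, Finset.mem_singleton, Finset.mem_insert]
    constructor
    · rintro ⟨hG, hRG⟩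
      by_cases hne : G = R
      · exact Or.inl hne
      · exact Or.inr ((hb G hG hRG hne).2.trans (hb M hM hRM hMR).2.symm)
    · rintro (rfl | rfl)
      exacts [⟨hR, subset_rfl⟩, ⟨hM, hRM⟩]
  have hsum := h.sum_superset hR
  rw [this, Finset.sum_pair hMR.symm, hRc, hMc] at hsum
  simp at hsum

/-- A face of codimension at least two has at least three cofaces of one dimension more. -/
lemma exists_three_insert (h : IsEulerSphere N S) {E : Finset V} (hE : E ∈ S)
    (hEc : E.card + 1 ≤ N) : ∃ a b c, a ∉ E ∧ b ∉ E ∧ c ∉ E ∧ a ≠ b ∧ c ≠ a ∧ c ≠ b ∧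
      insert a E ∈ S ∧ insert b E ∈ S ∧ insert c E ∈ S := by
  obtain ⟨M, hM, hEM, hMc⟩ := h.exists_facet E hE
  have hlt : 1 < (M \ E).card := by rw [Finset.card_sdiff_of_subset hEM]; omega
  obtain ⟨a, ha, b, hb, hab⟩ := Finset.one_lt_card.1 hlt
  rw [Finset.mem_sdiff] at ha hb
  have hER : E ⊆ M.erase b := fun v hv =>
    Finset.mem_erase.2 ⟨fun h => hb.2 (h ▸ hv), hEM hv⟩
  have haR : a ∈ M.erase b := Finset.mem_erase.2 ⟨hab, ha.1⟩
  obtain ⟨c, hcR, hcb, hc⟩ := h.exists_insert_ne (R := M.erase b)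
    (h.complex.2 M hM _ (M.erase_subset b) ⟨a, haR⟩)
    (by rw [Finset.card_erase_of_mem hb.1]; omega) b
  refine ⟨a, b, c, ha.2, hb.2, fun h => hcR (hER h), hab, fun h => hcR (h ▸ haR), hcb,
    h.complex.2 M hM _ (Finset.insert_subset ha.1 hEM) (Finset.insert_nonempty _ _),
    h.complex.2 M hM _ (Finset.insert_subset hb.1 hEM) (Finset.insert_nonempty _ _),
    h.complex.2 _ hc _ (Finset.insert_subset_insert _ hER) (Finset.insert_nonempty _ _)⟩

/-- The Dehn–Sommerville equations. -/
lemma fPoly_comp (h : IsEulerSphere N S) :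
    (fPoly S).comp (-1 - X) = (-1) ^ (N + 1) * fPoly S := by
  have hmem : ∅ ∉ S := fun h0 => by simpa using h.complex.1 ∅ h0
  have hexp : ∀ σ ∈ S, (-1 - X : ℤ[X]) ^ σ.card =
      (-1) ^ σ.card + ∑ τ ∈ S with τ ⊆ σ, (-1) ^ σ.card * X ^ τ.card := by
    intro σ hσ
    have hpow : σ.powerset = insert ∅ (S.filter (· ⊆ σ)) := by
      ext τ
      simp only [Finset.mem_powerset, Finset.mem_insert, Finset.mem_filter]
      constructor
      · intro hτ
        rcases τ.eq_empty_or_nonempty with h0 | h0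
        · exact Or.inl h0
        · exact Or.inr ⟨h.complex.2 σ hσ τ hτ h0, hτ⟩
      · rintro (rfl | hτ)
        exacts [Finset.empty_subset _, hτ.2]
    have hbin := Finset.sum_pow_mul_eq_add_pow (X : ℤ[X]) 1 σ
    rw [hpow, Finset.sum_insert (by simp [hmem])] at hbin
    rw [show (-1 - X : ℤ[X]) = (-1) * (X + 1) by ring, mul_pow, ← hbin, ← Finset.mul_sum]
    simp [mul_add]
  have hsum : ∀ τ ∈ S, ∑ σ ∈ S with τ ⊆ σ, (-1 : ℤ[X]) ^ σ.card = (-1) ^ (N + 1) := by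
    intro τ hτ
    exact_mod_cast congrArg (Int.cast : ℤ → ℤ[X]) (h.sum_superset hτ)
  have hone : 1 + ∑ σ ∈ S, (-1 : ℤ[X]) ^ σ.card = (-1) ^ (N + 1) := by
    exact_mod_cast congrArg (Int.cast : ℤ → ℤ[X]) h.one_add_sum
  rw [fPoly, mul_add, Finset.mul_sum, mul_one, ← hone, add_comp, one_comp, sum_comp, hone]
  simp only [pow_comp, X_comp]
  rw [Finset.sum_congr rfl hexp, Finset.sum_add_distrib, ← add_assoc, hone]
  congr 1
  simp only [Finset.sum_filter]
  rw [Finset.sum_comm]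
  refine Finset.sum_congr rfl fun τ hτ => ?_
  rw [← hsum τ hτ, Finset.sum_mul, Finset.sum_filter]

lemma natDegree_fPoly_le (h : IsEulerSphere N S) : (fPoly S).natDegree ≤ N + 1 := by
  refine natDegree_add_le_of_degree_le (by simp)
    (natDegree_sum_le_of_forall_le _ _ fun σ hσ => ?_)
  simpa using h.card_le σ hσ

/-- The face numbers of an even-dimensional sphere are determined by the lower half of them. -/
theorem card_filter_eq {d : ℕ} {S T : Finset (Finset V)} (hS : IsEulerSphere (2 * d) S)
    (hT : IsEulerSphere (2 * d) T)
    (h : ∀ k ≤ d, (S.filter fun σ => σ.card = k).card = (T.filter fun σ => σ.card = k).card)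
    (k : ℕ) : (S.filter fun σ => σ.card = k).card = (T.filter fun σ => σ.card = k).card := by
  have hX : X ^ (d + 1) ∣ fPoly S - fPoly T := by
    rw [X_pow_dvd_iff]
    intro k hk
    simp [coeff_fPoly, h k (Nat.lt_succ_iff.1 hk)]
  have hX1 : (X + 1) ^ (d + 1) ∣ fPoly S - fPoly T := by
    obtain ⟨q, hq⟩ := hX
    have hcomp := congrArg (fun p : ℤ[X] => p.comp (-1 - X)) hq
    simp only [sub_comp, hS.fPoly_comp, hT.fPoly_comp, mul_comp, pow_comp, X_comp] at hcomp
    refine ⟨(-1) ^ (2 * d + 1) * ((-1) ^ (d + 1) * q.comp (-1 - X)), ?_⟩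
    rw [show (-1 - X : ℤ[X]) = (-1) * (X + 1) by ring, mul_pow, ← mul_sub] at hcomp
    have hsq : (-1 : ℤ[X]) ^ (2 * d + 1) * (-1) ^ (2 * d + 1) = 1 := by
      rw [← mul_pow]; simp
    calc fPoly S - fPoly T
        = (-1) ^ (2 * d + 1) * ((-1) ^ (2 * d + 1) * (fPoly S - fPoly T)) := by
          rw [← mul_assoc, hsq, one_mul]
      _ = _ := by
          rw [hcomp, show (-1 - X : ℤ[X]) = (-1) * (X + 1) by ring]
          ring
  have hcop : IsCoprime (X ^ (d + 1) : ℤ[X]) ((X + 1) ^ (d + 1)) :=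
    IsCoprime.pow ⟨-1, 1, by ring⟩
  have hmonic : (X + 1 : ℤ[X]).Monic := by simpa using monic_X_add_C (1 : ℤ)
  have hdeg1 : (X + 1 : ℤ[X]).natDegree = 1 := by simpa using natDegree_X_add_C (1 : ℤ)
  have hzero : fPoly S - fPoly T = 0 := by
    refine eq_zero_of_dvd_of_natDegree_lt (hcop.mul_dvd hX hX1) ?_
    have h1 := natDegree_sub_le_of_le hS.natDegree_fPoly_le hT.natDegree_fPoly_le
    rw [(monic_X_pow (R := ℤ) (d + 1)).natDegree_mul (hmonic.pow _), hmonic.natDegree_pow,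
      natDegree_X_pow, hdeg1]
    omega
  have := congrArg (fun p : ℤ[X] => p.coeff k) (sub_eq_zero.1 hzero)
  simpa [coeff_fPoly] using this

end IsEulerSphere

end EulerSphere

section Gluing

variable {V : Type} [DecidableEq V]

lemma mem_of_mem_glued {d : ℕ} (hd : 1 ≤ d) {S B T : Finset (Finset V)} (hS : IsComplex S)
    (hB : IsComplex B) (hT : IsEulerSphere (2 * d) T)
    (hTeq : ∀ σ, σ ∈ T ∧ σ.card ≤ d + 1 ↔ σ ∈ S ∧ σ.card ≤ d + 1 ∨ σ ∈ B)
    (hbook : ∀ E : Finset V, E.card = d → ∀ a b c, a ∉ E → b ∉ E → c ∉ E → a ≠ b → c ≠ a →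
      c ≠ b → insert a E ∈ B → insert b E ∈ B → insert c E ∉ B)
    {F : Finset V} (hF : F ∈ B) (hFd : F.card ≤ d) : F ∈ S := by
  by_contra hFS
  have hFT := (hTeq F).2 (Or.inr hF)
  have hF0 := hB.1 F hF
  obtain ⟨M, hM, hFM, hMc⟩ := hT.exists_facet F hFT.1
  obtain ⟨E, hFE, hEM, hEc⟩ := Finset.exists_subsuperset_card_eq hFM hFd (by omega)
  have hnot : ∀ G, F ⊆ G → G ∉ S := fun G hFG hG => hFS (hS.2 G hG F hFG hF0)
  have hmem : ∀ v ∉ E, insert v E ∈ T → insert v E ∈ B := fun v hv hvT =>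
    ((hTeq _).1 ⟨hvT, by rw [Finset.card_insert_of_notMem hv]; omega⟩).resolve_left
      fun h => hnot _ (hFE.trans (Finset.subset_insert v E)) h.1
  obtain ⟨a, b, c, ha, hb, hc, hab, hca, hcb, haT, hbT, hcT⟩ := hT.exists_three_insert
    (hT.complex.2 M hM E hEM (hF0.mono hFE)) (by omega)
  exact hbook E hEc a b c ha hb hc hab hca hcb (hmem a ha haT) (hmem b hb hbT) (hmem c hc hcT)

lemma glued_contradiction {d : ℕ} (hd : 1 ≤ d) {S L B T : Finset (Finset V)}
    (hS : IsEulerSphere (2 * d) S) (hLind : ∃ W : Finset V, L = S.filter fun σ => σ ⊆ W)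
    (hL : L.Nonempty) (hB : IsComplex B)
    (hbook : ∀ E : Finset V, E.card = d → ∀ a b c, a ∉ E → b ∉ E → c ∉ E → a ≠ b → c ≠ a →
      c ≠ b → insert a E ∈ B → insert b E ∈ B → insert c E ∉ B)
    (hverts : vertexSet B ∩ vertexSet S = vertexSet L) (hbdry : bdryComplex B d = L)
    (hT : IsEulerSphere (2 * d) T)
    (hTeq : ∀ σ, σ ∈ T ∧ σ.card ≤ d + 1 ↔ σ ∈ S ∧ σ.card ≤ d + 1 ∨ σ ∈ B) : False := by
  obtain ⟨W, hW⟩ := hLind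
  have hBS := fun F hF => mem_of_mem_glued hd hS.complex hB hT hTeq hbook (F := F) hF
  have hcount := hT.card_filter_eq hS (fun k hk => by
    congr 1
    ext σ
    simp only [Finset.mem_filter]
    refine and_congr_left fun hσ => ⟨fun h => ?_, fun h => ?_⟩
    · rcases (hTeq σ).1 ⟨h, by omega⟩ with h | h
      exacts [h.1, hBS σ h (by omega)]
    · exact ((hTeq σ).2 (Or.inl ⟨h, by omega⟩)).1) (d + 1)
  have hsub : S.filter (fun σ => σ.card = d + 1) ⊆ T.filter fun σ => σ.card = d + 1 := by
    intro σ hσ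
    rw [Finset.mem_filter] at hσ ⊢
    exact ⟨((hTeq σ).2 (Or.inl ⟨hσ.1, hσ.2.le⟩)).1, hσ.2⟩
  have heq := Finset.eq_of_subset_of_card_le hsub hcount.le
  obtain ⟨σ, hσ⟩ := hL
  rw [← hbdry, bdryComplex, Finset.mem_filter] at hσ
  obtain ⟨-, F, -, -, -, hF1⟩ := hσ
  obtain ⟨G, hG⟩ := Finset.card_pos.1 (hF1 ▸ Nat.one_pos)
  obtain ⟨hGB, -, hGc⟩ := Finset.mem_filter.1 hG
  have hGS : G ∈ S := by
    have : G ∈ S.filter fun σ => σ.card = d + 1 :=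
      heq ▸ Finset.mem_filter.2 ⟨((hTeq G).2 (Or.inr hGB)).1, hGc⟩
    exact (Finset.mem_filter.1 this).1
  have hGL : G ∈ L := by
    rw [hW, Finset.mem_filter]
    refine ⟨hGS, fun v hv => ?_⟩
    have hvL : v ∈ vertexSet L := hverts ▸
      Finset.mem_inter.2 ⟨subset_vertexSet hGB hv, subset_vertexSet hGS hv⟩
    obtain ⟨τ, hτ, hvτ⟩ := mem_vertexSet.1 hvL
    rw [hW, Finset.mem_filter] at hτ
    exact hτ.2 hvτ
  rw [← hbdry, bdryComplex, Finset.mem_filter] at hGL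
  obtain ⟨-, F', -, hF'c, hGF', -⟩ := hGL
  have := Finset.card_le_card hGF'
  omega

end Gluing

/-- Theorem 1.4: if `S` is a triangulated `2d`-sphere, `L` an induced subcomplex of `S`
homeomorphic to the `(d-1)`-sphere, and `B` a triangulated `d`-ball glued to `S_{≤ d}`
along `∂B = L`, then `S_{≤ d} ∪ B` is not the `d`-skeleton of any triangulated
`2d`-sphere. -/
theorem glued_ball_not_skeleton
    {V : Type} [DecidableEq V] [Fintype V] (d : ℕ) (hd : 1 ≤ d)
    (S : Finset (Finset V)) (hS : IsComplex S)
    (hSsphere : Nonempty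
      (GeomRep S ≃ₜ Metric.sphere (0 : EuclideanSpace ℝ (Fin (2 * d + 1))) 1))
    (L : Finset (Finset V)) (hLind : ∃ W : Finset V, L = S.filter fun σ => σ ⊆ W)
    (hLsphere : Nonempty
      (GeomRep L ≃ₜ Metric.sphere (0 : EuclideanSpace ℝ (Fin d)) 1))
    (B : Finset (Finset V)) (hB : IsComplex B)
    (hBball : Nonempty
      (GeomRep B ≃ₜ Metric.closedBall (0 : EuclideanSpace ℝ (Fin d)) 1))
    (hverts : vertexSet B ∩ vertexSet S = vertexSet L)
    (hbdry : bdryComplex B d = L) :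
    ¬ ∃ (V' : Type) (_ : DecidableEq V') (_ : Fintype V') (S' : Finset (Finset V')),
        IsComplex S' ∧
        Nonempty
          (GeomRep S' ≃ₜ Metric.sphere (0 : EuclideanSpace ℝ (Fin (2 * d + 1))) 1) ∧
        -- `S'_{≤ d}` is simplicially isomorphic to `K := S_{≤ d} ∪ B`
        ∃ f : V' → V, Set.InjOn f ↑(vertexSet S') ∧
          (vertexSet S').image f = vertexSet ((S.filter fun σ => σ.card ≤ d + 1) ∪ B) ∧
          ∀ σ : Finset V', σ ⊆ vertexSet S' →
            ((σ ∈ S' ∧ σ.card ≤ d + 1) ↔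
              σ.image f ∈ (S.filter fun σ => σ.card ≤ d + 1) ∪ B) := by
  rintro ⟨V', _, _, S', hS', ⟨hS'sphere⟩, f, hf, hverts', hiff⟩
  obtain ⟨hSsphere⟩ := hSsphere
  obtain ⟨hBball⟩ := hBball
  obtain ⟨hLsphere⟩ := hLsphere
  have hLne : L.Nonempty := by
    have : Nonempty (Fin d) := ⟨⟨0, hd⟩⟩
    obtain ⟨x, hx⟩ := NormedSpace.sphere_nonempty
      (x := (0 : EuclideanSpace ℝ (Fin d))) (r := 1) |>.2 zero_le_one
    exact ⟨_, (hLsphere.symm ⟨x, hx⟩).2.2.2.2⟩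
  have hBemb := embedsLocally_of_homeomorph_closedBall hBball
  refine glued_contradiction hd (isEulerSphere_of_homeomorph (by omega) hS hSsphere) hLind hLne hB
    ?_ hverts hbdry ((isEulerSphere_of_homeomorph (by omega) hS' hS'sphere).image hf)
    fun σ => ?_
  · intro E hE a b c ha hb hc hab hca hcb haB hbB hcB
    have hE0 : E.Nonempty := Finset.card_pos.1 (by omega)
    have hmem := Finset.mem_insert_self c E
    rcases hBemb.subset_of_subset hB hE hE0 ha hb hab haB hbB hcB (Finset.subset_insert c E)
      with h | h
    · exact (Finset.mem_insert.1 (h hmem)).elim hca hc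
    · exact (Finset.mem_insert.1 (h hmem)).elim hcb hc
  · have hK : ∀ σ, σ ∈ (S.filter fun σ => σ.card ≤ d + 1) ∪ B ↔
        σ ∈ S ∧ σ.card ≤ d + 1 ∨ σ ∈ B := by simp
    have hcard : ∀ σ ⊆ vertexSet S', (σ.image f).card = σ.card := fun σ hσ =>
      Finset.card_image_of_injOn (hf.mono (by exact_mod_cast hσ))
    rw [← hK, Finset.mem_image]
    constructor
    · rintro ⟨⟨ρ, hρ, rfl⟩, hc⟩
      have hsub := subset_vertexSet hρ
      exact (hiff ρ hsub).1 ⟨hρ, hcard ρ hsub ▸ hc⟩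
    · intro hσ
      obtain ⟨ρ, hρ, rfl⟩ := Finset.subset_image_iff.1 (hverts' ▸ subset_vertexSet hσ)
      have hsub : ρ ⊆ vertexSet S' := by exact_mod_cast hρ
      have := (hiff ρ hsub).2 hσ
      exact ⟨⟨ρ, this.1, rfl⟩, (hcard ρ hsub).trans_le this.2⟩
end

section
/- Let d ≥ 0 and let S be a finite abstract simplicial complex with ‖S‖ homeomorphic to S^{2d+1} (a triangulated (2d+1)-sphere). Then K := S_{≤d}, the d-skeleton of S, does not embed in the 2d-sphere: there is no continuous injective map ‖K‖ → S^{2d}. -/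
section DivisionBasis

open Module MvPolynomial

variable {σ R : Type*} [CommRing R]

/-- The polynomials all of whose monomials have `w`-weight less than `k`. -/
noncomputable def weightLT (R : Type*) [CommRing R] (w : σ → ℕ) (k : ℕ) :
    Submodule R (MvPolynomial σ R) :=
  restrictSupport R {c | Finsupp.weight w c < k}

theorem mem_weightLT {w : σ → ℕ} {k : ℕ} {f : MvPolynomial σ R} :
    f ∈ weightLT R w k ↔ ∀ c ∈ f.support, Finsupp.weight w c < k := by
  rw [weightLT, mem_restrictSupport_iff]
  rfl

theorem weightLT_mono {w : σ → ℕ} {k l : ℕ} (h : k ≤ l) : weightLT R w k ≤ weightLT R w l :=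
  fun _ hf => mem_weightLT.2 fun c hc => (mem_weightLT.1 hf c hc).trans_le h

theorem mul_mem_weightLT {w : σ → ℕ} {k l : ℕ} {f g : MvPolynomial σ R}
    (hf : f ∈ weightLT R w k) (hg : g ∈ weightLT R w (l + 1)) : f * g ∈ weightLT R w (k + l) := by
  classical
  refine mem_weightLT.2 fun c hc => ?_
  obtain ⟨a, ha, b, hb, rfl⟩ := Finset.mem_add.1 (support_mul f g hc)
  have h1 := mem_weightLT.1 hf a ha
  have h2 := mem_weightLT.1 hg b hb
  rw [map_add]
  omega

theorem monomial_mem_weightLT {w : σ → ℕ} {k : ℕ} {c : σ →₀ ℕ} (h : Finsupp.weight w c < k)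
    (r : R) : monomial c r ∈ weightLT R w k := by
  refine mem_weightLT.2 fun a ha => ?_
  rw [Finset.mem_singleton.1 (support_monomial_subset ha)]
  exact h

/-- `f` is the monomial with exponent `c` up to terms of lower `w`-weight. -/
def IsMonicAt (w : σ → ℕ) (f : MvPolynomial σ R) (c : σ →₀ ℕ) : Prop :=
  f - monomial c 1 ∈ weightLT R w (Finsupp.weight w c)

theorem IsMonicAt.mul {w : σ → ℕ} {f g : MvPolynomial σ R} {c d : σ →₀ ℕ}
    (hf : IsMonicAt w f c) (hg : IsMonicAt w g d) : IsMonicAt w (f * g) (c + d) := by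
  have key : f * g - monomial (c + d) 1 =
      (f - monomial c 1) * ((g - monomial d 1) + monomial d 1) +
        (g - monomial d 1) * monomial c 1 := by
    rw [show (monomial (c + d) (1 : R)) = monomial c 1 * monomial d 1 by
      rw [monomial_mul, one_mul]]
    ring
  rw [IsMonicAt, key, map_add]
  refine add_mem (mul_mem_weightLT hf (add_mem (weightLT_mono (Nat.le_succ _) hg)
    (monomial_mem_weightLT (Nat.lt_succ_self _) 1))) ?_
  rw [add_comm]
  exact mul_mem_weightLT hg (monomial_mem_weightLT (Nat.lt_succ_self _) 1)

theorem isMonicAt_monomial (w : σ → ℕ) (c : σ →₀ ℕ) :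
    IsMonicAt w (monomial c (1 : R)) c := by
  simp [IsMonicAt]

theorem IsMonicAt.pow {w : σ → ℕ} {f : MvPolynomial σ R} {c : σ →₀ ℕ}
    (hf : IsMonicAt w f c) (n : ℕ) : IsMonicAt w (f ^ n) (n • c) := by
  induction n with
  | zero => simpa using isMonicAt_monomial (R := R) w 0
  | succ n ih => rw [pow_succ, succ_nsmul]; exact ih.mul hf

theorem IsMonicAt.prod {ι : Type*} {w : σ → ℕ} {f : ι → MvPolynomial σ R} {c : ι → σ →₀ ℕ}
    (s : Finset ι) (hf : ∀ i ∈ s, IsMonicAt w (f i) (c i)) :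
    IsMonicAt w (∏ i ∈ s, f i) (∑ i ∈ s, c i) := by
  classical
  induction s using Finset.induction_on with
  | empty => simpa using isMonicAt_monomial (R := R) w 0
  | insert a s ha ih =>
    rw [Finset.prod_insert ha, Finset.sum_insert ha]
    exact (hf a (by simp)).mul (ih fun i hi => hf i (by simp [hi]))

variable [Fintype σ]

/-- The monomial `c` with each factor `X i ^ D i` replaced by `p i`. -/
noncomputable def powerProduct (p : σ → MvPolynomial σ R) (D : σ → ℕ) (c : σ →₀ ℕ) :
    MvPolynomial σ R :=
  ∏ i, X i ^ (c i % D i) * p i ^ (c i / D i)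

/-- The linear endomorphism replacing each factor `X i ^ D i` by `p i`. -/
noncomputable def powerProductMap (p : σ → MvPolynomial σ R) (D : σ → ℕ) :
    MvPolynomial σ R →ₗ[R] MvPolynomial σ R :=
  (basisMonomials σ R).constr R (powerProduct p D)

theorem powerProductMap_monomial (p : σ → MvPolynomial σ R) (D : σ → ℕ) (c : σ →₀ ℕ) (r : R) :
    powerProductMap p D (monomial c r) = r • powerProduct p D c := by
  have h := (basisMonomials σ R).constr_basis R (powerProduct p D) c
  rw [coe_basisMonomials] at h
  rw [show monomial c r = r • monomial c (1 : R) by rw [smul_monomial, smul_eq_mul, mul_one],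
    map_smul, powerProductMap, h]

theorem isMonicAt_powerProduct {w : σ → ℕ} {p : σ → MvPolynomial σ R} {D : σ → ℕ}
    (hp : ∀ i, IsMonicAt w (p i) (Finsupp.single i (D i))) (c : σ →₀ ℕ) :
    IsMonicAt w (powerProduct p D c) c := by
  have hX : ∀ i, IsMonicAt w (X i : MvPolynomial σ R) (Finsupp.single i 1) :=
    fun i => isMonicAt_monomial w _
  have := IsMonicAt.prod Finset.univ (fun i _ => ((hX i).pow (c i % D i)).mul ((hp i).pow (c i / D i)))
  rw [powerProduct]
  convert this using 1
  refine (Finsupp.univ_sum_single c).symm.trans (Finset.sum_congr rfl fun i _ => ?_)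
  rw [Finsupp.smul_single, Finsupp.smul_single, ← Finsupp.single_add]
  congr 1
  simp only [smul_eq_mul, mul_one]
  exact (Nat.mod_add_div' _ _).symm

theorem powerProductMap_bijective {w : σ → ℕ} {p : σ → MvPolynomial σ R} {D : σ → ℕ}
    (hp : ∀ i, IsMonicAt w (p i) (Finsupp.single i (D i))) :
    Function.Bijective (powerProductMap p D) := by
  set T : End R (MvPolynomial σ R) := 1 - powerProductMap p D with hT
  have hstep : ∀ k, ∀ f ∈ weightLT R w (k + 1), T f ∈ weightLT R w k := by
    intro k f hf
    rw [f.as_sum, map_sum]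
    refine sum_mem fun c hc => ?_
    have h1 := isMonicAt_powerProduct hp c
    have h2 : T (monomial c (coeff c f)) =
        -(coeff c f • (powerProduct p D c - monomial c 1)) := by
      rw [hT, LinearMap.sub_apply, powerProductMap_monomial, smul_sub, smul_monomial]
      simp
    rw [h2]
    exact neg_mem (Submodule.smul_mem _ _
      (weightLT_mono (Nat.lt_succ_iff.1 (mem_weightLT.1 hf c hc)) h1))
  have hzero : ∀ k, ∀ f ∈ weightLT R w k, (T ^ k) f = 0 := by
    intro k
    induction k with
    | zero =>
      intro f hf
      have : f = 0 := support_eq_empty.1 (Finset.eq_empty_of_forall_notMem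
        fun c hc => absurd (mem_weightLT.1 hf c hc) (Nat.not_lt_zero _))
      simp [this]
    | succ k ih =>
      intro f hf
      rw [pow_succ, Module.End.mul_apply]
      exact ih _ (hstep k f hf)
  have hex : ∀ f : MvPolynomial σ R, ∃ k, (T ^ k) f = 0 := fun f =>
    ⟨f.support.sup (Finsupp.weight w) + 1, hzero _ f (mem_weightLT.2 fun c hc =>
      Nat.lt_succ_iff.2 (Finset.le_sup (f := Finsupp.weight w) hc))⟩
  have hP : powerProductMap p D = 1 - T := by rw [hT]; abel
  constructor
  · rw [injective_iff_map_eq_zero]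
    intro f hf
    obtain ⟨k, hk⟩ := hex f
    have h1 : T f = f := by
      rw [hT, LinearMap.sub_apply, hf, sub_zero, Module.End.one_apply]
    rw [← hk]
    have : ∀ j, (T ^ j) f = f := by
      intro j
      induction j with
      | zero => simp
      | succ j ih => rw [pow_succ, Module.End.mul_apply, h1, ih]
    exact (this k).symm
  · intro f
    obtain ⟨k, hk⟩ := hex f
    refine ⟨(∑ i ∈ Finset.range k, T ^ i) f, ?_⟩
    rw [hP, ← Module.End.mul_apply, mul_neg_geom_sum, LinearMap.sub_apply, hk, sub_zero,
      Module.End.one_apply]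

/-- The endomorphism `powerProductMap p D` as an equivalence. -/
noncomputable def powerProductEquiv {w : σ → ℕ} {p : σ → MvPolynomial σ R} {D : σ → ℕ}
    (hp : ∀ i, IsMonicAt w (p i) (Finsupp.single i (D i))) :
    MvPolynomial σ R ≃ₗ[R] MvPolynomial σ R :=
  LinearEquiv.ofBijective _ (powerProductMap_bijective hp)

theorem mul_powerProduct (p : σ → MvPolynomial σ R) {D : σ → ℕ} (hD : ∀ i, 0 < D i) (i : σ)
    (c : σ →₀ ℕ) : p i * powerProduct p D c = powerProduct p D (c + Finsupp.single i (D i)) := by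
  classical
  rw [powerProduct, powerProduct, ← Finset.mul_prod_erase _ _ (Finset.mem_univ i),
    ← Finset.mul_prod_erase (a := i) _ (fun j => X j ^ _ * p j ^ _) (Finset.mem_univ i)]
  have : ∀ j ∈ Finset.univ.erase i, X j ^ ((c + Finsupp.single i (D i)) j % D j) *
      p j ^ ((c + Finsupp.single i (D i)) j / D j) = X j ^ (c j % D j) * p j ^ (c j / D j) := by
    intro j hj
    rw [Finsupp.add_apply, Finsupp.single_eq_of_ne (Finset.ne_of_mem_erase hj), add_zero]
  rw [Finset.prod_congr rfl this, Finsupp.add_apply, Finsupp.single_eq_same, Nat.add_mod_right,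
    Nat.add_div_right _ (hD i), pow_succ]
  ring

theorem mul_powerProductMap (p : σ → MvPolynomial σ R) {D : σ → ℕ} (hD : ∀ i, 0 < D i) (i : σ)
    (f : MvPolynomial σ R) :
    p i * powerProductMap p D f =
      powerProductMap p D (f * monomial (Finsupp.single i (D i)) 1) := by
  induction f using MvPolynomial.induction_on' with
  | monomial c r =>
    rw [monomial_mul, powerProductMap_monomial, powerProductMap_monomial, mul_smul_comm,
      mul_powerProduct p hD, mul_one]
  | add f g hf hg => rw [map_add, mul_add, hf, hg, add_mul, map_add]

/-- Division with respect to `p`: the ideal spanned by `p` consists of the polynomials without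
reduced remainder. -/
theorem mem_span_range_iff {w : σ → ℕ} {p : σ → MvPolynomial σ R} {D : σ → ℕ}
    (hD : ∀ i, 0 < D i) (hp : ∀ i, IsMonicAt w (p i) (Finsupp.single i (D i)))
    (f : MvPolynomial σ R) :
    f ∈ Ideal.span (Set.range p) ↔
      ∀ c : σ →₀ ℕ, (∀ i, c i < D i) → coeff c ((powerProductEquiv hp).symm f) = 0 := by
  constructor
  · intro hf
    induction hf using Submodule.closure_induction with
    | zero => simp
    | add f g _ _ hf hg =>
      intro c hc
      rw [map_add, coeff_add, hf c hc, hg c hc, add_zero]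
    | smul_mem g x hx =>
      obtain ⟨i, rfl⟩ := hx
      intro c hc
      obtain ⟨h, rfl⟩ := (powerProductEquiv hp).surjective g
      have : powerProductEquiv hp h • p i =
          powerProductEquiv hp (h * monomial (Finsupp.single i (D i)) 1) := by
        rw [smul_eq_mul, mul_comm]
        exact mul_powerProductMap p hD i h
      rw [this, LinearEquiv.symm_apply_apply, coeff_mul_monomial', if_neg]
      intro hle
      have := hle i
      rw [Finsupp.single_eq_same] at this
      exact absurd (hc i) (not_lt.2 this)
  · intro h
    obtain ⟨g, rfl⟩ := (powerProductEquiv hp).surjective f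
    rw [LinearEquiv.symm_apply_apply] at h
    rw [g.as_sum, map_sum]
    refine sum_mem fun c hc => ?_
    have hc' : ∃ i, D i ≤ c i := by
      by_contra! hcon
      exact (mem_support_iff.1 hc) (h c hcon)
    obtain ⟨i, hi⟩ := hc'
    change powerProductMap p D _ ∈ _
    rw [powerProductMap_monomial, smul_eq_C_mul]
    refine Ideal.mul_mem_left _ _ ?_
    have hc2 : c = (c - Finsupp.single i (D i)) + Finsupp.single i (D i) :=
      (tsub_add_cancel_of_le (Finsupp.single_le_iff.2 hi)).symm
    rw [hc2, ← mul_powerProduct p hD]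
    exact Ideal.mul_mem_right _ _ (Ideal.subset_span ⟨i, rfl⟩)

end DivisionBasis

section RealPoint

open Module

theorem exists_algHom_real_of_odd_finrank {A : Type*} [CommRing A] [Algebra ℝ A]
    [FiniteDimensional ℝ A] (hA : Odd (finrank ℝ A)) : Nonempty (A →ₐ[ℝ] ℝ) := by
  induction hk : finrank ℝ A using Nat.strong_induction_on generalizing A with
  | _ k ih =>
  have hpos : 0 < finrank ℝ A := hA.pos
  have hnt : Nontrivial A := Module.nontrivial_of_finrank_pos hpos
  by_cases hF : IsField A
  · let := hF.toField
    rcases Real.nonempty_algEquiv_or A with ⟨⟨e⟩⟩ | ⟨⟨e⟩⟩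
    · exact ⟨e.toAlgHom⟩
    · rw [e.toLinearEquiv.finrank_eq, Complex.finrank_real_complex] at hA
      exact absurd hA (by decide)
  · obtain ⟨x, hx0, hxu⟩ := Ring.exists_not_isUnit_of_not_isField hF
    let T : A →ₗ[A] A := LinearMap.toSpanSingleton A A x
    let I : Ideal A := LinearMap.range T
    let J : Ideal A := LinearMap.ker T
    have hI : I ≠ ⊤ := by
      intro h
      obtain ⟨y, hy⟩ : (1 : A) ∈ LinearMap.range T := by
        change (1 : A) ∈ I
        rw [h]; trivial
      refine hxu (IsUnit.of_mul_eq_one y ?_)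
      simpa [T, mul_comm] using hy
    have hJ : J ≠ ⊤ := by
      intro h
      have : (1 : A) ∈ J := by rw [h]; trivial
      exact hx0 (by simpa [J, T] using this)
    have e1 : finrank ℝ (A ⧸ I) + finrank ℝ I = finrank ℝ A := by
      rw [← (Submodule.Quotient.restrictScalarsEquiv ℝ I).finrank_eq]
      exact Submodule.finrank_quotient_add_finrank (I.restrictScalars ℝ)
    have e2 : finrank ℝ (A ⧸ J) = finrank ℝ I :=
      (T.quotKerEquivRange.restrictScalars ℝ).finrank_eq
    have : FiniteDimensional ℝ (A ⧸ I) :=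
      Module.Finite.of_surjective (Ideal.Quotient.mkₐ ℝ I).toLinearMap Ideal.Quotient.mk_surjective
    have : FiniteDimensional ℝ (A ⧸ J) :=
      Module.Finite.of_surjective (Ideal.Quotient.mkₐ ℝ J).toLinearMap Ideal.Quotient.mk_surjective
    have := Ideal.Quotient.nontrivial_iff.mpr hI
    have := Ideal.Quotient.nontrivial_iff.mpr hJ
    have p1 : 0 < finrank ℝ (A ⧸ I) := Module.finrank_pos
    have p2 : 0 < finrank ℝ (A ⧸ J) := Module.finrank_pos
    by_cases ho : Odd (finrank ℝ (A ⧸ I))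
    · obtain ⟨φ⟩ := ih _ (by omega) ho rfl
      exact ⟨φ.comp (Ideal.Quotient.mkₐ ℝ I)⟩
    · have ho' : Odd (finrank ℝ (A ⧸ J)) := by grind
      obtain ⟨φ⟩ := ih _ (by omega) ho' rfl
      exact ⟨φ.comp (Ideal.Quotient.mkₐ ℝ J)⟩

end RealPoint

section EvenPart

open Module MvPolynomial

variable {σ : Type*}

/-- The substitution `X i ↦ -X i`. -/
noncomputable def antipode (σ : Type*) : MvPolynomial σ ℝ →ₐ[ℝ] MvPolynomial σ ℝ :=
  aeval fun i => -X i

theorem antipode_X (i : σ) : antipode σ (X i) = -X i := aeval_X _ _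

theorem antipode_monomial (c : σ →₀ ℕ) (r : ℝ) :
    antipode σ (monomial c r) = (-1 : ℝ) ^ c.degree • monomial c r := by
  rw [antipode, aeval_monomial, monomial_eq, Finsupp.prod, Finsupp.prod, Finsupp.degree_apply]
  simp_rw [neg_pow (X _ : MvPolynomial σ ℝ)]
  rw [Finset.prod_mul_distrib, Finset.prod_pow_eq_pow_sum, smul_eq_C_mul, algebraMap_eq]
  simp only [map_pow, map_neg, map_one]
  ring

theorem coeff_antipode (c : σ →₀ ℕ) (f : MvPolynomial σ ℝ) :
    coeff c (antipode σ f) = (-1) ^ c.degree * coeff c f := by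
  classical
  induction f using MvPolynomial.induction_on' with
  | monomial d r =>
    rw [antipode_monomial, coeff_smul, coeff_monomial, smul_eq_mul]
    split_ifs with h
    · rw [h]
    · simp
  | add f g hf hg => rw [map_add, coeff_add, coeff_add, hf, hg, mul_add]

/-- The subalgebra of even polynomials. -/
noncomputable def evenSubalgebra (σ : Type*) : Subalgebra ℝ (MvPolynomial σ ℝ) :=
  AlgHom.equalizer (antipode σ) (AlgHom.id ℝ _)

theorem mem_evenSubalgebra {f : MvPolynomial σ ℝ} :
    f ∈ evenSubalgebra σ ↔ antipode σ f = f := Iff.rfl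

theorem coeff_eq_zero_of_mem_evenSubalgebra {f : MvPolynomial σ ℝ} (hf : f ∈ evenSubalgebra σ)
    {c : σ →₀ ℕ} (hc : ¬ Even c.degree) : coeff c f = 0 := by
  have h := coeff_antipode c f
  rw [mem_evenSubalgebra.1 hf, (Nat.not_even_iff_odd.1 hc).neg_one_pow] at h
  linarith

theorem monomial_mem_evenSubalgebra {c : σ →₀ ℕ} (hc : Even c.degree) (r : ℝ) :
    monomial c r ∈ evenSubalgebra σ := by
  rw [mem_evenSubalgebra, antipode_monomial, hc.neg_one_pow, one_smul]

variable [Fintype σ]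

theorem antipode_powerProductMap {p : σ → MvPolynomial σ ℝ} {D : σ → ℕ}
    (hα : ∀ i, antipode σ (p i) = (-1 : ℝ) ^ D i • p i) (f : MvPolynomial σ ℝ) :
    antipode σ (powerProductMap p D f) = powerProductMap p D (antipode σ f) := by
  induction f using MvPolynomial.induction_on' with
  | monomial c r =>
    rw [antipode_monomial, map_smul, powerProductMap_monomial, map_smul,
      smul_comm ((-1 : ℝ) ^ c.degree)]
    congr 1
    rw [powerProduct, map_prod, Finsupp.degree_eq_sum, ← Finset.prod_pow_eq_pow_sum,
      Algebra.smul_def, map_prod, ← Finset.prod_mul_distrib]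
    refine Finset.prod_congr rfl fun i _ => ?_
    rw [map_mul, map_pow, map_pow, antipode_X, hα, neg_pow, smul_pow, ← pow_mul,
      Algebra.smul_def]
    conv_rhs => rw [← Nat.mod_add_div (c i) (D i), pow_add]
    simp only [Nat.mod_add_div, map_mul, map_pow, map_neg, map_one]
    ring
  | add f g hf hg => simp only [map_add, hf, hg]

/-- The even part of the ideal spanned by `p`. -/
noncomputable def evenIdeal (p : σ → MvPolynomial σ ℝ) : Ideal (evenSubalgebra σ) :=
  (Ideal.span (Set.range p)).comap (evenSubalgebra σ).val

theorem finrank_quotient_evenIdeal {ι : Type*} [Fintype ι] {w : σ → ℕ}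
    {p : σ → MvPolynomial σ ℝ} {D : σ → ℕ} (hD : ∀ i, 0 < D i)
    (hp : ∀ i, IsMonicAt w (p i) (Finsupp.single i (D i)))
    (hα : ∀ i, antipode σ (p i) = (-1 : ℝ) ^ D i • p i)
    {κ : ι → σ →₀ ℕ} (hκ : Function.Injective κ)
    (hr : Set.range κ = {c | (∀ i, c i < D i) ∧ Even c.degree}) :
    Module.Finite ℝ (evenSubalgebra σ ⧸ evenIdeal p) ∧
      finrank ℝ (evenSubalgebra σ ⧸ evenIdeal p) = Fintype.card ι := by
  classical
  set Φ := powerProductEquiv hp with hΦ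
  have hcomm : ∀ f, antipode σ (Φ f) = Φ (antipode σ f) := antipode_powerProductMap hα
  have hsymm : ∀ f ∈ evenSubalgebra σ, Φ.symm f ∈ evenSubalgebra σ := by
    intro f hf
    rw [mem_evenSubalgebra] at hf ⊢
    apply Φ.injective
    rw [← hcomm, LinearEquiv.apply_symm_apply, hf]
  let L : evenSubalgebra σ →ₗ[ℝ] (ι → ℝ) :=
    LinearMap.pi fun b => lcoeff ℝ (κ b) ∘ₗ Φ.symm.toLinearMap ∘ₗ (evenSubalgebra σ).val.toLinearMap
  have hL : ∀ e b, L e b = coeff (κ b) (Φ.symm e) := fun e b => rfl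
  have hker : LinearMap.ker L = LinearMap.ker (Ideal.Quotient.mkₐ ℝ (evenIdeal p)).toLinearMap := by
    ext e
    rw [LinearMap.mem_ker, LinearMap.mem_ker, AlgHom.toLinearMap_apply,
      Ideal.Quotient.mkₐ_eq_mk, Ideal.Quotient.eq_zero_iff_mem, evenIdeal, Ideal.mem_comap,
      Subalgebra.coe_val, mem_span_range_iff hD hp]
    constructor
    · intro h c hc
      by_cases hev : Even c.degree
      · obtain ⟨b, rfl⟩ : c ∈ Set.range κ := by rw [hr]; exact ⟨hc, hev⟩
        exact congrFun h b
      · exact coeff_eq_zero_of_mem_evenSubalgebra (hsymm _ e.2) hev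
    · intro h
      funext b
      have : κ b ∈ Set.range κ := ⟨b, rfl⟩
      rw [hr] at this
      exact h _ this.1
  have hsurj : Function.Surjective L := by
    intro v
    have hmem : Φ (∑ b, monomial (κ b) (v b)) ∈ evenSubalgebra σ := by
      rw [mem_evenSubalgebra, hcomm, mem_evenSubalgebra.1]
      refine sum_mem fun b _ => monomial_mem_evenSubalgebra ?_ _
      have : κ b ∈ Set.range κ := ⟨b, rfl⟩
      rw [hr] at this
      exact this.2
    refine ⟨⟨_, hmem⟩, funext fun b => ?_⟩
    rw [hL, LinearEquiv.symm_apply_apply, coeff_sum]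
    simp only [coeff_monomial, hκ.eq_iff]
    simp
  have hq : Function.Surjective (Ideal.Quotient.mkₐ ℝ (evenIdeal p)).toLinearMap :=
    Ideal.Quotient.mk_surjective
  have e : (ι → ℝ) ≃ₗ[ℝ] (evenSubalgebra σ ⧸ evenIdeal p) :=
    (L.quotKerEquivOfSurjective hsurj).symm ≪≫ₗ Submodule.quotEquivOfEq _ _ hker ≪≫ₗ
      LinearMap.quotKerEquivOfSurjective _ hq
  exact ⟨Module.Finite.equiv e, by rw [← e.finrank_eq, finrank_fintype_fun_eq_card]⟩

end EvenPart

section SphereZero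

open Module MvPolynomial

variable {σ : Type*}

/-- The quadratic monomial `X i * X j` as an even polynomial. -/
noncomputable def evenXX (i j : σ) : evenSubalgebra σ :=
  ⟨X i * X j, by rw [mem_evenSubalgebra, map_mul, antipode_X, antipode_X, neg_mul_neg]⟩

theorem algHom_monomial_eq_eval {φ : evenSubalgebra σ →ₐ[ℝ] ℝ} {u : σ → ℝ}
    (hu : ∀ i j, φ (evenXX i j) = u i * u j) (n : ℕ) :
    ∀ (c : σ →₀ ℕ) (hc : c.degree = 2 * n),
      φ ⟨monomial c 1, monomial_mem_evenSubalgebra (by rw [hc]; exact even_two_mul n) 1⟩ =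
        eval u (monomial c 1) := by
  classical
  have hsplit : ∀ (c : σ →₀ ℕ) (k : ℕ), c.degree = k + 1 →
      ∃ (i : σ) (d : σ →₀ ℕ), c = d + Finsupp.single i 1 ∧ d.degree = k := by
    intro c k hc
    have hne : c ≠ 0 := by
      rintro rfl
      simp at hc
    obtain ⟨i, hi⟩ := Finsupp.ne_iff.1 hne
    have h1 : c - Finsupp.single i 1 + Finsupp.single i 1 = c :=
      tsub_add_cancel_of_le (Finsupp.single_le_iff.2 (Nat.one_le_iff_ne_zero.2 hi))
    refine ⟨i, c - Finsupp.single i 1, h1.symm, ?_⟩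
    have h2 := congrArg Finsupp.degree h1
    rw [map_add, Finsupp.degree_single, hc] at h2
    omega
  induction n with
  | zero =>
    intro c hc
    obtain rfl : c = 0 := (Finsupp.degree_eq_zero_iff c).1 hc
    have : (⟨monomial 0 1, monomial_mem_evenSubalgebra (by simp) 1⟩ : evenSubalgebra σ) = 1 := rfl
    rw [this, map_one]
    simp
  | succ n ih =>
    intro c hc
    obtain ⟨i, d, rfl, hd⟩ := hsplit c (2 * n + 1) (by omega)
    obtain ⟨j, e, rfl, he⟩ := hsplit d (2 * n) hd
    have key : (⟨monomial (e + Finsupp.single j 1 + Finsupp.single i 1) 1,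
        monomial_mem_evenSubalgebra (by rw [hc]; exact even_two_mul _) 1⟩ : evenSubalgebra σ) =
        ⟨monomial e 1, monomial_mem_evenSubalgebra (by rw [he]; exact even_two_mul n) 1⟩ *
          evenXX j i := by
      apply Subtype.ext
      change monomial (e + Finsupp.single j 1 + Finsupp.single i 1) (1 : ℝ) =
        monomial e 1 * (X j * X i)
      rw [X, X, ← mul_assoc, monomial_mul, monomial_mul]
      simp
    rw [key, map_mul, ih e he, hu, show (monomial (e + Finsupp.single j 1 + Finsupp.single i 1)
      (1 : ℝ)) = monomial e 1 * X j * X i by rw [X, X, monomial_mul, monomial_mul]; simp]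
    rw [map_mul, map_mul, eval_X, eval_X, mul_assoc]

theorem algHom_eq_eval {φ : evenSubalgebra σ →ₐ[ℝ] ℝ} {u : σ → ℝ}
    (hu : ∀ i j, φ (evenXX i j) = u i * u j) (e : evenSubalgebra σ) :
    φ e = eval u (e : MvPolynomial σ ℝ) := by
  have hev : ∀ c ∈ (e : MvPolynomial σ ℝ).support, Even c.degree := by
    intro c hc
    by_contra hcon
    exact mem_support_iff.1 hc (coeff_eq_zero_of_mem_evenSubalgebra e.2 hcon)
  have hsum : e = ∑ c ∈ (e : MvPolynomial σ ℝ).support.attach, coeff c.1 (e : MvPolynomial σ ℝ) •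
      (⟨monomial c.1 1, monomial_mem_evenSubalgebra (hev c.1 c.2) 1⟩ : evenSubalgebra σ) := by
    apply Subtype.ext
    rw [AddSubmonoidClass.coe_finsetSum]
    conv_lhs => rw [(e : MvPolynomial σ ℝ).as_sum, ← Finset.sum_attach]
    refine Finset.sum_congr rfl fun c _ => ?_
    change _ = coeff c.1 (e : MvPolynomial σ ℝ) • monomial c.1 (1 : ℝ)
    rw [smul_monomial, smul_eq_mul, mul_one]
  have hmon : ∀ (c : σ →₀ ℕ) (hc : Even c.degree),
      φ ⟨monomial c 1, monomial_mem_evenSubalgebra hc 1⟩ = eval u (monomial c 1) := by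
    intro c hc
    obtain ⟨n, hn⟩ := hc
    exact algHom_monomial_eq_eval hu n c (by omega)
  conv_lhs => rw [hsum]
  conv_rhs => rw [(e : MvPolynomial σ ℝ).as_sum, ← Finset.sum_attach]
  rw [map_sum, map_sum]
  refine Finset.sum_congr rfl fun c _ => ?_
  rw [map_smul, hmon c.1 (hev c.1 c.2), eval_monomial, eval_monomial, one_mul, smul_eq_mul]

theorem exists_point_of_algHom [Fintype σ] (φ : evenSubalgebra σ →ₐ[ℝ] ℝ)
    (hφ : ∑ i, φ (evenXX i i) = 1) :
    ∃ u : σ → ℝ, ∀ e : evenSubalgebra σ, φ e = eval u (e : MvPolynomial σ ℝ) := by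
  obtain ⟨k, hk⟩ : ∃ k, 0 < φ (evenXX k k) := by
    by_contra! h
    have := Finset.sum_nonpos fun i (_ : i ∈ Finset.univ) => h i
    linarith
  refine ⟨fun j => φ (evenXX k j) / √(φ (evenXX k k)), algHom_eq_eval fun i j => ?_⟩
  have h1 : evenXX k k * evenXX i j = evenXX k i * evenXX k j := Subtype.ext (by
    change X k * X k * (X i * X j) = X k * X i * (X k * X j)
    ring)
  have h2 := congrArg φ h1
  rw [map_mul, map_mul] at h2
  rw [div_mul_div_comm, Real.mul_self_sqrt hk.le, eq_div_iff hk.ne', ← h2, mul_comm]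

/-- The parity-completed exponents. -/
noncomputable def parityExponent {m D : ℕ} (b : Fin m → Fin D) : Fin (m + 1) →₀ ℕ :=
  Finsupp.equivFunOnFinite.symm (Fin.cons ((∑ i, (b i : ℕ)) % 2) fun i => (b i : ℕ))

theorem parityExponent_zero {m D : ℕ} (b : Fin m → Fin D) :
    parityExponent b 0 = (∑ i, (b i : ℕ)) % 2 := rfl

theorem parityExponent_succ {m D : ℕ} (b : Fin m → Fin D) (i : Fin m) :
    parityExponent b i.succ = b i := rfl

theorem parityExponent_injective (m D : ℕ) :
    Function.Injective (parityExponent : (Fin m → Fin D) → _) := by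
  intro a b h
  funext i
  apply Fin.ext
  rw [← parityExponent_succ, ← parityExponent_succ, h]

theorem range_parityExponent (m D : ℕ) :
    Set.range (parityExponent : (Fin m → Fin D) → _) =
      {c | (∀ i, c i < (Fin.cons 2 fun _ => D : Fin (m + 1) → ℕ) i) ∧ Even c.degree} := by
  ext c
  simp only [Set.mem_range, Set.mem_ofPred_eq, Finsupp.degree_eq_sum, Fin.sum_univ_succ,
    Fin.forall_fin_succ, Fin.cons_zero, Fin.cons_succ]
  constructor
  · rintro ⟨b, rfl⟩
    simp only [parityExponent_zero, parityExponent_succ]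
    refine ⟨⟨Nat.mod_lt _ two_pos, fun i => (b i).2⟩, ?_⟩
    rw [Nat.even_iff]
    omega
  · rintro ⟨⟨h0, h1⟩, h2⟩
    refine ⟨fun i => ⟨c i.succ, h1 i⟩, ?_⟩
    ext i
    refine Fin.cases ?_ (fun i => ?_) i
    · rw [parityExponent_zero]
      rw [Nat.even_iff] at h2
      dsimp only
      omega
    · rw [parityExponent_succ]

theorem mem_weightLT_of_totalDegree {m D : ℕ} {f : MvPolynomial (Fin (m + 1)) ℝ}
    (hf : 2 * f.totalDegree < D) :
    f ∈ weightLT ℝ (Fin.cons 2 fun _ => 1 : Fin (m + 1) → ℕ) D := by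
  refine mem_weightLT.2 fun c hc => lt_of_le_of_lt ?_ hf
  have h1 : c.degree ≤ f.totalDegree := by
    rw [Finsupp.degree_apply]
    exact le_totalDegree hc
  refine le_trans ?_ (Nat.mul_le_mul_left 2 h1)
  rw [Finsupp.weight_apply, Finsupp.sum, Finsupp.degree_apply, Finset.mul_sum]
  refine Finset.sum_le_sum fun i _ => ?_
  rw [smul_eq_mul, mul_comm]
  refine Nat.mul_le_mul_right _ ?_
  refine Fin.cases ?_ (fun i => ?_) i <;> simp

/-- A system `X i ^ D + f i` with `D` odd and large and all `f i` odd polynomials, having one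
variable more than equations, has a zero on the unit sphere. -/
theorem exists_sphere_zero {m D : ℕ} (hD : Odd D) (f : Fin m → MvPolynomial (Fin (m + 1)) ℝ)
    (hdeg : ∀ i, 2 * (f i).totalDegree < D) (hodd : ∀ i, antipode _ (f i) = -f i) :
    ∃ u : Fin (m + 1) → ℝ, ∑ j, u j ^ 2 = 1 ∧ ∀ i : Fin m, u i.succ ^ D + eval u (f i) = 0 := by
  set Dv : Fin (m + 1) → ℕ := Fin.cons 2 fun _ => D with hDv
  set w : Fin (m + 1) → ℕ := Fin.cons 2 fun _ => 1 with hw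
  set p : Fin (m + 1) → MvPolynomial (Fin (m + 1)) ℝ :=
    Fin.cons ((∑ j, X j ^ 2) - 1) fun i => X i.succ ^ D + f i with hpdef
  have hDpos : ∀ i, 0 < Dv i := by
    refine Fin.cases ?_ fun i => ?_
    · simp [hDv]
    · simpa [hDv] using hD.pos
  have hp : ∀ i, IsMonicAt w (p i) (Finsupp.single i (Dv i)) := by
    refine Fin.cases ?_ fun i => ?_
    · have : p 0 - monomial (Finsupp.single 0 (Dv 0)) 1 =
          (∑ i : Fin m, monomial (Finsupp.single i.succ 2) 1) - monomial 0 1 := by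
        simp only [hpdef, hDv, Fin.cons_zero, Fin.sum_univ_succ, X_pow_eq_monomial]
        rw [show (monomial 0 (1 : ℝ) : MvPolynomial (Fin (m + 1)) ℝ) = 1 from rfl]
        ring
      rw [IsMonicAt, this]
      refine sub_mem (sum_mem fun i _ => monomial_mem_weightLT ?_ 1) (monomial_mem_weightLT ?_ 1)
      · simp [Finsupp.weight_single, hw, hDv]
      · simp [Finsupp.weight_single, hw, hDv]
    · have : p i.succ - monomial (Finsupp.single i.succ (Dv i.succ)) 1 = f i := by
        simp [hpdef, hDv, X_pow_eq_monomial]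
      rw [IsMonicAt, this]
      convert mem_weightLT_of_totalDegree (hdeg i) using 1
      simp [Finsupp.weight_single, hw, hDv]
  have hα : ∀ i, antipode _ (p i) = (-1 : ℝ) ^ Dv i • p i := by
    refine Fin.cases ?_ fun i => ?_
    · simp [hpdef, hDv, antipode_X]
    · simp only [hpdef, hDv, Fin.cons_succ, hD.neg_one_pow, map_add, map_pow, antipode_X, hodd,
        hD.neg_pow]
      module
  obtain ⟨hfin, hrank⟩ := finrank_quotient_evenIdeal hDpos hp hα (parityExponent_injective m D)
    (range_parityExponent m D)
  obtain ⟨ψ⟩ : Nonempty ((evenSubalgebra (Fin (m + 1)) ⧸ evenIdeal p) →ₐ[ℝ] ℝ) :=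
    exists_algHom_real_of_odd_finrank (A := evenSubalgebra (Fin (m + 1)) ⧸ evenIdeal p) (by
      rw [hrank]
      simpa using hD.pow)
  set φ := ψ.comp (Ideal.Quotient.mkₐ ℝ (evenIdeal p)) with hφ
  have hvanish : ∀ e : evenSubalgebra (Fin (m + 1)),
      (e : MvPolynomial (Fin (m + 1)) ℝ) ∈ Ideal.span (Set.range p) → φ e = 0 := by
    intro e he
    rw [hφ, AlgHom.comp_apply, Ideal.Quotient.mkₐ_eq_mk, Ideal.Quotient.eq_zero_iff_mem.2, map_zero]
    exact he
  have hone : ∑ i, φ (evenXX i i) = 1 := by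
    have h0 : φ ((∑ i, evenXX i i) - 1) = 0 := by
      apply hvanish
      refine Ideal.subset_span ⟨0, ?_⟩
      simp only [hpdef, Fin.cons_zero, AddSubgroupClass.coe_sub, AddSubmonoidClass.coe_finsetSum,
        OneMemClass.coe_one, evenXX, pow_two]
    rw [map_sub, map_one, map_sum] at h0
    linarith
  obtain ⟨u, hu⟩ := exists_point_of_algHom φ hone
  have hnorm : ∑ j, u j ^ 2 = 1 := by
    rw [← hone]
    refine Finset.sum_congr rfl fun j _ => ?_
    rw [hu]
    simp [evenXX, pow_two]
  refine ⟨u, hnorm, fun i => ?_⟩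
  have hk : ∀ k, u k * (u i.succ ^ D + eval u (f i)) = 0 := by
    intro k
    have hmem : X k * p i.succ ∈ evenSubalgebra (Fin (m + 1)) := by
      rw [mem_evenSubalgebra, map_mul, hα, antipode_X]
      simp [hDv, hD.neg_one_pow]
    have := hvanish ⟨_, hmem⟩ (Ideal.mul_mem_left _ _ (Ideal.subset_span ⟨_, rfl⟩))
    rw [hu] at this
    simpa [hpdef] using this
  calc u i.succ ^ D + eval u (f i)
      = ∑ k, u k * (u k * (u i.succ ^ D + eval u (f i))) := by
        simp_rw [← mul_assoc, ← pow_two]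
        rw [← Finset.sum_mul, hnorm, one_mul]
    _ = 0 := by simp [hk]

end SphereZero

section BorsukUlam

open MvPolynomial

theorem eval_antipode {σ : Type*} (u : σ → ℝ) (q : MvPolynomial σ ℝ) :
    eval u (antipode σ q) = eval (-u) q := by
  induction q using MvPolynomial.induction_on with
  | C a => simp [antipode]
  | add f g hf hg => simp [hf, hg]
  | mul_X f i hf => simp [hf, antipode_X]

theorem antipode_antipode {σ : Type*} (q : MvPolynomial σ ℝ) :
    antipode σ (antipode σ q) = q := by
  induction q using MvPolynomial.induction_on with
  | C a => simp [antipode]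
  | add f g hf hg => simp [hf, hg]
  | mul_X f i hf => simp [hf, antipode_X]

theorem exists_odd_polynomial_near {n : ℕ}
    {g : Metric.sphere (0 : EuclideanSpace ℝ (Fin n)) 1 → ℝ} (hg : Continuous g)
    (hodd : ∀ u, g (-u) = -g u) {ε : ℝ} (hε : 0 < ε) :
    ∃ q : MvPolynomial (Fin n) ℝ, antipode _ q = -q ∧ ∀ u, |eval (fun i => u.1 i) q - g u| < ε := by
  let x : Fin n → C(Metric.sphere (0 : EuclideanSpace ℝ (Fin n)) 1, ℝ) :=
    fun i => ⟨fun u => u.1 i, by fun_prop⟩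
  have hx : ∀ (q : MvPolynomial (Fin n) ℝ) u, aeval x q u = eval (fun i => u.1 i) q := by
    intro q u
    induction q using MvPolynomial.induction_on with
    | C a => simp
    | add f g hf hg => simp [hf, hg]
    | mul_X f i hf => simp [hf, x]
  have hsep : (aeval x : MvPolynomial (Fin n) ℝ →ₐ[ℝ] _).range.SeparatesPoints := by
    intro u v huv
    obtain ⟨i, hi⟩ : ∃ i, u.1 i ≠ v.1 i := by
      by_contra! h
      exact huv (Subtype.ext (PiLp.ext h))
    exact ⟨x i, ⟨x i, ⟨X i, by simp⟩, rfl⟩, hi⟩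
  obtain ⟨⟨_, hr⟩, hq'⟩ :=
    ContinuousMap.exists_mem_subalgebra_near_continuous_of_separatesPoints _ hsep g hg ε hε
  obtain ⟨q, rfl⟩ := AlgHom.mem_range _ |>.1 hr
  have hq : ∀ u, |eval (fun i => u.1 i) q - g u| < ε := fun u => by
    rw [← hx]
    exact hq' u
  refine ⟨(1 / 2 : ℝ) • (q - antipode _ q), ?_, fun u => ?_⟩
  · rw [map_smul, map_sub, antipode_antipode]
    module
  · have h1 := hq u
    have h2 : |eval (-fun i => u.1 i) q + g u| < ε := by
      have := hq (-u)
      rwa [hodd, sub_neg_eq_add] at this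
    rw [smul_eval, map_sub, eval_antipode]
    rw [abs_lt] at h1 h2 ⊢
    constructor <;> linarith [h1.1, h1.2, h2.1, h2.2]

/-- The Borsuk–Ulam theorem. -/
theorem borsuk_ulam {m : ℕ}
    {H : Metric.sphere (0 : EuclideanSpace ℝ (Fin (m + 1))) 1 → EuclideanSpace ℝ (Fin m)}
    (hH : Continuous H) : ∃ u, H u = H (-u) := by
  by_contra! hne
  let G : Metric.sphere (0 : EuclideanSpace ℝ (Fin (m + 1))) 1 → Fin m → ℝ :=
    fun u i => H u i - H (-u) i
  have hG : Continuous G := by fun_prop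
  have hG0 : ∀ u, 0 < ‖G u‖ := by
    intro u
    rw [norm_pos_iff]
    intro h
    exact hne u (PiLp.ext fun i => sub_eq_zero.1 (congrFun h i))
  have hnonempty : Nonempty (Metric.sphere (0 : EuclideanSpace ℝ (Fin (m + 1))) 1) :=
    ⟨⟨EuclideanSpace.single 0 1, by simp⟩⟩
  obtain ⟨u₀, -, hu₀⟩ := isCompact_univ.exists_isMinOn
    (Set.univ_nonempty (α := Metric.sphere (0 : EuclideanSpace ℝ (Fin (m + 1))) 1))
    hG.norm.continuousOn
  set δ := ‖G u₀‖ with hδ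
  have hδ0 : 0 < δ := hG0 u₀
  have hmin : ∀ u, ¬ ∀ i, |G u i| < δ := by
    intro u h
    exact absurd ((pi_norm_lt_iff hδ0).2 h) (not_lt.2 (hu₀ (Set.mem_univ u)))
  have hq := fun i => exists_odd_polynomial_near (g := fun u => G u i) (by fun_prop)
    (fun u => by simp [G]) (half_pos hδ0)
  choose q hqodd hqnear using hq
  obtain ⟨u, hu1, hu2⟩ := exists_sphere_zero (D := 2 * (∑ i, (C (4 / δ) * q i).totalDegree) + 1)
    (odd_two_mul_add_one _) (fun i => C (4 / δ) * q i)
    (fun i => Nat.lt_succ_of_le (Nat.mul_le_mul_left 2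
      (Finset.single_le_sum (f := fun i => (C (4 / δ) * q i).totalDegree)
        (fun _ _ => Nat.zero_le _) (Finset.mem_univ i))))
    (fun i => by
      rw [map_mul, hqodd, mul_neg, antipode, ← algebraMap_eq, AlgHom.commutes])
  have hmem : WithLp.toLp 2 u ∈ Metric.sphere (0 : EuclideanSpace ℝ (Fin (m + 1))) 1 := by
    rw [mem_sphere_zero_iff_norm, EuclideanSpace.norm_eq]
    simp [hu1]
  refine hmin ⟨_, hmem⟩ fun i => ?_
  have h1 := hqnear i ⟨_, hmem⟩
  have h2 := hu2 i
  rw [map_mul, eval_C] at h2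
  have h3 : |u i.succ ^ (2 * (∑ i, (C (4 / δ) * q i).totalDegree) + 1)| ≤ 1 := by
    rw [abs_pow]
    refine pow_le_one₀ (abs_nonneg _) ((sq_le_one_iff_abs_le_one _).1 ?_)
    rw [← hu1]
    exact Finset.single_le_sum (f := fun j => u j ^ 2) (fun _ _ => sq_nonneg _) (Finset.mem_univ _)
  rw [eq_neg_of_add_eq_zero_left h2, abs_neg, abs_mul, abs_of_pos (by positivity : 0 < 4 / δ),
    div_mul_eq_mul_div, div_le_one hδ0] at h3
  change |eval u (q i) - G _ i| < δ / 2 at h1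
  rw [abs_lt] at h1 ⊢
  have h4 := abs_le.1 (show |eval u (q i)| ≤ δ / 4 by linarith)
  constructor <;> linarith [h1.1, h1.2, h4.1, h4.2]

end BorsukUlam

section Perturbation

open Module

variable {V : Type*} [Fintype V] {n : ℕ}

/-- The perturbations `M` of `β` which are constant on `A` and on `B` at some point of the unit
sphere with nonzero `k`-th coordinate. -/
def degeneratePerturbations (β : EuclideanSpace ℝ (Fin (n + 1)) → V → ℝ) (A B : Finset V)
    (k : Fin (n + 1)) : Set (Fin (n + 1) → V → ℝ) :=
  {M | ∃ x : EuclideanSpace ℝ (Fin (n + 1)), ‖x‖ = 1 ∧ x k ≠ 0 ∧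
    (∃ a, ∀ v ∈ A, (β x + ∑ j, x j • M j) v = a) ∧ ∃ b, ∀ v ∈ B, (β x + ∑ j, x j • M j) v = b}

theorem norm_smul_apply_smul {E F : Type*} [NormedAddCommGroup E] [NormedSpace ℝ E]
    [AddCommGroup F] [Module ℝ F] {β : E → F} (hodd : ∀ x, β (-x) = -β x) {x : E} (hx : ‖x‖ = 1)
    {c : ℝ} (hc : c ≠ 0) : ‖c • x‖ • β (‖c • x‖⁻¹ • c • x) = c • β x := by
  rw [norm_smul, hx, mul_one, Real.norm_eq_abs, smul_smul]
  rcases lt_or_gt_of_ne hc with h | h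
  · rw [abs_of_neg h, inv_neg, neg_mul, inv_mul_cancel₀ hc, neg_one_smul, hodd, neg_smul_neg]
  · rw [abs_of_pos h, inv_mul_cancel₀ hc, one_smul]

theorem dimH_degeneratePerturbations_le {β : EuclideanSpace ℝ (Fin (n + 1)) → V → ℝ}
    (hβ : ContDiff ℝ 1 β) (hodd : ∀ x, β (-x) = -β x) {A B : Finset V} (hAB : Disjoint A B)
    (hA : A.Nonempty) (hB : B.Nonempty) (hcard : n + 3 ≤ A.card + B.card) (k : Fin (n + 1)) :
    dimH (degeneratePerturbations β A B k) ≤ ((n + 1) * Fintype.card V - 1 : ℕ) := by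
  classical
  obtain ⟨a₀, ha₀⟩ := hA
  obtain ⟨b₀, hb₀⟩ := hB
  set S := A.erase a₀ ∪ B.erase b₀ with hS
  have hScard : S.card + 2 = A.card + B.card := by
    rw [hS, Finset.card_union_of_disjoint
      (Finset.disjoint_of_subset_left (Finset.erase_subset _ _)
        (Finset.disjoint_of_subset_right (Finset.erase_subset _ _) hAB)),
      Finset.card_erase_of_mem ha₀, Finset.card_erase_of_mem hb₀]
    have := Finset.card_pos.2 ⟨a₀, ha₀⟩
    have := Finset.card_pos.2 ⟨b₀, hb₀⟩
    omega
  have ha₀S : a₀ ∉ S := by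
    simp only [hS, Finset.mem_union, Finset.mem_erase, not_or, not_and]
    exact ⟨fun h => absurd rfl h, fun _ => Finset.disjoint_left.1 hAB ha₀⟩
  have hb₀S : b₀ ∉ S := by
    simp only [hS, Finset.mem_union, Finset.mem_erase, not_or, not_and]
    exact ⟨fun _ => Finset.disjoint_right.1 hAB hb₀, fun h => absurd rfl h⟩
  let ρ : V → {v // v ∉ S} := fun v =>
    if h : v ∉ S then ⟨v, h⟩ else if v ∈ A then ⟨a₀, ha₀S⟩ else ⟨b₀, hb₀S⟩
  let y : (Fin n → ℝ) → EuclideanSpace ℝ (Fin (n + 1)) :=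
    fun t => WithLp.toLp 2 (k.insertNth (1 : ℝ) t : Fin (n + 1) → ℝ)
  let φ : (Fin n → ℝ) × ({v // v ∉ S} → ℝ) × (Fin n → V → ℝ) → Fin (n + 1) → V → ℝ :=
    fun q => k.insertNth
      ((fun v => q.2.1 (ρ v)) - ‖y q.1‖ • β (‖y q.1‖⁻¹ • y q.1) - ∑ j, q.1 j • q.2.2 j) q.2.2
  have hy : ContDiff ℝ 1 y := by
    refine (PiLp.contDiff_toLp (p := 2)).comp (contDiff_pi.2 fun i => ?_)
    refine Fin.succAboveCases k ?_ (fun j => ?_) i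
    · simpa using contDiff_const
    · simpa using contDiff_apply ℝ ℝ j
  have hy0 : ∀ t, y t ≠ 0 := by
    intro t h
    have : y t k = 0 := by rw [h]; rfl
    simp [y] at this
  have hφ : ContDiff ℝ 1 φ := by
    refine contDiff_pi.2 fun i => ?_
    refine Fin.succAboveCases k ?_ (fun j => ?_) i
    · simp only [φ, Fin.insertNth_apply_same]
      have h1 : ContDiff ℝ 1 fun q : (Fin n → ℝ) × ({v // v ∉ S} → ℝ) × (Fin n → V → ℝ) =>
          y q.1 := hy.comp contDiff_fst
      have h2 : ContDiff ℝ 1 fun q : (Fin n → ℝ) × ({v // v ∉ S} → ℝ) × (Fin n → V → ℝ) =>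
          ‖y q.1‖ := h1.norm ℝ fun q => hy0 q.1
      refine ContDiff.sub (ContDiff.sub ?_ (h2.smul (hβ.comp ((h2.inv fun q =>
        norm_ne_zero_iff.2 (hy0 q.1)).smul h1)))) (ContDiff.sum fun j _ => ?_)
      · fun_prop
      · fun_prop
    · simp only [φ, Fin.insertNth_apply_succAbove]
      fun_prop
  have hsub : degeneratePerturbations β A B k ⊆ Set.range φ := by
    rintro M ⟨x, hx, hxk, ⟨a, ha⟩, ⟨b, hb⟩⟩
    refine ⟨⟨fun j => (x k)⁻¹ * x (k.succAbove j),
      fun v => (x k)⁻¹ * (β x + ∑ j, x j • M j) v, fun j => M (k.succAbove j)⟩, ?_⟩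
    have hyx : y (fun j => (x k)⁻¹ * x (k.succAbove j)) = (x k)⁻¹ • x := by
      ext i
      refine Fin.succAboveCases k ?_ (fun j => ?_) i
      · simp [y, hxk]
      · simp [y]
    have hρ : ∀ v, (β x + ∑ j, x j • M j) (ρ v) = (β x + ∑ j, x j • M j) v := by
      intro v
      by_cases h : v ∈ S
      · by_cases h' : v ∈ A
        · simp only [ρ, h, h', not_true_eq_false, dite_false, if_true]
          rw [ha _ ha₀, ha _ h']
        · have hvB : v ∈ B := by
            rcases Finset.mem_union.1 h with h'' | h''
            · exact absurd (Finset.mem_of_mem_erase h'') h'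
            · exact Finset.mem_of_mem_erase h''
          simp only [ρ, h, h', not_true_eq_false, dite_false, if_false]
          rw [hb _ hb₀, hb _ hvB]
      · simp only [ρ, h, not_false_eq_true, dite_true]
    funext i
    refine Fin.succAboveCases k ?_ (fun j => ?_) i
    · simp only [φ, Fin.insertNth_apply_same]
      rw [hyx, norm_smul_apply_smul hodd hx (inv_ne_zero hxk)]
      funext v
      simp only [Pi.sub_apply, hρ]
      rw [Fin.sum_univ_succAbove _ k]
      simp only [Pi.add_apply, Pi.smul_apply, Finset.sum_apply, smul_eq_mul, mul_assoc,
        ← Finset.mul_sum]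
      field_simp
      ring
    · simp only [φ, Fin.insertNth_apply_succAbove]
  refine (dimH_mono hsub).trans (hφ.dimH_range_le.trans ?_)
  have hsubcard : Fintype.card {v // v ∉ S} + S.card = Fintype.card V := by
    have h1 := Fintype.card_subtype_compl (fun v => v ∈ S)
    have h2 := Finset.card_le_univ S
    rw [Fintype.card_coe] at h1
    omega
  simp only [finrank_prod, finrank_pi_fintype, finrank_self, Finset.sum_const, Finset.card_univ,
    Fintype.card_fin, smul_eq_mul, mul_one]
  norm_cast
  rw [add_mul, one_mul]
  omega

theorem exists_nondegenerate_perturbation {β : EuclideanSpace ℝ (Fin (n + 1)) → V → ℝ}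
    (hβ : ContDiff ℝ 1 β) (hodd : ∀ x, β (-x) = -β x) {η : ℝ} (hη : 0 < η) :
    ∃ M : Fin (n + 1) → V → ℝ, (∀ k v, |M k v| < η) ∧
      ∀ A B : Finset V, Disjoint A B → A.Nonempty → B.Nonempty → n + 3 ≤ A.card + B.card →
        ∀ k, M ∉ degeneratePerturbations β A B k := by
  rcases isEmpty_or_nonempty V with hV | hV
  · exact ⟨0, by simp [hη], fun A B _ hA => (hV.false hA.choose).elim⟩
  set Z : Set (Fin (n + 1) → V → ℝ) := ⋃ (A : Finset V) (B : Finset V) (_ : Disjoint A B)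
    (_ : A.Nonempty) (_ : B.Nonempty) (_ : n + 3 ≤ A.card + B.card) (k : Fin (n + 1)),
      degeneratePerturbations β A B k with hZ
  have hdim : dimH Z < finrank ℝ (Fin (n + 1) → V → ℝ) := by
    have h1 : dimH Z ≤ ((n + 1) * Fintype.card V - 1 : ℕ) := by
      simp only [hZ, dimH_iUnion]
      exact iSup_le fun A => iSup_le fun B => iSup_le fun hAB => iSup_le fun hA => iSup_le fun hB =>
        iSup_le fun hc => iSup_le fun k => dimH_degeneratePerturbations_le hβ hodd hAB hA hB hc k
    refine h1.trans_lt ?_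
    rw [finrank_pi_fintype]
    simp only [finrank_fintype_fun_eq_card, Finset.sum_const, Finset.card_univ, Fintype.card_fin,
      smul_eq_mul]
    have : 0 < (n + 1) * Fintype.card V := Nat.mul_pos n.succ_pos Fintype.card_pos
    exact_mod_cast Nat.sub_lt this one_pos
  obtain ⟨M, hM, hMZ⟩ := (dense_compl_of_dimH_lt_finrank hdim).exists_dist_lt 0 hη
  refine ⟨M, fun k v => ?_, fun A B hAB hA hB hc k hk => hM ?_⟩
  · rw [dist_zero_left] at hMZ
    exact ((norm_le_pi_norm (M k) v).trans (norm_le_pi_norm M k)).trans_lt hMZ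
  · simp only [hZ, Set.mem_iUnion]
    exact ⟨A, B, hAB, hA, hB, hc, k, hk⟩

end Perturbation

section Truncation

variable {V : Type*} [Fintype V]

/-- The `(k + 1)`-st largest value of `z`, or `ε` if that is larger. -/
noncomputable def cutoff (ε : ℝ) (k : ℕ) (z : V → ℝ) : ℝ :=
  Finset.univ.sup' ⟨∅, Finset.mem_univ _⟩ fun A : Finset V =>
    if h : A.card = k + 1 then max ε (A.inf' (Finset.card_pos.1 (h ▸ k.succ_pos)) z) else ε

theorem le_cutoff (ε : ℝ) (k : ℕ) (z : V → ℝ) : ε ≤ cutoff ε k z := by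
  refine le_trans ?_ (Finset.le_sup' _ (Finset.mem_univ ∅))
  split_ifs
  · exact le_max_left _ _
  · exact le_rfl

theorem continuous_cutoff (ε : ℝ) (k : ℕ) : Continuous (cutoff ε k : (V → ℝ) → ℝ) := by
  refine Continuous.finset_sup'_apply _ fun A _ => ?_
  split_ifs with h
  · exact continuous_const.max (Continuous.finset_inf'_apply _ fun v _ => continuous_apply v)
  · exact continuous_const

theorem card_le_of_cutoff_lt {ε : ℝ} {k : ℕ} {z : V → ℝ} {A : Finset V}
    (hA : ∀ v ∈ A, cutoff ε k z < z v) : A.card ≤ k := by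
  by_contra! hcard
  obtain ⟨B, hBA, hB⟩ := Finset.exists_subset_card_eq (Nat.succ_le_of_lt hcard)
  have h1 : B.inf' (Finset.card_pos.1 (hB ▸ k.succ_pos)) z ≤ cutoff ε k z := by
    refine le_trans ?_ (Finset.le_sup' _ (Finset.mem_univ B))
    rw [dif_pos hB]
    exact le_max_right _ _
  refine absurd h1 (not_le.2 ?_)
  rw [Finset.lt_inf'_iff]
  exact fun v hv => hA v (hBA hv)

theorem exists_eq_cutoff {ε : ℝ} {k : ℕ} {z : V → ℝ} (hz : ∀ v, z v ≤ cutoff ε k z) {v : V}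
    (hv : ε < z v) : ∃ A : Finset V, A.card = k + 1 ∧ ∀ v ∈ A, z v = cutoff ε k z := by
  obtain ⟨A, -, hA⟩ := Finset.exists_mem_eq_sup' (⟨∅, Finset.mem_univ _⟩ : Finset.univ.Nonempty)
    fun A : Finset V =>
      if h : A.card = k + 1 then max ε (A.inf' (Finset.card_pos.1 (h ▸ k.succ_pos)) z) else ε
  have hA' : cutoff ε k z = _ := hA
  have hlt := hv.trans_le (hz v)
  split_ifs at hA' with h
  · refine ⟨A, h, fun v hv => le_antisymm (hz v) ?_⟩
    rcases max_choice ε (A.inf' (Finset.card_pos.1 (h ▸ k.succ_pos)) z) with h' | h'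
    · rw [hA', h'] at hlt
      exact absurd hlt (lt_irrefl _)
    · rw [hA', h']
      exact Finset.inf'_le _ hv
  · rw [hA'] at hlt
    exact absurd hlt (lt_irrefl _)

/-- The excess of `z` above its cutoff; it has at most `k` nonzero entries. -/
noncomputable def truncation (ε : ℝ) (k : ℕ) (z : V → ℝ) : V → ℝ :=
  fun v => max 0 (z v - cutoff ε k z)

theorem continuous_truncation (ε : ℝ) (k : ℕ) :
    Continuous (truncation ε k : (V → ℝ) → V → ℝ) :=
  continuous_pi fun v =>
    continuous_const.max ((continuous_apply v).sub (continuous_cutoff ε k))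

theorem truncation_ne_zero {ε : ℝ} {k : ℕ} {z : V → ℝ} {v : V} :
    truncation ε k z v ≠ 0 ↔ cutoff ε k z < z v := by
  rw [truncation, Ne, max_eq_left_iff, sub_nonpos, not_le]

end Truncation

section ConeMap

theorem exists_continuous_cone_map {X V E : Type} [TopologicalSpace X] [Fintype V]
    [NormedAddCommGroup E] [NormedSpace ℝ E] {K : Finset (Finset V)}
    {f : GeomRep K → Metric.sphere (0 : E) 1} (hf : Continuous f) (hinj : Function.Injective f)
    {r : X → V → ℝ} (hr : Continuous r) (hr0 : ∀ x v, 0 ≤ r x v)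
    (hK : ∀ x, r x ≠ 0 → (Finset.univ.filter fun v => r x v ≠ 0) ∈ K) :
    ∃ H : X → E, Continuous H ∧ ∀ x y, H x = H y → r x = r y := by
  classical
  set l : X → ℝ := fun x => ∑ v, r x v with hl
  have hlc : Continuous l := by fun_prop
  have hl0 : ∀ x, 0 ≤ l x := fun x => Finset.sum_nonneg fun v _ => hr0 x v
  have hrl : ∀ x, l x = 0 → r x = 0 := fun x h => funext fun v =>
    (Finset.sum_eq_zero_iff_of_nonneg fun v _ => hr0 x v).1 h v (Finset.mem_univ v)
  have hmem : ∀ x, 0 < l x → (∀ v, 0 ≤ r x v / l x) ∧ (∀ v, r x v / l x ≤ 1) ∧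
      (∑ v, r x v / l x) = 1 ∧ (Finset.univ.filter fun v => r x v / l x ≠ 0) ∈ K := by
    intro x hx
    refine ⟨fun v => div_nonneg (hr0 x v) hx.le, fun v => (div_le_one hx).2
      (Finset.single_le_sum (fun v _ => hr0 x v) (Finset.mem_univ v)), ?_, ?_⟩
    · rw [← Finset.sum_div]
      exact div_self hx.ne'
    · have hne : r x ≠ 0 := by
        intro h
        simp [hl, h] at hx
      simpa only [ne_eq, div_eq_zero_iff, hx.ne', or_false] using hK x hne
  let c : {x // 0 < l x} → GeomRep K := fun x => ⟨fun v => r x v / l x, hmem x x.2⟩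
  have hc : Continuous c := Continuous.subtype_mk (continuous_pi fun v =>
    (((continuous_apply v).comp hr).comp continuous_subtype_val).div
      (hlc.comp continuous_subtype_val) fun x => x.2.ne') _
  let H : X → E := fun x => if h : 0 < l x then l x • (f (c ⟨x, h⟩) : E) else 0
  have hHpos : ∀ x (h : 0 < l x), H x = l x • (f (c ⟨x, h⟩) : E) := fun x h => dif_pos h
  have hnorm : ∀ x, ‖H x‖ = l x := by
    intro x
    by_cases h : 0 < l x
    · rw [hHpos x h, norm_smul, mem_sphere_zero_iff_norm.1 (f _).2, mul_one, Real.norm_of_nonneg h.le]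
    · rw [show H x = 0 from dif_neg h, norm_zero]
      exact le_antisymm (hl0 x) (not_lt.1 h)
  refine ⟨H, ?_, ?_⟩
  · refine continuous_iff_continuousAt.2 fun x => ?_
    rcases (hl0 x).lt_or_eq with h | h
    · have hon : ContinuousOn H {x | 0 < l x} := by
        rw [continuousOn_iff_continuous_domRestrict]
        have : Set.domRestrict {x | 0 < l x} H = fun x : {x // 0 < l x} => l x • (f (c x) : E) :=
          funext fun x => hHpos x.1 x.2
        rw [this]
        exact (hlc.comp continuous_subtype_val).smul
          (continuous_subtype_val.comp (hf.comp hc))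
      exact hon.continuousAt ((isOpen_lt continuous_const hlc).mem_nhds h)
    · have hx : H x = 0 := by rw [← norm_eq_zero, hnorm, ← h]
      rw [ContinuousAt, hx, tendsto_zero_iff_norm_tendsto_zero]
      simp_rw [hnorm]
      have := hlc.tendsto x
      rwa [← h] at this
  · intro x y hxy
    have hlxy : l x = l y := by rw [← hnorm, ← hnorm, hxy]
    rcases (hl0 x).lt_or_eq with h | h
    · have h' : 0 < l y := hlxy ▸ h
      rw [hHpos x h, hHpos y h', ← hlxy] at hxy
      have h1 := hinj (Subtype.ext (smul_right_injective E h.ne' hxy))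
      funext v
      have h2 : r x v / l x = r y v / l y := congrFun (congrArg Subtype.val h1) v
      rwa [← hlxy, div_left_inj' h.ne'] at h2
    · rw [hrl x h.symm, hrl y (hlxy ▸ h.symm)]

end ConeMap

theorem contDiff_eval_mvPolynomial {N : ℕ} (q : MvPolynomial (Fin N) ℝ) :
    ContDiff ℝ 1 fun x : EuclideanSpace ℝ (Fin N) => MvPolynomial.eval (fun i => x i) q := by
  induction q using MvPolynomial.induction_on with
  | C a => simpa using contDiff_const
  | add f g hf hg => simpa using hf.add hg
  | mul_X f i hf => simpa using hf.mul (by fun_prop)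

/-- An odd map from a sphere to `V → ℝ` is uniformly close to an odd map which is nowhere constant
on two disjoint sets of vertices of large total size. -/
theorem exists_nondegenerate_near {V : Type*} [Fintype V] {n : ℕ}
    {a : Metric.sphere (0 : EuclideanSpace ℝ (Fin (n + 1))) 1 → V → ℝ} (ha : Continuous a)
    (hodd : ∀ u, a (-u) = -a u) {ε : ℝ} (hε : 0 < ε) :
    ∃ b : Metric.sphere (0 : EuclideanSpace ℝ (Fin (n + 1))) 1 → V → ℝ, Continuous b ∧
      (∀ u, b (-u) = -b u) ∧ (∀ u v, |b u v - a u v| < ε) ∧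
      ∀ u (A B : Finset V) (s t : ℝ), Disjoint A B → A.Nonempty → B.Nonempty →
        n + 3 ≤ A.card + B.card → (∀ v ∈ A, b u v = s) → ¬ ∀ v ∈ B, b u v = t := by
  choose q hqodd hq using fun v => exists_odd_polynomial_near (g := fun u => a u v) (by fun_prop)
    (fun u => by rw [hodd]; rfl) (half_pos hε)
  let β : EuclideanSpace ℝ (Fin (n + 1)) → V → ℝ :=
    fun x v => MvPolynomial.eval (fun i => x i) (q v)
  have hβ : ContDiff ℝ 1 β := contDiff_pi.2 fun v => contDiff_eval_mvPolynomial (q v)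
  have hβodd : ∀ x, β (-x) = -β x := by
    intro x
    funext v
    have := eval_antipode (fun i => x i) (q v)
    rw [hqodd, map_neg] at this
    exact this.symm
  have hη : 0 < ε / 2 / (n + 1) := by positivity
  obtain ⟨M, hM, hMnd⟩ := exists_nondegenerate_perturbation hβ hβodd hη
  have hβc := hβ.continuous
  refine ⟨fun u => β u + ∑ j, u.1 j • M j, by fun_prop, fun u => ?_, fun u v => ?_, ?_⟩
  · change β (-u.1) + ∑ j, (-u.1 j) • M j = _
    rw [hβodd]
    simp only [neg_smul, Finset.sum_neg_distrib, neg_add]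
  · have h1 := hq v u
    have h2 : |(∑ j, u.1 j • M j) v| ≤ ε / 2 := by
      rw [Finset.sum_apply]
      calc |∑ j, (u.1 j • M j) v| ≤ ∑ j, |(u.1 j • M j) v| := Finset.abs_sum_le_sum_abs _ _
        _ ≤ ∑ _j : Fin (n + 1), ε / 2 / (n + 1) := by
          refine Finset.sum_le_sum fun j _ => ?_
          rw [Pi.smul_apply, smul_eq_mul, abs_mul]
          have h3 : |u.1 j| ≤ 1 := by
            have := PiLp.norm_apply_le u.1 j
            rwa [mem_sphere_zero_iff_norm.1 u.2] at this
          calc |u.1 j| * |M j v| ≤ 1 * |M j v| := mul_le_mul_of_nonneg_right h3 (abs_nonneg _)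
            _ ≤ _ := by rw [one_mul]; exact (hM j v).le
        _ = ε / 2 := by
          rw [Finset.sum_const, Finset.card_univ, Fintype.card_fin, nsmul_eq_mul]
          push_cast
          field_simp
    calc |(β u.1 + ∑ j, u.1 j • M j) v - a u v|
        = |(β u.1 v - a u v) + (∑ j, u.1 j • M j) v| := by rw [Pi.add_apply]; congr 1; ring
      _ ≤ |β u.1 v - a u v| + |(∑ j, u.1 j • M j) v| := abs_add_le _ _
      _ < ε := by
        have : |β u.1 v - a u v| < ε / 2 := h1
        linarith
  · intro u A B s t hAB hA hB hcard hs ht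
    have hu := mem_sphere_zero_iff_norm.1 u.2
    obtain ⟨k, hk⟩ : ∃ k, u.1 k ≠ 0 := by
      by_contra! h
      have : u.1 = 0 := PiLp.ext h
      rw [this, norm_zero] at hu
      exact zero_ne_one hu
    exact hMnd A B hAB hA hB hcard k ⟨u.1, hu, hk, ⟨s, hs⟩, ⟨t, ht⟩⟩

/-- Theorem 1.5: the `d`-skeleton of a triangulated `(2d+1)`-sphere does not embed in the
`2d`-sphere. -/
theorem skeleton_of_odd_sphere_not_embeddable
    {V : Type} [DecidableEq V] [Fintype V] (d : ℕ)
    (S : Finset (Finset V)) (hS : IsComplex S)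
    (hSsphere : Nonempty
      (GeomRep S ≃ₜ Metric.sphere (0 : EuclideanSpace ℝ (Fin (2 * d + 2))) 1)) :
    ¬ ∃ f : GeomRep (S.filter fun σ => σ.card ≤ d + 1) →
        Metric.sphere (0 : EuclideanSpace ℝ (Fin (2 * d + 1))) 1,
      Continuous f ∧ Function.Injective f := by
  rintro ⟨f, hf, hinj⟩
  obtain ⟨h⟩ := hSsphere
  let x : Metric.sphere (0 : EuclideanSpace ℝ (Fin (2 * d + 1 + 1))) 1 → V → ℝ :=
    fun u => (h.symm u).1
  have hx : Continuous x := continuous_subtype_val.comp h.symm.continuous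
  have hx0 : ∀ u v, 0 ≤ x u v := fun u => (h.symm u).2.1
  have hxsum : ∀ u, ∑ v, x u v = 1 := fun u => (h.symm u).2.2.2.1
  have hxS : ∀ u, (Finset.univ.filter fun v => x u v ≠ 0) ∈ S := fun u => (h.symm u).2.2.2.2
  let a : Metric.sphere (0 : EuclideanSpace ℝ (Fin (2 * d + 1 + 1))) 1 → V → ℝ :=
    fun u => x u - x (-u)
  have ha : Continuous a := by fun_prop
  have haodd : ∀ u, a (-u) = -a u := fun u => by simp [a]
  have hapos : ∀ u, ∃ v, 0 < a u v := by
    intro u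
    have hne : ∃ v, a u v ≠ 0 := by
      by_contra! hcon
      have h1 : h.symm u = h.symm (-u) := Subtype.ext (funext fun v => sub_eq_zero.1 (hcon v))
      exact ne_neg_of_mem_unit_sphere ℝ u (h.symm.injective h1)
    obtain ⟨v, -, hv⟩ := Finset.exists_pos_of_sum_zero_of_exists_nonzero (s := Finset.univ) (a u)
      (by simp [a, hxsum]) (by simpa using hne)
    exact ⟨v, hv⟩
  obtain ⟨δ, hδ, haδ⟩ : ∃ δ : ℝ, 0 < δ ∧ ∀ u, ∃ v, δ ≤ a u v := by
    have hsphere : Nonempty (Metric.sphere (0 : EuclideanSpace ℝ (Fin (2 * d + 1 + 1))) 1) :=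
      ⟨⟨EuclideanSpace.single 0 1, by simp⟩⟩
    have hV : Nonempty V := ⟨(hapos hsphere.some).choose⟩
    let s : Metric.sphere (0 : EuclideanSpace ℝ (Fin (2 * d + 1 + 1))) 1 → ℝ :=
      fun u => Finset.univ.sup' Finset.univ_nonempty (a u)
    have hs : Continuous s :=
      Continuous.finset_sup'_apply _ fun v _ => (continuous_apply v).comp ha
    obtain ⟨u₀, -, hu₀⟩ := isCompact_univ.exists_isMinOn Set.univ_nonempty hs.continuousOn
    refine ⟨s u₀, ?_, fun u => ?_⟩
    · obtain ⟨v, hv⟩ := hapos u₀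
      exact hv.trans_le (Finset.le_sup' (a u₀) (Finset.mem_univ v))
    · obtain ⟨v, -, hv⟩ := Finset.exists_mem_eq_sup' Finset.univ_nonempty (a u)
      exact ⟨v, hv ▸ hu₀ (Set.mem_univ u)⟩
  obtain ⟨ε, hε, hεδ⟩ : ∃ ε : ℝ, 0 < ε ∧ ε + ε < δ := ⟨δ / 3, by positivity, by linarith⟩
  obtain ⟨b, hb, hbodd, hba, hbnd⟩ := exists_nondegenerate_near ha haodd hε
  have hεb : ∀ u, ∃ v, ε < b u v := fun u => by
    obtain ⟨v, hv⟩ := haδ u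
    exact ⟨v, by linarith [(abs_lt.1 (hba u v)).1]⟩
  have hxb : ∀ u v, ε < b u v → x u v ≠ 0 := fun u v hv h0 => by
    have h1 : a u v = x u v - x (-u) v := rfl
    linarith [(abs_lt.1 (hba u v)).2, hx0 (-u) v]
  let r := fun u => truncation ε (d + 1) (b u)
  have hK : ∀ u, r u ≠ 0 → (Finset.univ.filter fun v => r u v ≠ 0) ∈
      S.filter fun σ => σ.card ≤ d + 1 := by
    intro u hu
    have hcut : ∀ v ∈ Finset.univ.filter fun v => r u v ≠ 0, cutoff ε (d + 1) (b u) < b u v :=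
      fun v hv => truncation_ne_zero.1 (Finset.mem_filter.1 hv).2
    refine Finset.mem_filter.2 ⟨hS.2 _ (hxS u) _ (fun v hv => ?_) ?_, card_le_of_cutoff_lt hcut⟩
    · exact Finset.mem_filter.2
        ⟨Finset.mem_univ v, hxb u v ((le_cutoff ε (d + 1) (b u)).trans_lt (hcut v hv))⟩
    · obtain ⟨v, hv⟩ := Function.ne_iff.1 hu
      exact ⟨v, Finset.mem_filter.2 ⟨Finset.mem_univ v, hv⟩⟩
  obtain ⟨H, hH, hHr⟩ := exists_continuous_cone_map hf hinj
    ((continuous_truncation ε (d + 1)).comp hb) (fun u v => le_max_left _ _) hK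
  obtain ⟨u, hu⟩ := borsuk_ulam hH
  have hru : ∀ v, r u v = r (-u) v := congrFun (hHr _ _ hu)
  have hpos : ∀ w, 0 < cutoff ε (d + 1) (b w) := fun w => hε.trans_le (le_cutoff _ _ _)
  have hneg : ∀ v, b (-u) v = -b u v := fun v => by rw [hbodd]; rfl
  have hle : ∀ v, b u v ≤ cutoff ε (d + 1) (b u) := by
    intro v
    by_contra! hv
    have h1 := truncation_ne_zero.1 ((hru v).symm.trans_ne (truncation_ne_zero.2 hv))
    linarith [hneg v, hpos u, hpos (-u)]
  have hle' : ∀ v, b (-u) v ≤ cutoff ε (d + 1) (b (-u)) := by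
    intro v
    by_contra! hv
    have h1 := truncation_ne_zero.1 ((hru v).trans_ne (truncation_ne_zero.2 hv))
    linarith [hneg v, hpos u, hpos (-u)]
  obtain ⟨A, hAcard, hA⟩ := exists_eq_cutoff hle (hεb u).choose_spec
  obtain ⟨B, hBcard, hB⟩ := exists_eq_cutoff hle' (hεb (-u)).choose_spec
  refine hbnd u A B _ (-cutoff ε (d + 1) (b (-u))) ?_ (Finset.card_pos.1 (by omega))
    (Finset.card_pos.1 (by omega)) (by omega) hA fun v hv => by rw [← hB v hv, hneg, neg_neg]
  refine Finset.disjoint_left.2 fun v hvA hvB => ?_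
  linarith [hA v hvA, hB v hvB, hneg v, hpos u, hpos (-u)]
end
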